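/- Every Kleetope on n vertices admits a monotone plane arc diagram with at most ⌊(n−8)/3⌋ biarcs, where every biarc is down-up. -/

import Mathlib

open Set Bornology

noncomputable section

/-! ### Plane drawings, planarity, and triangulations

A drawing of a simple graph in the plane: vertices are distinct points, edges are
simple continuous curves between their endpoints, interiors of edges avoid vertices,
and distinct edges have disjoint interiors (no two edges cross or touch). -/

structure PlaneDrawing {V : Type} (G : SimpleGraph V) where
  vert : V → ℝ × ℝ
  edge : Sym2 V → ℝ → ℝ × ℝ
  vert_inj : Function.Injective vert
  edge_cont : ∀ e ∈ G.edgeSet, ContinuousOn (edge e) (Set.Icc 0 1)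
  edge_injOn : ∀ e ∈ G.edgeSet, Set.InjOn (edge e) (Set.Icc 0 1)
  edge_ends : ∀ a b : V, G.Adj a b →
    ({edge s(a, b) 0, edge s(a, b) 1} : Set (ℝ × ℝ)) = {vert a, vert b}
  edge_int_vert : ∀ e ∈ G.edgeSet, ∀ x : V, vert x ∉ edge e '' Set.Ioo 0 1
  edge_disjoint : ∀ e ∈ G.edgeSet, ∀ f ∈ G.edgeSet, e ≠ f →
    edge e '' Set.Ioo 0 1 ∩ edge f '' Set.Ioo 0 1 = ∅

/-- A graph is planar if it admits a crossing-free drawing in the plane. -/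
def IsPlanar {V : Type} (G : SimpleGraph V) : Prop := Nonempty (PlaneDrawing G)

/-- A (plane) triangulation: a maximal planar graph on at least three vertices. -/
def IsTriangulation {V : Type} [Fintype V] (G : SimpleGraph V) : Prop :=
  3 ≤ Fintype.card V ∧ IsPlanar G ∧
    ∀ a b : V, a ≠ b → ¬ G.Adj a b →
      ¬ IsPlanar (G ⊔ SimpleGraph.fromEdgeSet {s(a, b)})

/-- The edges of `G` with both endpoints in `W`. -/
def edgesWithin {V : Type} (G : SimpleGraph V) (W : Set V) : Set (Sym2 V) :=
  {e | e ∈ G.edgeSet ∧ ∀ x ∈ e, x ∈ W}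

/-- The neighbours of `x` that lie in `W`. -/
def nbrsIn {V : Type} (G : SimpleGraph V) (W : Set V) (x : V) : Set V :=
  {y | y ∈ W ∧ G.Adj x y}

namespace PlaneDrawing

variable {V : Type} {G : SimpleGraph V}

def edgeImage (D : PlaneDrawing G) (e : Sym2 V) : Set (ℝ × ℝ) :=
  D.edge e '' Set.Icc 0 1

/-- The union of all vertex points and edge curves of the sub-drawing induced by `W`. -/
def imageOn (D : PlaneDrawing G) (W : Set V) : Set (ℝ × ℝ) :=
  D.vert '' W ∪ ⋃ e ∈ edgesWithin G W, D.edgeImage e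

/-- The outer face `F∘` of the sub-drawing induced by `W`: the union of the unbounded
connected components of the complement of the drawing. -/
def outerRegion (D : PlaneDrawing G) (W : Set V) : Set (ℝ × ℝ) :=
  {p | p ∉ D.imageOn W ∧ ¬ IsBounded (connectedComponentIn (D.imageOn W)ᶜ p)}

/-- The vertex `x` lies on the boundary cycle `C∘` of the outer face of `G[W]`. -/
def OnOuterVertex (D : PlaneDrawing G) (W : Set V) (x : V) : Prop :=
  D.vert x ∈ frontier (D.outerRegion W)

/-- The edge `e` lies on the boundary cycle `C∘` of the outer face of `G[W]`. -/
def OnOuterEdge (D : PlaneDrawing G) (W : Set V) (e : Sym2 V) : Prop :=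
  e ∈ edgesWithin G W ∧ D.edgeImage e ⊆ frontier (D.outerRegion W)

/-- The triangle `abc` bounds a face of the full drawing. -/
def IsFacialTriangle (D : PlaneDrawing G) (a b c : V) : Prop :=
  G.Adj a b ∧ G.Adj b c ∧ G.Adj a c ∧
    ∃ p, p ∉ D.imageOn Set.univ ∧
      frontier (connectedComponentIn (D.imageOn Set.univ)ᶜ p) =
        D.edgeImage s(a, b) ∪ D.edgeImage s(b, c) ∪ D.edgeImage s(a, c)

/-- Every inner (bounded) face of the sub-drawing induced by `W` is bounded by a
triangle of `G[W]`. -/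
def InnerFacesTriangulated (D : PlaneDrawing G) (W : Set V) : Prop :=
  ∀ p, p ∉ D.imageOn W → IsBounded (connectedComponentIn (D.imageOn W)ᶜ p) →
    ∃ a ∈ W, ∃ b ∈ W, ∃ c ∈ W, G.Adj a b ∧ G.Adj b c ∧ G.Adj a c ∧
      frontier (connectedComponentIn (D.imageOn W)ᶜ p) =
        D.edgeImage s(a, b) ∪ D.edgeImage s(b, c) ∪ D.edgeImage s(a, c)

end PlaneDrawing

/-- A graph is biconnected if it is connected and has no cut vertex. -/
def Biconnected {α : Type} (H : SimpleGraph α) : Prop :=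
  H.Connected ∧ ∀ x : α, (H.induce {y | y ≠ x}).Connected

/-- The subgraph of `G` induced by `W` (with the drawing `D`) is internally
triangulated: biconnected and every inner face is a triangle. -/
def InternallyTriangulatedOn {V : Type} {G : SimpleGraph V}
    (D : PlaneDrawing G) (W : Set V) : Prop :=
  Biconnected (G.induce W) ∧ D.InnerFacesTriangulated W

/-! ### Canonical orderings -/

/-- The vertex set `V_i = {v 1, …, v i}`. -/
def Vset {V : Type} (v : ℕ → V) (i : ℕ) : Set V := v '' Set.Icc 1 i

/-- `v 1, …, v i` is a canonical ordering for `G_i` (conditions (C1)–(C3)). -/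
def IsCanonicalOrdering {V : Type} {G : SimpleGraph V} (D : PlaneDrawing G)
    (i : ℕ) (v : ℕ → V) : Prop :=
  3 ≤ i ∧ Set.InjOn v (Set.Icc 1 i) ∧ G.Adj (v 1) (v 2) ∧
    ∀ m, 3 ≤ m → m ≤ i →
      InternallyTriangulatedOn D (Vset v m) ∧
      D.OnOuterEdge (Vset v m) s(v 1, v 2) ∧
      ∀ j, m < j → j ≤ i → D.vert (v j) ∈ D.outerRegion (Vset v m)

/-- The canonical ordering `v 1, …, v i` is extensible: it can be completed to a
canonical ordering of the whole graph. -/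
def ExtensibleOrd {V : Type} [Fintype V] {G : SimpleGraph V} (D : PlaneDrawing G)
    (i : ℕ) (v : ℕ → V) : Prop :=
  ∃ w : ℕ → V, (∀ m, 1 ≤ m → m ≤ i → w m = v m) ∧
    Set.BijOn w (Set.Icc 1 (Fintype.card V)) Set.univ ∧
    IsCanonicalOrdering D (Fintype.card V) w

/-- Append `x` to the sequence `v` at position `i + 1`. -/
def extendSeq {V : Type} (v : ℕ → V) (i : ℕ) (x : V) : ℕ → V :=
  fun m => if m = i + 1 then x else v m

/-- A vertex `x ∉ V_i` is eligible for `G_i` if appending it yields an extensible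
canonical ordering for `G_{i+1}`. -/
def Eligible {V : Type} [Fintype V] {G : SimpleGraph V} (D : PlaneDrawing G)
    (i : ℕ) (v : ℕ → V) (x : V) : Prop :=
  x ∉ Vset v i ∧ IsCanonicalOrdering D (i + 1) (extendSeq v i x) ∧
    ExtensibleOrd D (i + 1) (extendSeq v i x)

open Classical in
/-- The region `R_i(x)` associated to a vertex `x ∉ W` (with `W = V_i`): the outer
face of `G[W]` if `x` has at most one neighbour in `W`, and otherwise the part of the
outer face cut off from infinity by the edges from `x` to its neighbours on the
outer path. -/
def Rregion {V : Type} {G : SimpleGraph V} (D : PlaneDrawing G)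
    (W : Set V) (x : V) : Set (ℝ × ℝ) :=
  if (nbrsIn G W x).Subsingleton then D.outerRegion W
  else
    {p | p ∈ D.outerRegion W ∧
      p ∉ (⋃ y ∈ nbrsIn G W x, D.edgeImage s(x, y)) ∧
      IsBounded (connectedComponentIn
        (D.imageOn W ∪ ⋃ y ∈ nbrsIn G W x, D.edgeImage s(x, y))ᶜ p)}

/-- The open region `X_j` spanned by `u` and the part of the outer path between two
consecutive neighbours `a`, `b` of `u`. -/
def Xregion {V : Type} {G : SimpleGraph V} (D : PlaneDrawing G)
    (W : Set V) (u a b : V) : Set (ℝ × ℝ) :=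
  {p | p ∈ D.outerRegion W ∧
    p ∉ D.edgeImage s(u, a) ∪ D.edgeImage s(u, b) ∧
    IsBounded (connectedComponentIn
      (D.imageOn W ∪ D.edgeImage s(u, a) ∪ D.edgeImage s(u, b))ᶜ p)}

/-! ### Arc diagrams

Vertices are placed on a horizontal spine.  Every edge is drawn as a *mountain*
(a proper arc, i.e. halfcircle, above the spine), a *pocket* (a proper arc below the
spine), or a *down-up biarc* (two halfcircles, crossing the spine exactly once, the
left halfcircle below and the right halfcircle above the spine).  In particular all
edges are x-monotone and every biarc is down-up monotone.  Each edge also carries an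
amount of credits (used only for the credit-scheme lemmas). -/

inductive ArcKind : Type
  | mountain
  | pocket
  | biarc
deriving DecidableEq

structure ArcDiagram (V : Type) where
  pos : V → ℝ
  kind : Sym2 V → ArcKind
  crossPt : Sym2 V → ℝ
  credit : Sym2 V → ℝ

/-- Two intervals interleave (so that halfcircles over them on the same side of the
spine cross). -/
def Interleaved (p q : ℝ × ℝ) : Prop := p.1 < q.1 ∧ q.1 < p.2 ∧ p.2 < q.2

/-- The height above (or depth below) the spine, at abscissa `x`, of the halfcircle
with diameter from `l` to `r` centered on the spine. -/
def arcHeight (l r x : ℝ) : ℝ := Real.sqrt (((r - l) / 2) ^ 2 - (x - (l + r) / 2) ^ 2)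

namespace ArcDiagram

variable {V : Type}

def lo (A : ArcDiagram V) (e : Sym2 V) : ℝ :=
  Sym2.lift ⟨fun a b => min (A.pos a) (A.pos b), fun _ _ => min_comm _ _⟩ e

def hi (A : ArcDiagram V) (e : Sym2 V) : ℝ :=
  Sym2.lift ⟨fun a b => max (A.pos a) (A.pos b), fun _ _ => max_comm _ _⟩ e

/-- The halfcircles of the edge `e` above the spine (as intervals on the spine). -/
def upperArcs (A : ArcDiagram V) (e : Sym2 V) : List (ℝ × ℝ) :=
  match A.kind e with
  | ArcKind.mountain => [(A.lo e, A.hi e)]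
  | ArcKind.pocket => []
  | ArcKind.biarc => [(A.crossPt e, A.hi e)]

/-- The halfcircles of the edge `e` below the spine (as intervals on the spine). -/
def lowerArcs (A : ArcDiagram V) (e : Sym2 V) : List (ℝ × ℝ) :=
  match A.kind e with
  | ArcKind.mountain => []
  | ArcKind.pocket => [(A.lo e, A.hi e)]
  | ArcKind.biarc => [(A.lo e, A.crossPt e)]

/-- `A` is a plane arc diagram of the subgraph of `G` induced by `W`: vertex
positions on the spine are distinct, spine crossings of biarcs are in the interior
of the edge's span and distinct from all vertices and from each other, and no two
halfcircles on the same side of the spine cross. -/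
def IsPlaneOn (A : ArcDiagram V) (G : SimpleGraph V) (W : Set V) : Prop :=
  Set.InjOn A.pos W ∧
  (∀ e ∈ edgesWithin G W, A.kind e = ArcKind.biarc →
      A.lo e < A.crossPt e ∧ A.crossPt e < A.hi e ∧ ∀ x ∈ W, A.crossPt e ≠ A.pos x) ∧
  (∀ e ∈ edgesWithin G W, ∀ f ∈ edgesWithin G W, e ≠ f →
      A.kind e = ArcKind.biarc → A.kind f = ArcKind.biarc → A.crossPt e ≠ A.crossPt f) ∧
  (∀ e ∈ edgesWithin G W, ∀ f ∈ edgesWithin G W, e ≠ f →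
      (∀ p ∈ A.upperArcs e, ∀ q ∈ A.upperArcs f, ¬ Interleaved p q) ∧
      (∀ p ∈ A.lowerArcs e, ∀ q ∈ A.lowerArcs f, ¬ Interleaved p q))

/-- The number of biarcs of the diagram (on the subgraph induced by `W`). -/
def biarcCount (A : ArcDiagram V) (G : SimpleGraph V) (W : Set V) : ℕ :=
  {e | e ∈ edgesWithin G W ∧ A.kind e = ArcKind.biarc}.ncard

/-- The cost of the diagram: the total amount of credits on its edges. -/
def cost (A : ArcDiagram V) (G : SimpleGraph V) (W : Set V) : ℝ :=
  ∑ᶠ e ∈ edgesWithin G W, A.credit e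

/-- The edge `e` is (partly) vertically visible from above. -/
def OnUpperEnvelope (A : ArcDiagram V) (G : SimpleGraph V) (W : Set V)
    (e : Sym2 V) : Prop :=
  e ∈ edgesWithin G W ∧ ∃ p ∈ A.upperArcs e, ∃ x : ℝ, p.1 < x ∧ x < p.2 ∧
    ∀ f ∈ edgesWithin G W, f ≠ e → ∀ q ∈ A.upperArcs f, q.1 < x → x < q.2 →
      arcHeight q.1 q.2 x < arcHeight p.1 p.2 x

/-- The edge `e` is (partly) vertically visible from below. -/
def OnLowerEnvelope (A : ArcDiagram V) (G : SimpleGraph V) (W : Set V)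
    (e : Sym2 V) : Prop :=
  e ∈ edgesWithin G W ∧ ∃ p ∈ A.lowerArcs e, ∃ x : ℝ, p.1 < x ∧ x < p.2 ∧
    ∀ f ∈ edgesWithin G W, f ≠ e → ∀ q ∈ A.lowerArcs f, q.1 < x → x < q.2 →
      arcHeight q.1 q.2 x < arcHeight p.1 p.2 x

end ArcDiagram

/-! ### The invariants (I1)–(I5) of valid resp. extensible arc diagrams -/

/-- Invariants (I1)–(I4): `A` is a valid arc diagram for the subgraph of `G` induced
by `W` (relative to the plane embedding `D` of `G`, the starting vertices `v1, v2`,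
and the constant `χ`).  (I1) every edge is a proper arc or a down-up biarc and every
edge on the upper envelope is a proper arc; (I2) every mountain whose left endpoint
lies on `C∘(G[W]) \ {v2}` carries one credit; (I3) every biarc carries one credit;
(I4) every pocket on `P∘(G[W])` carries `χ` credits. -/
def ValidDiagram {V : Type} {G : SimpleGraph V} (D : PlaneDrawing G)
    (W : Set V) (v1 v2 : V) (χ : ℝ) (A : ArcDiagram V) : Prop :=
  A.IsPlaneOn G W ∧
  (∀ e ∈ edgesWithin G W, 0 ≤ A.credit e) ∧
  (∀ e, A.OnUpperEnvelope G W e → A.kind e ≠ ArcKind.biarc) ∧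
  (∀ a b : V, a ∈ W → b ∈ W → G.Adj a b → A.kind s(a, b) = ArcKind.mountain →
      A.pos a < A.pos b → D.OnOuterVertex W a → a ≠ v2 → 1 ≤ A.credit s(a, b)) ∧
  (∀ e ∈ edgesWithin G W, A.kind e = ArcKind.biarc → 1 ≤ A.credit e) ∧
  (∀ e ∈ edgesWithin G W, A.kind e = ArcKind.pocket → D.OnOuterEdge W e →
      e ≠ s(v1, v2) → χ ≤ A.credit e)

/-- Invariants (I1)–(I5): additionally `v1` is leftmost and `v2` rightmost on the
spine, the edge `v1 v2` forms the lower envelope, and the edges of `P∘(G[W])` form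
the upper envelope. -/
def ExtensibleDiagram {V : Type} {G : SimpleGraph V} (D : PlaneDrawing G)
    (W : Set V) (v1 v2 : V) (χ : ℝ) (A : ArcDiagram V) : Prop :=
  ValidDiagram D W v1 v2 χ A ∧ v1 ∈ W ∧ v2 ∈ W ∧
  (∀ w ∈ W, w ≠ v1 → A.pos v1 < A.pos w) ∧
  (∀ w ∈ W, w ≠ v2 → A.pos w < A.pos v2) ∧
  (∀ e ∈ edgesWithin G W, (A.OnLowerEnvelope G W e ↔ e = s(v1, v2))) ∧
  (∀ e ∈ edgesWithin G W, (A.OnUpperEnvelope G W e ↔ D.OnOuterEdge W e ∧ e ≠ s(v1, v2)))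

/-! ### Profiles, problematic vertices, pivots and the covering relation -/

/-- `x` has type `T(2, ⌢)`: degree two in `G_{i+1}` and its profile is a single
mountain. -/
def TypeT2 {V : Type} (A : ArcDiagram V) (G : SimpleGraph V) (W : Set V)
    (x : V) : Prop :=
  ∃ a b : V, nbrsIn G W x = {a, b} ∧ A.pos a < A.pos b ∧ G.Adj a b ∧
    A.kind s(a, b) = ArcKind.mountain

/-- `x` has type `T(3, ⌢⌢)`. -/
def TypeT3mm {V : Type} (A : ArcDiagram V) (G : SimpleGraph V) (W : Set V)
    (x : V) : Prop :=
  ∃ a b c : V, nbrsIn G W x = {a, b, c} ∧ A.pos a < A.pos b ∧ A.pos b < A.pos c ∧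
    G.Adj a b ∧ G.Adj b c ∧
    A.kind s(a, b) = ArcKind.mountain ∧ A.kind s(b, c) = ArcKind.mountain

/-- `x` has type `T(4, ⌢⌢⌢)`. -/
def TypeT4 {V : Type} (A : ArcDiagram V) (G : SimpleGraph V) (W : Set V)
    (x : V) : Prop :=
  ∃ a b c d : V, nbrsIn G W x = {a, b, c, d} ∧
    A.pos a < A.pos b ∧ A.pos b < A.pos c ∧ A.pos c < A.pos d ∧
    G.Adj a b ∧ G.Adj b c ∧ G.Adj c d ∧
    A.kind s(a, b) = ArcKind.mountain ∧ A.kind s(b, c) = ArcKind.mountain ∧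
    A.kind s(c, d) = ArcKind.mountain

/-- `x` has type `T(3, ⌢⌣)`. -/
def TypeT3ms {V : Type} (A : ArcDiagram V) (G : SimpleGraph V) (W : Set V)
    (x : V) : Prop :=
  ∃ a b c : V, nbrsIn G W x = {a, b, c} ∧ A.pos a < A.pos b ∧ A.pos b < A.pos c ∧
    G.Adj a b ∧ G.Adj b c ∧
    A.kind s(a, b) = ArcKind.mountain ∧ A.kind s(b, c) = ArcKind.pocket

/-- An eligible vertex is problematic if it has one of the four types
`T(2,⌢)`, `T(3,⌢⌢)`, `T(4,⌢⌢⌢)`, `T(3,⌢⌣)`. -/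
def Problematic {V : Type} (A : ArcDiagram V) (G : SimpleGraph V) (W : Set V)
    (x : V) : Prop :=
  TypeT2 A G W x ∨ TypeT3mm A G W x ∨ TypeT4 A G W x ∨ TypeT3ms A G W x

def HasLeftPivotType {V : Type} (A : ArcDiagram V) (G : SimpleGraph V) (W : Set V)
    (x : V) : Prop :=
  TypeT2 A G W x ∨ TypeT3mm A G W x ∨ TypeT4 A G W x

def HasRightPivotType {V : Type} (A : ArcDiagram V) (G : SimpleGraph V) (W : Set V)
    (x : V) : Prop :=
  TypeT3ms A G W x

def IsLeftmostNbr {V : Type} (A : ArcDiagram V) (G : SimpleGraph V) (W : Set V)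
    (x l : V) : Prop :=
  l ∈ nbrsIn G W x ∧ ∀ y ∈ nbrsIn G W x, A.pos l ≤ A.pos y

def IsRightmostNbr {V : Type} (A : ArcDiagram V) (G : SimpleGraph V) (W : Set V)
    (x r : V) : Prop :=
  r ∈ nbrsIn G W x ∧ ∀ y ∈ nbrsIn G W x, A.pos y ≤ A.pos r

/-- `q` is the pivot `p(x)` of the problematic vertex `x`: its rightmost neighbour on
the outer path if `x` has right pivot type `T(3,⌢⌣)`, its leftmost neighbour
otherwise. -/
def IsPivot {V : Type} (A : ArcDiagram V) (G : SimpleGraph V) (W : Set V)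
    (x q : V) : Prop :=
  (HasRightPivotType A G W x ∧ IsRightmostNbr A G W x q) ∨
  (HasLeftPivotType A G W x ∧ IsLeftmostNbr A G W x q)

/-- `z = pc(x)`: the vertex covering the pivot edge `x·p(x)`, i.e. the vertex outside
`W ∪ {x}` forming a triangular face of `G` with this edge. -/
def PivotCover {V : Type} {G : SimpleGraph V} (D : PlaneDrawing G) (A : ArcDiagram V)
    (W : Set V) (x z : V) : Prop :=
  z ∉ W ∧ z ≠ x ∧ ∃ q : V, IsPivot A G W x q ∧ D.IsFacialTriangle x q z

/-- `z` covers the edge `e` of the outer path: `z ∉ W` forms a triangular face of `G`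
with the two endpoints of `e`. -/
def CoversEdge {V : Type} {G : SimpleGraph V} (D : PlaneDrawing G)
    (W : Set V) (z : V) (e : Sym2 V) : Prop :=
  z ∉ W ∧ ∃ a b : V, e = s(a, b) ∧ D.IsFacialTriangle a b z

/-- `a` and `b` are consecutive neighbours (from left to right) of `x` in `W`. -/
def ConsecNbrs {V : Type} (A : ArcDiagram V) (G : SimpleGraph V) (W : Set V)
    (x a b : V) : Prop :=
  a ∈ nbrsIn G W x ∧ b ∈ nbrsIn G W x ∧ A.pos a < A.pos b ∧
    ∀ c ∈ nbrsIn G W x, ¬ (A.pos a < A.pos c ∧ A.pos c < A.pos b)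

/-- `e` is an edge of the profile `pr(x)`: an edge of the outer path between two
consecutive neighbours of `x`. -/
def ProfileEdge {V : Type} (A : ArcDiagram V) (G : SimpleGraph V) (W : Set V)
    (x : V) (e : Sym2 V) : Prop :=
  ∃ a b : V, e = s(a, b) ∧ ConsecNbrs A G W x a b ∧ G.Adj a b

/-! ### Construction sequences of planar 3-trees and their dual face trees -/

/-- A construction sequence of a planar 3-tree `G`: starting from the triangle on the
first three vertices, each subsequent vertex `ord j` is inserted into a face `F j`
(a triangle of three earlier vertices that was created earlier and not yet
subdivided) and joined to its three vertices. -/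
structure P3TConstruction (V : Type) [Fintype V] [DecidableEq V]
    (G : SimpleGraph V) where
  n : ℕ
  three_le : 3 ≤ n
  card_eq : Fintype.card V = n
  ord : Fin n ≃ V
  F : Fin n → Finset V
  adj_base : ∀ i j : Fin n, (i : ℕ) < 3 → (j : ℕ) < 3 → (G.Adj (ord i) (ord j) ↔ i ≠ j)
  adj_ins : ∀ j : Fin n, 3 ≤ (j : ℕ) → ∀ i : Fin n, i < j →
    (G.Adj (ord i) (ord j) ↔ ord i ∈ F j)
  F_card : ∀ j : Fin n, 3 ≤ (j : ℕ) → (F j).card = 3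
  F_sub : ∀ j : Fin n, 3 ≤ (j : ℕ) → ∀ u ∈ F j, ∃ i : Fin n, i < j ∧ ord i = u
  F_inj : ∀ j k : Fin n, 3 ≤ (j : ℕ) → 3 ≤ (k : ℕ) → F j = F k → j = k
  F_created : ∀ j : Fin n, 3 ≤ (j : ℕ) →
    F j = {ord ⟨0, Nat.lt_of_lt_of_le (by norm_num) three_le⟩,
           ord ⟨1, Nat.lt_of_lt_of_le (by norm_num) three_le⟩,
           ord ⟨2, Nat.lt_of_lt_of_le (by norm_num) three_le⟩} ∨
      ∃ i : Fin n, i < j ∧ 3 ≤ (i : ℕ) ∧ ∃ x ∈ F i, F j = insert (ord i) ((F i).erase x)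

namespace P3TConstruction

variable {V : Type} [Fintype V] [DecidableEq V] {G : SimpleGraph V}

/-- The root face `v1 v2 v3` of the dual face tree. -/
def rootFace (C : P3TConstruction V G) : Finset V :=
  {C.ord ⟨0, Nat.lt_of_lt_of_le (by norm_num) C.three_le⟩,
   C.ord ⟨1, Nat.lt_of_lt_of_le (by norm_num) C.three_le⟩,
   C.ord ⟨2, Nat.lt_of_lt_of_le (by norm_num) C.three_le⟩}

/-- The child face of `F j` obtained by replacing its vertex `x` with `ord j`. -/
def childFace (C : P3TConstruction V G) (j : Fin C.n) (x : V) : Finset V :=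
  insert (C.ord j) ((C.F j).erase x)

/-- A face is internal (has a face vertex, i.e. is subdivided at some point, i.e. is
active at some point) iff some vertex is inserted into it. -/
def IsInternalFace (C : P3TConstruction V G) (f : Finset V) : Prop :=
  ∃ j : Fin C.n, 3 ≤ (j : ℕ) ∧ C.F j = f

/-- `g` is a child of `f` in the dual face tree. -/
def IsChildOf (C : P3TConstruction V G) (g f : Finset V) : Prop :=
  ∃ j : Fin C.n, 3 ≤ (j : ℕ) ∧ C.F j = f ∧ ∃ x ∈ C.F j, g = C.childFace j x

/-- `f` is a node of the dual face tree `𝒯`. -/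
def IsFace (C : P3TConstruction V G) (f : Finset V) : Prop :=
  f = C.rootFace ∨ ∃ f' : Finset V, C.IsChildOf f f'

/-- The grand-degree of a face: the maximal number of active child faces over the
whole construction, i.e. the number of its internal (non-leaf) children in `𝒯`. -/
def gd (C : P3TConstruction V G) (f : Finset V) : ℕ :=
  {g : Finset V | C.IsChildOf g f ∧ C.IsInternalFace g}.ncard

end P3TConstruction

/-- `G` is a Kleetope over the sub-triangulation on the vertex set `S`: both `G` and
`G[S]` are plane triangulations, every vertex outside `S` has exactly the three
vertices of a triangle of `G[S]` as neighbours (so it is inserted into a face of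
`G[S]`), and the number of inserted vertices equals the number `2|S| - 4` of faces
of `G[S]` (so that exactly one vertex is inserted into each face). -/
def IsKleetopeOf {V : Type} [Fintype V] [DecidableEq V]
    (G : SimpleGraph V) (S : Finset V) : Prop :=
  IsTriangulation G ∧ IsTriangulation (G.induce (S : Set V)) ∧
    (∀ v : V, v ∉ S →
      (G.neighborSet v).ncard = 3 ∧ G.neighborSet v ⊆ (S : Set V) ∧
        ∀ a ∈ G.neighborSet v, ∀ b ∈ G.neighborSet v, a ≠ b → G.Adj a b) ∧
    Fintype.card V + 4 = 3 * S.card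

end

/-! ### Face systems and their counting bound -/

/-- `X` induces a connected subgraph of `T`. -/
def ConnIn {V : Type} (T : SimpleGraph V) (X : Finset V) : Prop :=
  X.Nonempty ∧ ∀ A ⊆ X, A.Nonempty → (∃ b ∈ X, b ∉ A) → ∃ a ∈ A, ∃ b ∈ X, b ∉ A ∧ T.Adj a b

/-- A family `F` of triangles `N f` of `T` on the vertex set `S` such that the incidence structure
has no `K₃,₃` minor with the three elements of one side taken from `F`. -/
structure IsFaceSystem {V ι : Type} (T : SimpleGraph V) (S : Finset V) (F : Finset ι)
    (N : ι → Finset V) : Prop where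
  sub : ∀ f ∈ F, N f ⊆ S
  card : ∀ f ∈ F, (N f).card = 3
  clique : ∀ f ∈ F, ∀ a ∈ N f, ∀ b ∈ N f, a ≠ b → T.Adj a b
  noK33 : ∀ X : Fin 3 → Finset V, (∀ j, X j ⊆ S) → (∀ j, ConnIn T (X j)) →
    (∀ i j, i ≠ j → Disjoint (X i) (X j)) → ∀ g : Fin 3 → ι, Function.Injective g →
    (∀ i, g i ∈ F) → (∀ i j, ∃ y ∈ N (g i), y ∈ X j) → False

section Counting

variable {V ι : Type} {T : SimpleGraph V} {S : Finset V} {F : Finset ι} {N : ι → Finset V}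

lemma connIn_singleton (T : SimpleGraph V) (a : V) : ConnIn T {a} := by
  refine ⟨Finset.singleton_nonempty a, fun A hA hne ⟨b, hb, hbA⟩ => ?_⟩
  obtain ⟨x, hx⟩ := hne
  have h1 := hA hx
  simp only [Finset.mem_singleton] at h1 hb
  subst h1 hb
  exact absurd hx hbA

lemma connIn_pair [DecidableEq V] {a b : V} (h : T.Adj a b) : ConnIn T {a, b} := by
  refine ⟨⟨a, by simp⟩, fun A hA hne ⟨z, hz, hzA⟩ => ?_⟩
  obtain ⟨x, hx⟩ := hne
  have h1 := hA hx
  simp only [Finset.mem_insert, Finset.mem_singleton] at h1 hz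
  rcases h1 with rfl | rfl <;> rcases hz with rfl | rfl
  · exact absurd hx hzA
  · exact ⟨_, hx, _, by simp, hzA, h⟩
  · exact ⟨_, hx, _, by simp, hzA, h.symm⟩
  · exact absurd hx hzA

/-- A set which is not connected splits into two nonempty parts without edges in between. -/
lemma exists_split [DecidableEq V] {X : Finset V} (hX : X.Nonempty) (h : ¬ ConnIn T X) :
    ∃ A B : Finset V, A.Nonempty ∧ B.Nonempty ∧ Disjoint A B ∧ A ∪ B = X ∧
      ∀ a ∈ A, ∀ b ∈ B, ¬ T.Adj a b := by
  unfold ConnIn at h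
  push Not at h
  obtain ⟨A, hA, hne, ⟨b, hb, hbA⟩, hno⟩ := h hX
  exact ⟨A, X \ A, hne, ⟨b, by simp [hb, hbA]⟩, Finset.disjoint_sdiff, by
    simpa using hA, fun a ha c hc => hno a ha c (Finset.mem_sdiff.1 hc).1
      (Finset.mem_sdiff.1 hc).2⟩

/-- A connected union of connected branch sets is connected. -/
lemma connIn_biUnion [DecidableEq V] {T' : SimpleGraph V} {Y : Finset V} {B : V → Finset V}
    (hY : ConnIn T' Y) (hB : ∀ y ∈ Y, ConnIn T (B y))
    (hadj : ∀ a ∈ Y, ∀ b ∈ Y, T'.Adj a b → ∃ a' ∈ B a, ∃ b' ∈ B b, T.Adj a' b') :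
    ConnIn T (Y.biUnion B) := by
  classical
  obtain ⟨y0, hy0⟩ := hY.1
  obtain ⟨z0, hz0⟩ := (hB y0 hy0).1
  refine ⟨⟨z0, Finset.mem_biUnion.2 ⟨y0, hy0, hz0⟩⟩, fun A hA hne ⟨b, hb, hbA⟩ => ?_⟩
  by_cases hs : ∃ y ∈ Y, (∃ z ∈ B y, z ∈ A) ∧ ∃ z ∈ B y, z ∉ A
  · obtain ⟨y, hy, ⟨z, hz, hzA⟩, w, hw, hwA⟩ := hs
    obtain ⟨p, hp, q, hq, hqA, hpq⟩ := (hB y hy).2 (A ∩ B y) Finset.inter_subset_right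
      ⟨z, by simp [hz, hzA]⟩ ⟨w, hw, by simp [hwA]⟩
    refine ⟨p, (Finset.mem_inter.1 hp).1, q, Finset.mem_biUnion.2 ⟨y, hy, hq⟩, ?_, hpq⟩
    intro h; exact hqA (by simp [h, hq])
  · push Not at hs
    obtain ⟨a, ha⟩ := hne
    obtain ⟨ya, hya, haB⟩ := Finset.mem_biUnion.1 (hA ha)
    obtain ⟨yb, hyb, hbB⟩ := Finset.mem_biUnion.1 hb
    obtain ⟨p, hp, q, hq, hqA, hpq⟩ := hY.2 (Y.filter fun y => ∃ z ∈ B y, z ∈ A)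
      (Finset.filter_subset _ _) ⟨ya, by simp only [Finset.mem_filter]; exact ⟨hya, a, haB, ha⟩⟩
      ⟨yb, hyb, by
        simp only [Finset.mem_filter, not_and]
        exact fun _ h => hbA (hs yb hyb h b hbB)⟩
    obtain ⟨hpY, hpA⟩ := Finset.mem_filter.1 hp
    obtain ⟨p', hp', q', hq', h'⟩ := hadj p hpY q hq hpq
    refine ⟨p', hs p hpY hpA p' hp', q', Finset.mem_biUnion.2 ⟨q, hq, hq'⟩, fun h => hqA ?_, h'⟩
    simp only [Finset.mem_filter]
    exact ⟨hq, q', hq', h⟩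

/-- The image of a connected set under an adjacency-respecting map is connected. -/
lemma ConnIn.image [DecidableEq V] {T' : SimpleGraph V} {X : Finset V} (h : ConnIn T X) (q : V → V)
    (hq : ∀ a ∈ X, ∀ b ∈ X, T.Adj a b → q a ≠ q b → T'.Adj (q a) (q b)) :
    ConnIn T' (X.image q) := by
  refine ⟨h.1.image q, fun A hA hne ⟨b, hb, hbA⟩ => ?_⟩
  obtain ⟨a, ha⟩ := hne
  obtain ⟨a', ha', rfl⟩ := Finset.mem_image.1 (hA ha)
  obtain ⟨b', hb', rfl⟩ := Finset.mem_image.1 hb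
  obtain ⟨c, hc, d, hd, hdA, hcd⟩ := h.2 (X.filter fun z => q z ∈ A) (Finset.filter_subset _ _)
    ⟨a', by simp [ha', ha]⟩ ⟨b', hb', by simp [hbA]⟩
  simp only [Finset.mem_filter, not_and] at hc hdA
  exact ⟨q c, hc.2, q d, Finset.mem_image_of_mem q hd, hdA hd, hq c hc.1 d hd hcd
    (fun h => hdA hd (h ▸ hc.2))⟩

namespace IsFaceSystem

lemma adj_of_mem (h : IsFaceSystem T S F N) {f : ι} (hf : f ∈ F) {a b : V} (ha : a ∈ N f)
    (hb : b ∈ N f) (hab : a ≠ b) : T.Adj a b := h.clique f hf a ha b hb hab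

lemma restrict (h : IsFaceSystem T S F N) {S' : Finset V} {F' : Finset ι} (hS : S' ⊆ S)
    (hF : ∀ f ∈ F', f ∈ F ∧ N f ⊆ S') : IsFaceSystem T S' F' N where
  sub f hf := (hF f hf).2
  card f hf := h.card f (hF f hf).1
  clique f hf := h.clique f (hF f hf).1
  noK33 X hX hc hd g hg hgF := h.noK33 X (fun j => (hX j).trans hS) hc hd g hg
    fun i => (hF _ (hgF i)).1

end IsFaceSystem

/-- The map collapsing `C` to the point `x`. -/
def collapse [DecidableEq V] (C : Finset V) (x : V) : V → V := fun z => if z ∈ C then x else z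

/-- The graph obtained from the part of `T` on `S` by collapsing `C` to the point `x`. -/
def contractGraph [DecidableEq V] (T : SimpleGraph V) (S C : Finset V) (x : V) : SimpleGraph V where
  Adj a b := a ≠ b ∧ ∃ a' ∈ S, ∃ b' ∈ S, collapse C x a' = a ∧ collapse C x b' = b ∧ T.Adj a' b'
  symm := ⟨fun a b ⟨hab, a', ha, b', hb, h1, h2, h3⟩ => ⟨hab.symm, b', hb, a', ha, h2, h1, h3.symm⟩⟩
  loopless := ⟨fun a h => h.1 rfl⟩

lemma IsFaceSystem.contract [DecidableEq V] (h : IsFaceSystem T S F N) {C : Finset V} {x : V}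
    (hCS : C ⊆ S) (hC : ConnIn T C) (hx : x ∈ C) {F' : Finset ι}
    (hF' : ∀ f ∈ F', f ∈ F ∧ ∀ a ∈ N f, ∀ b ∈ N f, a ∈ C → b ∈ C → a = b) :
    IsFaceSystem (contractGraph T S C x) (insert x (S \ C)) F'
      (fun f => (N f).image (collapse C x)) := by
  have hinj : ∀ f ∈ F', ∀ a ∈ N f, ∀ b ∈ N f, collapse C x a = collapse C x b → a = b := by
    intro f hf a ha b hb hab
    unfold collapse at hab
    split_ifs at hab with h1 h2 h2
    · exact (hF' f hf).2 a ha b hb h1 h2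
    · exact absurd (hab ▸ hx) h2
    · exact absurd (hab ▸ hx) h1
    · exact hab
  let B : V → Finset V := fun y => if y = x then C else {y}
  have hBmem : ∀ z, z ∈ B (collapse C x z) := by
    intro z
    by_cases hz : z ∈ C
    · simp [B, collapse, hz]
    · have : z ≠ x := fun h => hz (h ▸ hx)
      simp [B, collapse, hz, this]
  have hBconn : ∀ y, ConnIn T (B y) := by
    intro y
    by_cases hy : y = x
    · simpa [B, hy] using hC
    · simpa [B, hy] using connIn_singleton T y
  have hBS : ∀ y ∈ insert x (S \ C), B y ⊆ S := by
    intro y hy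
    by_cases hyx : y = x
    · simpa [B, hyx] using hCS
    · simp only [Finset.mem_insert, hyx, Finset.mem_sdiff, false_or] at hy
      simpa [B, hyx] using hy.1
  have hBd : ∀ y ∈ insert x (S \ C), ∀ z ∈ insert x (S \ C), y ≠ z → Disjoint (B y) (B z) := by
    intro y hy z hz hyz
    simp only [Finset.mem_insert, Finset.mem_sdiff] at hy hz
    by_cases h1 : y = x <;> by_cases h2 : z = x
    · exact absurd (h1.trans h2.symm) hyz
    · simp [B, h1, h2, (hz.resolve_left h2).2]
    · simp [B, h1, h2, (hy.resolve_left h1).2]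
    · simp [B, h1, h2, hyz]
  refine ⟨?_, ?_, ?_, ?_⟩
  · intro f hf z hz
    obtain ⟨a, ha, rfl⟩ := Finset.mem_image.1 hz
    have := h.sub f (hF' f hf).1 ha
    by_cases haC : a ∈ C <;> simp [collapse, haC, this]
  · intro f hf
    rw [Finset.card_image_of_injOn (fun a ha b hb => hinj f hf a ha b hb), h.card f (hF' f hf).1]
  · intro f hf a ha b hb hab
    obtain ⟨a', ha', rfl⟩ := Finset.mem_image.1 ha
    obtain ⟨b', hb', rfl⟩ := Finset.mem_image.1 hb
    exact ⟨hab, a', h.sub f (hF' f hf).1 ha', b', h.sub f (hF' f hf).1 hb', rfl, rfl,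
      h.clique f (hF' f hf).1 a' ha' b' hb' (fun h => hab (h ▸ rfl))⟩
  · intro X hX hc hd g hg hgF hinc
    refine h.noK33 (fun j => (X j).biUnion B) ?_ ?_ ?_ g hg (fun i => (hF' _ (hgF i)).1) ?_
    · intro j
      exact Finset.biUnion_subset.2 fun y hy => hBS y (hX j hy)
    · intro j
      refine connIn_biUnion (hc j) (fun y _ => hBconn y) ?_
      rintro a ha b hb ⟨hab, a', ha', b', hb', rfl, rfl, hadj⟩
      exact ⟨a', hBmem a', b', hBmem b', hadj⟩
    · intro i j hij
      rw [Finset.disjoint_biUnion_left]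
      intro y hy
      rw [Finset.disjoint_biUnion_right]
      intro z hz
      exact hBd y (hX i hy) z (hX j hz) (fun h => Finset.disjoint_left.1 (hd i j hij) hy (h ▸ hz))
    · intro i j
      obtain ⟨y, hy, hyX⟩ := hinc i j
      obtain ⟨z, hz, rfl⟩ := Finset.mem_image.1 hy
      exact ⟨z, hz, Finset.mem_biUnion.2 ⟨_, hyX, hBmem z⟩⟩

/-- No three faces of a face system share three pairwise disjoint connected sets. -/
lemma IsFaceSystem.card_le_two [DecidableEq V] (h : IsFaceSystem T S F N) {X Y Z : Finset V}
    (hX : X ⊆ S) (hY : Y ⊆ S) (hZ : Z ⊆ S) (cX : ConnIn T X) (cY : ConnIn T Y) (cZ : ConnIn T Z)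
    (hXY : Disjoint X Y) (hXZ : Disjoint X Z) (hYZ : Disjoint Y Z) {G : Finset ι} (hG : G ⊆ F)
    (hinc : ∀ f ∈ G, (∃ y ∈ N f, y ∈ X) ∧ (∃ y ∈ N f, y ∈ Y) ∧ ∃ y ∈ N f, y ∈ Z) :
    G.card ≤ 2 := by
  by_contra hcon
  obtain ⟨a, b, c, ha, hb, hc, hab, hac, hbc⟩ := Finset.two_lt_card_iff.1 (not_le.1 hcon)
  refine h.noK33 ![X, Y, Z] ?_ ?_ ?_ ![a, b, c] ?_ ?_ ?_
  · intro j; fin_cases j <;> simpa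
  · intro j; fin_cases j <;> simpa
  · intro i j hij
    fin_cases i <;> fin_cases j <;> simp_all [disjoint_comm]
  · intro i j hij
    fin_cases i <;> fin_cases j <;> simp_all
  · intro i; fin_cases i <;> simp [hG ha, hG hb, hG hc]
  · intro i j
    fin_cases i
    · fin_cases j
      exacts [(hinc a ha).1, (hinc a ha).2.1, (hinc a ha).2.2]
    · fin_cases j
      exacts [(hinc b hb).1, (hinc b hb).2.1, (hinc b hb).2.2]
    · fin_cases j
      exacts [(hinc c hc).1, (hinc c hc).2.1, (hinc c hc).2.2]

end Counting

section Counting2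

variable {V ι : Type} [DecidableEq V] {T : SimpleGraph V} {S : Finset V} {F : Finset ι}
  {N : ι → Finset V}

/-- The faces incident to both `x` and `y`. -/
def facesOn (F : Finset ι) (N : ι → Finset V) (x y : V) : Finset ι :=
  F.filter fun f => x ∈ N f ∧ y ∈ N f

/-- The faces contained in `A`. -/
def facesIn (F : Finset ι) (N : ι → Finset V) (A : Finset V) : Finset ι :=
  F.filter fun f => N f ⊆ A

lemma IsFaceSystem.facesIn (h : IsFaceSystem T S F N) {A : Finset V} (hA : A ⊆ S) :
    IsFaceSystem T A (facesIn F N A) N :=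
  h.restrict hA fun f hf => by simpa [_root_.facesIn] using hf

/-- The faces which survive the contraction of `x y`. -/
def facesOff (F : Finset ι) (N : ι → Finset V) (x y : V) : Finset ι :=
  F.filter fun f => ¬ (x ∈ N f ∧ y ∈ N f)

lemma card_facesOn_add_card_facesOff (F : Finset ι) (N : ι → Finset V) (x y : V) :
    (facesOn F N x y).card + (facesOff F N x y).card = F.card := by
  unfold facesOn facesOff
  exact Finset.card_filter_add_card_filter_not _

/-- A face avoids one of the two sides of a separation. -/
lemma IsFaceSystem.subset_or_subset (h : IsFaceSystem T S F N) {A B Z : Finset V}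
    (hcov : S ⊆ A ∪ B ∪ Z) (hAB : Disjoint A B) (hno : ∀ a ∈ A, ∀ b ∈ B, ¬ T.Adj a b)
    {f : ι} (hf : f ∈ F) : N f ⊆ A ∪ Z ∨ N f ⊆ B ∪ Z := by
  by_contra hcon
  push Not at hcon
  obtain ⟨⟨a, ha, haA⟩, b, hb, hbB⟩ := And.imp Finset.not_subset.1 Finset.not_subset.1 hcon
  have h1 := hcov (h.sub f hf ha)
  have h2 := hcov (h.sub f hf hb)
  simp only [Finset.mem_union, not_or] at h1 h2 haA hbB
  have haB : a ∈ B := by tauto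
  have hbA : b ∈ A := by tauto
  exact hno b hbA a haB (h.clique f hf b hb a ha fun hh =>
    Finset.disjoint_left.1 hAB hbA (hh ▸ haB))

lemma IsFaceSystem.card_le_facesIn (h : IsFaceSystem T S F N) {A B Z : Finset V}
    (hcov : S ⊆ A ∪ B ∪ Z) (hAB : Disjoint A B) (hno : ∀ a ∈ A, ∀ b ∈ B, ¬ T.Adj a b) :
    F.card ≤ (_root_.facesIn F N (A ∪ Z)).card + (_root_.facesIn F N (B ∪ Z)).card := by
  classical
  refine le_trans (Finset.card_le_card ?_) (Finset.card_union_le _ _)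
  intro f hf
  simp only [Finset.mem_union, _root_.facesIn, Finset.mem_filter]
  rcases h.subset_or_subset hcov hAB hno hf with h' | h' <;> tauto

lemma IsFaceSystem.contractPair (h : IsFaceSystem T S F N) {x y : V} (hx : x ∈ S) (hy : y ∈ S)
    (hxy : T.Adj x y) : IsFaceSystem (contractGraph T S {x, y} x) (S.erase y) (facesOff F N x y)
      (fun f => (N f).image (collapse {x, y} x)) := by
  have hS : S.erase y = insert x (S \ {x, y}) := by
    ext z
    simp only [Finset.mem_erase, Finset.mem_insert, Finset.mem_sdiff, Finset.mem_singleton, not_or]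
    constructor
    · rintro ⟨h1, h2⟩
      by_cases hz : z = x <;> simp [hz, h1, h2]
    · rintro (rfl | ⟨h1, h2, h3⟩)
      · exact ⟨hxy.ne, hx⟩
      · exact ⟨h3, h1⟩
  rw [hS]
  refine h.contract (by intro z; simp; rintro (rfl | rfl) <;> assumption) (connIn_pair hxy)
    (by simp) fun f hf => ?_
  simp only [facesOff, Finset.mem_filter, not_and] at hf
  refine ⟨hf.1, fun a ha b hb haC hbC => ?_⟩
  simp only [Finset.mem_insert, Finset.mem_singleton] at haC hbC
  rcases haC with rfl | rfl <;> rcases hbC with rfl | rfl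
  · rfl
  · exact absurd hb (hf.2 ha)
  · exact absurd ha (hf.2 hb)
  · rfl

/-- Euler's bound on the number of faces. -/
lemma IsFaceSystem.card_bound (h : IsFaceSystem T S F N) (hS : 3 ≤ S.card) :
    F.card + 4 ≤ 2 * S.card := by
  induction hn : S.card using Nat.strong_induction_on generalizing T S F N with
  | _ n ih =>
  subst hn
  rcases F.eq_empty_or_nonempty with rfl | ⟨f, hf⟩
  · simp; omega
  have hNc := h.card f hf
  obtain ⟨x, y, z, hxy, hxz, hyz, hN⟩ := Finset.card_eq_three.1 hNc
  have hxN : x ∈ N f := by simp [hN]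
  have hyN : y ∈ N f := by simp [hN]
  have hx := h.sub f hf hxN
  have hy := h.sub f hf hyN
  have hadj := h.adj_of_mem hf hxN hyN hxy
  rcases Nat.lt_or_ge 3 S.card with h3 | h3
  · by_cases hm : (facesOn F N x y).card ≤ 2
    · have h1 := ih (S.erase y).card (by rw [Finset.card_erase_of_mem hy]; omega)
        (h.contractPair hx hy hadj) (by rw [Finset.card_erase_of_mem hy]; omega) rfl
      have h2 := card_facesOn_add_card_facesOff F N x y
      rw [Finset.card_erase_of_mem hy] at h1
      omega
    · have hcard : (S \ {x, y}).card + 2 = S.card := by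
        rw [← Finset.card_pair hxy]
        exact Finset.card_sdiff_add_card_eq_card (by intro z; simp; rintro (rfl | rfl) <;> assumption)
      have hne : (S \ {x, y}).Nonempty := Finset.card_pos.1 (by omega)
      by_cases hc : ConnIn T (S \ {x, y})
      · refine absurd (h.card_le_two (X := {x}) (Y := {y}) (Z := S \ {x, y}) (by simpa)
          (by simpa) Finset.sdiff_subset (connIn_singleton T x) (connIn_singleton T y) hc
          (by simpa) (by simp) (by simp) (G := facesOn F N x y) (Finset.filter_subset _ _) ?_) hm
        intro g hg
        simp only [facesOn, Finset.mem_filter] at hg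
        refine ⟨⟨x, by simp [hg]⟩, ⟨y, by simp [hg]⟩, ?_⟩
        obtain ⟨w, hw, hw'⟩ := Finset.exists_mem_notMem_of_card_lt_card (s := {x, y}) (t := N g)
          (by rw [h.card g hg.1, Finset.card_pair hxy]; omega)
        exact ⟨w, hw, Finset.mem_sdiff.2 ⟨h.sub g hg.1 hw, hw'⟩⟩
      · obtain ⟨A, B, hA, hB, hAB, hun, hno⟩ := exists_split hne hc
        have hAZ : A ⊆ S \ {x, y} := hun ▸ Finset.subset_union_left
        have hBZ : B ⊆ S \ {x, y} := hun ▸ Finset.subset_union_right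
        have hcA : (A ∪ {x, y}).card = A.card + 2 := by
          rw [Finset.card_union_of_disjoint, Finset.card_pair hxy]
          exact Finset.disjoint_of_subset_left hAZ Finset.sdiff_disjoint
        have hcB : (B ∪ {x, y}).card = B.card + 2 := by
          rw [Finset.card_union_of_disjoint, Finset.card_pair hxy]
          exact Finset.disjoint_of_subset_left hBZ Finset.sdiff_disjoint
        have hsub : ({x, y} : Finset V) ⊆ S := by intro z; simp; rintro (rfl | rfl) <;> assumption
        have hcu : A.card + B.card = (S \ {x, y}).card := by
          rw [← hun, Finset.card_union_of_disjoint hAB]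
        have hA0 := hA.card_pos
        have hB0 := hB.card_pos
        have h1 := ih _ (by rw [hcA]; omega) (h.facesIn
          (Finset.union_subset (hAZ.trans Finset.sdiff_subset) hsub)) (by rw [hcA]; omega) rfl
        have h2 := ih _ (by rw [hcB]; omega) (h.facesIn
          (Finset.union_subset (hBZ.trans Finset.sdiff_subset) hsub)) (by rw [hcB]; omega) rfl
        have h3 := h.card_le_facesIn (A := A) (B := B) (Z := {x, y})
          (by rw [hun, Finset.sdiff_union_self_eq_union]; exact Finset.subset_union_left) hAB hno
        omega
  · have hSe : S = {x, y, z} := by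
      rw [← hN]; exact (Finset.eq_of_subset_of_card_le (h.sub f hf) (by omega)).symm
    have hall : ∀ g ∈ F, N g = {x, y, z} := fun g hg => by
      rw [← hSe]; exact Finset.eq_of_subset_of_card_le (h.sub g hg) (by rw [h.card g hg]; omega)
    have := h.card_le_two (X := {x}) (Y := {y}) (Z := {z}) (by simpa) (by simpa)
      (by simp [hSe]) (connIn_singleton T x) (connIn_singleton T y) (connIn_singleton T z)
      (by simpa) (by simpa) (by simpa) (G := F) (fun _ h => h) (fun g hg => by simp [hall g hg])
    omega

/-- A face system attaining Euler's bound. -/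
structure IsFullSystem (T : SimpleGraph V) (S : Finset V) (F : Finset ι)
    (N : ι → Finset V) : Prop extends IsFaceSystem T S F N where
  three_le : 3 ≤ S.card
  card_eq : F.card + 4 = 2 * S.card

/-- `S` is not separated by two of its vertices. -/
def NoTwoCut (T : SimpleGraph V) (S : Finset V) : Prop :=
  ∀ a ∈ S, ∀ b ∈ S, a ≠ b → ConnIn T (S \ {a, b})

lemma IsFaceSystem.facesIn_card_le (h : IsFaceSystem T S F N) {A : Finset V} (hA : A ⊆ S) :
    (_root_.facesIn F N A).card ≤ 2 * (A.card - 2) := by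
  by_cases hc : 3 ≤ A.card
  · have := (h.facesIn hA).card_bound hc
    omega
  · rw [Finset.card_eq_zero.2]
    · omega
    · refine Finset.eq_empty_of_forall_notMem fun f hf => hc ?_
      simp only [_root_.facesIn, Finset.mem_filter] at hf
      rw [← h.card f hf.1]
      exact Finset.card_le_card hf.2

lemma IsFaceSystem.contract_card_le (h : IsFaceSystem T S F N) {C : Finset V} {x : V}
    (hCS : C ⊆ S) (hC : ConnIn T C) (hx : x ∈ C) {F' : Finset ι}
    (hF' : ∀ f ∈ F', f ∈ F ∧ ∀ a ∈ N f, ∀ b ∈ N f, a ∈ C → b ∈ C → a = b) :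
    F'.card ≤ 2 * ((S \ C).card - 1) := by
  have hcard : (insert x (S \ C)).card = (S \ C).card + 1 :=
    Finset.card_insert_of_notMem (by simp [hx])
  have h' := h.contract hCS hC hx hF'
  by_cases h3 : 3 ≤ (insert x (S \ C)).card
  · have := h'.card_bound h3
    omega
  · rw [Finset.card_eq_zero.2]
    · omega
    · refine Finset.eq_empty_of_forall_notMem fun f hf => h3 ?_
      rw [← h'.card f hf]
      exact Finset.card_le_card (h'.sub f hf)

lemma IsFullSystem.noOneCut (h : IsFullSystem T S F N) {a : V} (ha : a ∈ S) :
    ConnIn T (S.erase a) := by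
  by_contra hc
  have hs := h.three_le
  have hce := Finset.card_erase_of_mem ha
  obtain ⟨A, B, hA, hB, hAB, hun, hno⟩ := exists_split (Finset.card_pos.1 (by omega)) hc
  have hAZ : A ⊆ S.erase a := hun ▸ Finset.subset_union_left
  have hBZ : B ⊆ S.erase a := hun ▸ Finset.subset_union_right
  have hcA : (A ∪ {a}).card = A.card + 1 := by
    rw [Finset.card_union_of_disjoint, Finset.card_singleton]
    simpa using fun h => by simpa using hAZ h
  have hcB : (B ∪ {a}).card = B.card + 1 := by
    rw [Finset.card_union_of_disjoint, Finset.card_singleton]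
    simpa using fun h => by simpa using hBZ h
  have hcu : A.card + B.card = (S.erase a).card := by
    rw [← hun, Finset.card_union_of_disjoint hAB]
  have hA0 := hA.card_pos
  have hB0 := hB.card_pos
  have h1 := h.facesIn_card_le (A := A ∪ {a})
    (Finset.union_subset (hAZ.trans (Finset.erase_subset _ _)) (by simpa))
  have h2 := h.facesIn_card_le (A := B ∪ {a})
    (Finset.union_subset (hBZ.trans (Finset.erase_subset _ _)) (by simpa))
  have h3 := h.card_le_facesIn (A := A) (B := B) (Z := {a})
    (by rw [hun]; intro z hz; by_cases hza : z = a <;> simp [hza, hz]) hAB hno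
  have := h.card_eq
  omega

lemma facesOn_third (h : IsFaceSystem T S F N) {x y : V} (hxy : x ≠ y) {g : ι}
    (hg : g ∈ facesOn F N x y) : ∃ w ∈ S, w ≠ x ∧ w ≠ y ∧ N g = {x, y, w} := by
  simp only [facesOn, Finset.mem_filter] at hg
  obtain ⟨w, hw, hw'⟩ := Finset.exists_mem_notMem_of_card_lt_card (s := {x, y}) (t := N g)
    (by rw [h.card g hg.1, Finset.card_pair hxy]; omega)
  simp only [Finset.mem_insert, Finset.mem_singleton, not_or] at hw'
  refine ⟨w, h.sub g hg.1 hw, hw'.1, hw'.2, (Finset.eq_of_subset_of_card_le ?_ ?_).symm⟩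
  · intro z; simp only [Finset.mem_insert, Finset.mem_singleton]
    rintro (rfl | rfl | rfl)
    exacts [hg.2.1, hg.2.2, hw]
  · rw [h.card g hg.1, Finset.card_eq_three.2 ⟨x, y, w, hxy, Ne.symm hw'.1, Ne.symm hw'.2, rfl⟩]

/-- Without separating pairs every edge lies on exactly two faces. -/
lemma IsFullSystem.card_facesOn (h : IsFullSystem T S F N) (h2 : NoTwoCut T S) {x y : V}
    (hx : x ∈ S) (hy : y ∈ S) (hxy : T.Adj x y) : (facesOn F N x y).card = 2 := by
  have hle : (facesOn F N x y).card ≤ 2 := by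
    refine h.card_le_two (X := {x}) (Y := {y}) (Z := S \ {x, y}) (by simpa)
      (by simpa) Finset.sdiff_subset (connIn_singleton T x) (connIn_singleton T y)
      (h2 x hx y hy hxy.ne) (by simpa using hxy.ne) (by simp) (by simp) (Finset.filter_subset _ _) ?_
    intro g hg
    obtain ⟨w, hw, hwx, hwy, hN⟩ := facesOn_third h.toIsFaceSystem hxy.ne hg
    exact ⟨⟨x, by simp [hN]⟩, ⟨y, by simp [hN]⟩, w, by simp [hN], by simp [hw, hwx, hwy]⟩
  have hs := h.three_le
  have he := h.card_eq
  have h' := h.contractPair hx hy hxy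
  have hadd := card_facesOn_add_card_facesOff F N x y
  have hce := Finset.card_erase_of_mem hy
  rcases Nat.lt_or_ge 3 S.card with h3 | h3
  · have := h'.card_bound (by omega)
    omega
  · have h0 : (facesOff F N x y).card = 0 := by
      rw [Finset.card_eq_zero]
      refine Finset.eq_empty_of_forall_notMem fun f hf => ?_
      have h1 := Finset.card_le_card (h'.sub f hf)
      rw [h'.card f hf] at h1
      omega
    omega

lemma IsFullSystem.contractPair_full (h : IsFullSystem T S F N) (h2 : NoTwoCut T S) {x y : V}
    (hx : x ∈ S) (hy : y ∈ S) (hxy : T.Adj x y) (h4 : 4 ≤ S.card) :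
    IsFullSystem (contractGraph T S {x, y} x) (S.erase y) (facesOff F N x y)
      (fun f => (N f).image (collapse {x, y} x)) where
  toIsFaceSystem := h.contractPair hx hy hxy
  three_le := by rw [Finset.card_erase_of_mem hy]; omega
  card_eq := by
    have := h.card_facesOn h2 hx hy hxy
    have := card_facesOn_add_card_facesOff F N x y
    have := h.card_eq
    rw [Finset.card_erase_of_mem hy]; omega

end Counting2

section Connectivity

variable {V ι : Type} [DecidableEq V] {T : SimpleGraph V} {S : Finset V} {F : Finset ι}
  {N : ι → Finset V}

/-- One side of a separating pair, together with the pair, is connected. -/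
lemma connIn_side {U K R : Finset V} {x y : V} (hxy : x ≠ y) (hx : x ∈ U) (hy : y ∈ U)
    (hcx : ConnIn T (U.erase x)) (hcy : ConnIn T (U.erase y)) (hR : R.Nonempty)
    (hKR : Disjoint K R) (hun : K ∪ R = U \ {x, y}) (hno : ∀ a ∈ K, ∀ b ∈ R, ¬ T.Adj a b) :
    ConnIn T (R ∪ {x, y}) := by
  have hmem : ∀ z, z ∈ K ∨ z ∈ R ↔ z ∈ U ∧ z ≠ x ∧ z ≠ y := fun z => by
    simpa using congrArg (z ∈ ·) hun
  have hdis' := Finset.disjoint_left.1 hKR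
  obtain ⟨r, hr⟩ := hR
  have key : ∀ A B : Finset V, Disjoint A B → A ∪ B = R ∪ {x, y} → B.Nonempty →
      (∀ a ∈ A, ∀ b ∈ B, ¬ T.Adj a b) → x ∈ A → False := by
    intro A B hd hu hne hn hxA
    have hm : ∀ z, z ∈ A ∨ z ∈ B ↔ z = x ∨ z = y ∨ z ∈ R := fun z => by
      simpa using congrArg (z ∈ ·) hu
    have hdis := Finset.disjoint_left.1 hd
    by_cases hB : ∃ z ∈ B, z ≠ y
    · obtain ⟨z, hz, hzy⟩ := hB
      obtain ⟨p, hp, q, hq, hqA, hpq⟩ := hcy.2 (B.erase y) (by grind) ⟨z, by grind⟩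
        ⟨x, by grind, by grind⟩
      have hpR : p ∈ R := by grind
      by_cases hqK : q ∈ K
      · exact hno q hqK p hpR hpq.symm
      · exact hn q (by grind) p (by grind) hpq.symm
    · push Not at hB
      have hyB : y ∈ B := by obtain ⟨z, hz⟩ := hne; exact hB z hz ▸ hz
      obtain ⟨p, hp, q, hq, hqA, hpq⟩ := hcx.2 (A.erase x) (by grind) ⟨r, by grind⟩
        ⟨y, by grind, by grind⟩
      have hpR : p ∈ R := by grind
      by_cases hqK : q ∈ K
      · exact hno q hqK p hpR hpq.symm
      · exact hn p (by grind) q (by grind) hpq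
  by_contra hc
  obtain ⟨A, B, hA, hB, hAB, hu, hn⟩ := exists_split ⟨x, by simp⟩ hc
  have hxm : x ∈ A ∪ B := by rw [hu]; simp
  rcases Finset.mem_union.1 hxm with hxA | hxB
  · exact key A B hAB hu hB hn hxA
  · exact key B A hAB.symm (by rw [Finset.union_comm, hu]) hA
      (fun a ha b hb h => hn b hb a ha h.symm) hxB

/-- In a full system without separating pairs, two vertices of a separating triple
are adjacent. -/
lemma IsFullSystem.adj_of_threeCut (h : IsFullSystem T S F N) (h2 : NoTwoCut T S) {c x y : V}
    (hc : c ∈ S) (hx : x ∈ S) (hy : y ∈ S) (hcx : c ≠ x) (hcy : c ≠ y) (hxy : x ≠ y)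
    {K R : Finset V} (hK : K.Nonempty) (hR : R.Nonempty) (hKR : Disjoint K R)
    (hun : K ∪ R = S \ {c, x, y}) (hno : ∀ a ∈ K, ∀ b ∈ R, ¬ T.Adj a b) : T.Adj x y := by
  by_contra hadj
  have hmem : ∀ z, z ∈ K ∨ z ∈ R ↔ z ∈ S ∧ z ≠ c ∧ z ≠ x ∧ z ≠ y := fun z => by
    simpa using congrArg (z ∈ ·) hun
  have hdis := Finset.disjoint_left.1 hKR
  have e1 : (S.erase c).erase x = S \ {c, x} := by grind
  have e2 : (S.erase c).erase y = S \ {c, y} := by grind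
  have e3 : S.erase c \ {x, y} = S \ {c, x, y} := by grind
  have hcR : ConnIn T (R ∪ {x, y}) := connIn_side hxy (by grind) (by grind)
    (e1 ▸ h2 c hc x hx hcx) (e2 ▸ h2 c hc y hy hcy) hR hKR (e3 ▸ hun) hno
  have hcK : ConnIn T (K ∪ {x, y}) := connIn_side hxy (by grind) (by grind)
    (e1 ▸ h2 c hc x hx hcx) (e2 ▸ h2 c hc y hy hcy) hK hKR.symm
    (by rw [Finset.union_comm, hun, e3]) (fun a ha b hb h => hno b hb a ha h.symm)
  have side : ∀ K R : Finset V, K ∪ R = S \ {c, x, y} → Disjoint K R →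
      ConnIn T (R ∪ {x, y}) → K.Nonempty →
      (_root_.facesIn F N (K ∪ {c, x, y})).card ≤ 2 * K.card := by
    intro K R hun hd hcR hK
    have hmem : ∀ z, z ∈ K ∨ z ∈ R ↔ z ∈ S ∧ z ≠ c ∧ z ≠ x ∧ z ≠ y := fun z => by
      simpa using congrArg (z ∈ ·) hun
    have hdis := Finset.disjoint_left.1 hd
    have hb := h.contract_card_le (C := R ∪ {x, y}) (x := x)
      (F' := _root_.facesIn F N (K ∪ {c, x, y})) (by grind) hcR (by simp) ?_
    · have hS : S \ (R ∪ {x, y}) = insert c K := by grind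
      rw [hS, Finset.card_insert_of_notMem (by grind)] at hb
      omega
    · intro f hf
      simp only [_root_.facesIn, Finset.mem_filter] at hf
      refine ⟨hf.1, fun a ha b hb haC hbC => ?_⟩
      have h1 := hf.2 ha
      have h2 := hf.2 hb
      by_contra hab
      have := h.clique f hf.1 a ha b hb hab
      have := this.symm
      grind
  have h1 := side K R hun hKR hcR hK
  have h2' := side R K (by rw [Finset.union_comm, hun]) hKR.symm hcK hR
  have h3 := h.card_le_facesIn (A := K) (B := R) (Z := {c, x, y})
    (by intro z hz; grind) hKR hno
  have hcard : (S \ {c, x, y}).card + 3 = S.card := by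
    rw [← Finset.card_eq_three.2 ⟨c, x, y, hcx, hcy, hxy, rfl⟩]
    exact Finset.card_sdiff_add_card_eq_card (by grind)
  rw [← hun, Finset.card_union_of_disjoint hKR] at hcard
  have := h.card_eq
  omega

lemma ne_of_card_eq_three {a b c : V} (h : ({a, b, c} : Finset V).card = 3) :
    a ≠ b ∧ a ≠ c ∧ b ≠ c := by
  refine ⟨?_, ?_, ?_⟩ <;> rintro rfl
  · have := Finset.card_le_two (a := a) (b := c); simp at h; omega
  · have := Finset.card_le_two (a := b) (b := a); simp at h; omega
  · have := Finset.card_le_two (a := a) (b := b); simp at h; omega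

/-- A side of a second separating triple through `c` which avoids `x` and `y` lies
inside the side `K` of the first one. -/
lemma NoTwoCut.side_subset (h2 : NoTwoCut T S) {c x y x' y' : V} {K R A B : Finset V}
    (hc : c ∈ S) (hx : x ∈ S) (hy : y ∈ S) (hy' : y' ∈ S) (hcx : c ≠ x) (hyc : y ≠ c) (hyx : y ≠ x)
    (hy'c : y' ≠ c) (hx'K : x' ∈ K)
    (hdis : Disjoint K R) (hun : K ∪ R = S \ {c, x, y}) (hno : ∀ a ∈ K, ∀ b ∈ R, ¬ T.Adj a b)
    (hun' : A ∪ B = S \ {c, x', y'}) (hno' : ∀ a ∈ A, ∀ b ∈ B, ¬ T.Adj a b)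
    (hxB : x ∉ B) (hyB : y ∉ B) : ∀ b ∈ B, b ∈ K := by
  have hmem : ∀ z, z ∈ K ∨ z ∈ R ↔ z ∈ S ∧ z ≠ c ∧ z ≠ x ∧ z ≠ y := fun z => by
    simpa using congrArg (z ∈ ·) hun
  have hmem' : ∀ z, z ∈ A ∨ z ∈ B ↔ z ∈ S ∧ z ≠ c ∧ z ≠ x' ∧ z ≠ y' := fun z => by
    simpa using congrArg (z ∈ ·) hun'
  replace hdis := Finset.disjoint_left.1 hdis
  clear hun hun'
  intro b hb
  by_contra hbK
  have hb' := (hmem' b).1 (Or.inr hb)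
  have hbR : b ∈ R := by
    refine ((hmem b).2 ⟨hb'.1, hb'.2.1, ?_, ?_⟩).resolve_left hbK
    · rintro rfl; exact hxB hb
    · rintro rfl; exact hyB hb
  obtain ⟨p, hp, r, hr, hrB, hpr⟩ := (h2 c hc y' hy' hy'c.symm).2 (B ∩ R) (by
      intro z hz
      have := (hmem' z).1 (Or.inr (Finset.mem_inter.1 hz).1)
      simp [this])
    ⟨b, by simp [hb, hbR]⟩ (by
      by_cases hxy' : x = y'
      · exact ⟨y, by simp [hy, hyc, ← hxy', hyx], by simp [hyB]⟩
      · exact ⟨x, by simp [hx, hcx.symm, hxy'], by simp [hxB]⟩)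
  obtain ⟨hpB, hpR⟩ := Finset.mem_inter.1 hp
  have hrA : r ∉ A := fun hrA => hno' r hrA p hpB hpr.symm
  have hrK : r ∉ K := fun hrK => hno r hrK p hpR hpr.symm
  simp only [Finset.mem_sdiff, Finset.mem_insert, Finset.mem_singleton, not_or,
    Finset.mem_inter, not_and] at hr hrB
  have hrB' : r ∈ B := ((hmem' r).2 ⟨hr.1, hr.2.1, fun h => hrK (h ▸ hx'K), hr.2.2⟩).resolve_left hrA
  refine hrB hrB' (((hmem r).2 ⟨hr.1, hr.2.1, ?_, ?_⟩).resolve_left hrK)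
  · rintro rfl; exact hxB hrB'
  · rintro rfl; exact hyB hrB'

/-- A vertex `c` of a face has a neighbour off this face along which contraction creates no
separating pair. -/
lemma IsFullSystem.exists_contractible (h : IsFullSystem T S F N) (h2 : NoTwoCut T S)
    (h4 : 4 ≤ S.card) {f : ι} (hf : f ∈ F) {v1 v2 c : V} (hN : N f = {v1, v2, c}) :
    ∃ x ∈ S, x ≠ v1 ∧ x ≠ v2 ∧ T.Adj c x ∧
      ∀ y ∈ S, y ≠ c → y ≠ x → ConnIn T (S \ {c, x, y}) := by
  obtain ⟨h12, h1c, h2c⟩ := ne_of_card_eq_three (hN ▸ h.card f hf)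
  have hv1 : v1 ∈ S := h.sub f hf (by simp [hN])
  have hv2 : v2 ∈ S := h.sub f hf (by simp [hN])
  have hc : c ∈ S := h.sub f hf (by simp [hN])
  have hadj12 : T.Adj v1 v2 := h.clique f hf _ (by simp [hN]) _ (by simp [hN]) h12
  by_contra hcon
  push Not at hcon
  have split : ∀ x ∈ S, x ≠ v1 → x ≠ v2 → T.Adj c x → ∃ y ∈ S, y ≠ c ∧ y ≠ x ∧ ∃ A B : Finset V,
      A.Nonempty ∧ B.Nonempty ∧ Disjoint A B ∧ A ∪ B = S \ {c, x, y} ∧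
      ∀ a ∈ A, ∀ b ∈ B, ¬ T.Adj a b := by
    intro x hx hx1 hx2 hcx
    obtain ⟨y, hy, hyc, hyx, hnc⟩ := hcon x hx hx1 hx2 hcx
    refine ⟨y, hy, hyc, hyx, exists_split ?_ hnc⟩
    have : ({c, x, y} : Finset V).card ≤ 3 := Finset.card_le_three
    exact (Finset.sdiff_nonempty_of_card_lt_card (by omega))
  have bad : ∀ n : ℕ, ∀ x ∈ S, ∀ y ∈ S, ∀ K R : Finset V, K.card = n → T.Adj c x →
      y ≠ c → y ≠ x → K.Nonempty → R.Nonempty → Disjoint K R → K ∪ R = S \ {c, x, y} →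
      (∀ a ∈ K, ∀ b ∈ R, ¬ T.Adj a b) → v1 ∉ K → v2 ∉ K → False := by
    intro n
    induction n using Nat.strong_induction_on with
    | _ n ih =>
    intro x hx y hy K R hKn hcx hyc hyx hK hR hKR hun hno hv1K hv2K
    have hmem : ∀ z, z ∈ K ∨ z ∈ R ↔ z ∈ S ∧ z ≠ c ∧ z ≠ x ∧ z ≠ y := fun z => by
      simpa using congrArg (z ∈ ·) hun
    have hdis := Finset.disjoint_left.1 hKR
    have hxy : T.Adj x y := h.adj_of_threeCut h2 hc hx hy hcx.ne hyc.symm hyx.symm hK hR hKR hun hno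
    obtain ⟨x', hx'K, q, hq, hqK, hadj⟩ := (h2 x hx y hy hyx.symm).2 K (by
        intro z hz; have := (hmem z).1 (Or.inl hz); simp [this]) hK
      ⟨c, by simp [hc, hcx.ne, hyc.symm], fun hh => ((hmem c).1 (Or.inl hh)).2.1 rfl⟩
    have hqc : q = c := by
      by_contra hqc
      simp only [Finset.mem_sdiff, Finset.mem_insert, Finset.mem_singleton, not_or] at hq
      exact hno x' hx'K q (((hmem q).2 ⟨hq.1, hqc, hq.2.1, hq.2.2⟩).resolve_left hqK) hadj
    subst hqc
    have hx'S : x' ∈ S := ((hmem x').1 (Or.inl hx'K)).1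
    obtain ⟨y', hy', hy'c, hy'x, A, B, hA, hB, hAB, hun', hno'⟩ := split x' hx'S
      (fun hh => hv1K (hh ▸ hx'K)) (fun hh => hv2K (hh ▸ hx'K)) hadj.symm
    have main : ∀ A B : Finset V, A.Nonempty → B.Nonempty → Disjoint A B →
        A ∪ B = S \ {q, x', y'} → (∀ a ∈ A, ∀ b ∈ B, ¬ T.Adj a b) → x ∉ B → y ∉ B → False := by
      intro A B hA hB hAB hun' hno' hxB hyB
      have hBK' := h2.side_subset hc hx hy hy' hcx.ne hyc hyx hy'c hx'K hKR hun hno hun' hno' hxB hyB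
      have hx'B : x' ∉ B := fun hh => by
        have := hun' ▸ Finset.mem_union_right A hh
        simp at this
      have hBK : B ⊆ K.erase x' := fun b hb =>
        Finset.mem_erase.2 ⟨fun hh => hx'B (hh ▸ hb), hBK' b hb⟩
      have hlt : B.card < n := by
        have := Finset.card_le_card hBK
        rw [Finset.card_erase_of_mem hx'K] at this
        have := hK.card_pos
        omega
      exact ih _ hlt x' hx'S y' hy' B A rfl hadj.symm hy'c hy'x hB hA hAB.symm
        (by rw [Finset.union_comm, hun']) (fun a ha b hb h => hno' b hb a ha h.symm)
        (fun hh => hv1K (hBK' _ hh)) (fun hh => hv2K (hBK' _ hh))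
    have hno'' : ∀ a ∈ B, ∀ b ∈ A, ¬ T.Adj a b := fun a ha b hb h => hno' b hb a ha h.symm
    by_cases hside : x ∉ B ∧ y ∉ B
    · exact main A B hA hB hAB hun' hno' hside.1 hside.2
    · refine main B A hB hA hAB.symm (by rw [Finset.union_comm, hun']) hno'' ?_ ?_
      · intro hxA
        have := Finset.disjoint_left.1 hAB hxA
        exact hno' x hxA y (by tauto) hxy
      · intro hyA
        have := Finset.disjoint_left.1 hAB hyA
        exact hno' y hyA x (by tauto) hxy.symm
  obtain ⟨p, hp, x, hx, hxp, hadj⟩ := (h2 v1 hv1 v2 hv2 h12).2 {c} (by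
      simp [hc, h1c.symm, h2c.symm]) (by simp) (by
    obtain ⟨w, hw, hw'⟩ := Finset.exists_mem_notMem_of_card_lt_card (s := {v1, v2, c}) (t := S)
      (by have : ({v1, v2, c} : Finset V).card ≤ 3 := Finset.card_le_three
          omega)
    simp only [Finset.mem_insert, Finset.mem_singleton, not_or] at hw'
    exact ⟨w, by simp [hw, hw'], by simp [hw']⟩)
  obtain rfl : p = c := by simpa using hp
  simp only [Finset.mem_sdiff, Finset.mem_insert, Finset.mem_singleton, not_or] at hx
  obtain ⟨y, hy, hyc, hyx, A, B, hA, hB, hAB, hun, hno⟩ := split x hx.1 hx.2.1 hx.2.2 hadj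
  by_cases hside : v1 ∉ A ∧ v2 ∉ A
  · exact bad _ x hx.1 y hy A B rfl hadj hyc hyx hA hB hAB hun hno hside.1 hside.2
  · refine bad _ x hx.1 y hy B A rfl hadj hyc hyx hB hA hAB.symm
      (by rw [Finset.union_comm, hun]) (fun a ha b hb h => hno b hb a ha h.symm) ?_ ?_
    · intro h1
      have := Finset.disjoint_right.1 hAB h1
      exact hno v2 (by tauto) v1 h1 hadj12.symm
    · intro h1
      have := Finset.disjoint_right.1 hAB h1
      exact hno v1 (by tauto) v2 h1 hadj12

end Connectivity

section Contraction

variable {V ι : Type} [DecidableEq V] {T : SimpleGraph V} {S : Finset V} {F : Finset ι}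
  {N : ι → Finset V}

lemma collapse_pair_left (c x : V) : collapse {c, x} c c = c := by simp [collapse]

lemma collapse_pair_right (c x : V) : collapse {c, x} c x = c := by simp [collapse]

lemma collapse_pair_of_ne {c x z : V} (h1 : z ≠ c) (h2 : z ≠ x) : collapse {c, x} c z = z := by
  simp [collapse, h1, h2]

lemma collapse_pair_of_ne_right {c x z : V} (h2 : z ≠ x) : collapse {c, x} c z = z := by
  by_cases h : z = c <;> simp [collapse, h, h2]

lemma mem_image_collapse_of_ne {c x z : V} (h1 : z ≠ c) {X : Finset V} :
    z ∈ X.image (collapse {c, x} c) ↔ z ∈ X ∧ z ≠ x := by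
  rw [Finset.mem_image]
  constructor
  · rintro ⟨a, ha, rfl⟩
    by_cases hac : a = c
    · exact absurd (by rw [hac, collapse_pair_left]) h1
    by_cases hax : a = x
    · exact absurd (by rw [hax, collapse_pair_right]) h1
    rw [collapse_pair_of_ne hac hax]
    exact ⟨ha, hax⟩
  · rintro ⟨hz, hzx⟩
    exact ⟨z, hz, collapse_pair_of_ne h1 hzx⟩

lemma mem_image_collapse_self {c x : V} {X : Finset V} :
    c ∈ X.image (collapse {c, x} c) ↔ c ∈ X ∨ x ∈ X := by
  rw [Finset.mem_image]
  constructor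
  · rintro ⟨a, ha, h⟩
    by_cases hax : a = x
    · exact Or.inr (hax ▸ ha)
    · rw [collapse_pair_of_ne_right hax] at h
      exact Or.inl (h ▸ ha)
  · rintro (h | h)
    · exact ⟨c, h, collapse_pair_left c x⟩
    · exact ⟨x, h, collapse_pair_right c x⟩

lemma contractGraph_pair_adj {c x a b : V} (ha : a ∈ S) (hb : b ∈ S) (hax : a ≠ x) (hbx : b ≠ x)
    (h : T.Adj a b) : (contractGraph T S {c, x} c).Adj a b :=
  ⟨h.ne, a, ha, b, hb, collapse_pair_of_ne_right hax, collapse_pair_of_ne_right hbx, h⟩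

lemma NoTwoCut.contractPair (h2 : NoTwoCut T S) {c x : V} (hc : c ∈ S) (hx : x ∈ S)
    (hcx : c ≠ x) (hgood : ∀ y ∈ S, y ≠ c → y ≠ x → ConnIn T (S \ {c, x, y})) :
    NoTwoCut (contractGraph T S {c, x} c) (S.erase x) := by
  have himg : ∀ X : Finset V, X ⊆ S → ConnIn T X →
      ConnIn (contractGraph T S {c, x} c) (X.image (collapse {c, x} c)) := fun X hX hXc =>
    hXc.image _ fun a ha b hb hab hne => ⟨hne, a, hX ha, b, hX hb, rfl, rfl, hab⟩
  have hcase : ∀ b ∈ S, b ≠ c → b ≠ x →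
      ConnIn (contractGraph T S {c, x} c) (S.erase x \ {c, b}) := by
    intro b hb hbc hbx
    have e : S.erase x \ {c, b} = (S \ {c, x, b}).image (collapse {c, x} c) := by
      ext z
      by_cases hz : z = c
      · subst hz; rw [mem_image_collapse_self]; simp
      · rw [mem_image_collapse_of_ne hz]; simp; tauto
    rw [e]
    exact himg _ Finset.sdiff_subset (hgood b hb hbc hbx)
  intro a ha b hb hab
  obtain ⟨hax, haS⟩ := Finset.mem_erase.1 ha
  obtain ⟨hbx, hbS⟩ := Finset.mem_erase.1 hb
  by_cases hac : a = c
  · subst hac; exact hcase b hbS hab.symm hbx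
  by_cases hbc : b = c
  · subst hbc; rw [Finset.pair_comm a]; exact hcase a haS hab hax
  have e : S.erase x \ {a, b} = (S \ {a, b}).image (collapse {c, x} c) := by
    ext z
    by_cases hz : z = c
    · subst hz; rw [mem_image_collapse_self]; simp [hc, hcx, Ne.symm hac, Ne.symm hbc]
    · rw [mem_image_collapse_of_ne hz]; simp; tauto
  rw [e]
  exact himg _ Finset.sdiff_subset (h2 a haS b hbS hab)

/-- A face vertex `c` has a neighbour `x` off the face such that contracting `c x` preserves
the absence of separating pairs; the common neighbours of `c` and `x` are exactly the third
vertices of the two faces on `c x`. -/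
lemma IsFullSystem.exists_contraction (h : IsFullSystem T S F N) (h2 : NoTwoCut T S)
    (h4 : 4 ≤ S.card) {f : ι} (hf : f ∈ F) {v1 v2 c : V} (hN : N f = {v1, v2, c}) :
    ∃ x ∈ S, x ≠ v1 ∧ x ≠ v2 ∧ T.Adj c x ∧ NoTwoCut (contractGraph T S {c, x} c) (S.erase x) ∧
      ∃ u w g₁ g₂, g₁ ∈ F ∧ g₂ ∈ F ∧ g₁ ≠ g₂ ∧ N g₁ = {c, x, u} ∧ N g₂ = {c, x, w} ∧ u ≠ w ∧
        (∀ g ∈ F, c ∈ N g → x ∈ N g → g = g₁ ∨ g = g₂) ∧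
        (∀ y ∈ S, T.Adj c y → T.Adj x y → y = u ∨ y = w) := by
  classical
  obtain ⟨x, hx, hx1, hx2, hcx, hgood⟩ := h.exists_contractible h2 h4 hf hN
  have hc : c ∈ S := h.sub f hf (by simp [hN])
  have h2' := h2.contractPair hc hx hcx.ne hgood
  have h' := h.contractPair_full h2 hc hx hcx h4
  obtain ⟨g₁, g₂, hg, hgs⟩ := Finset.card_eq_two.1 (h.card_facesOn h2 hc hx hcx)
  have hg₁ : g₁ ∈ facesOn F N c x := by simp [hgs]
  have hg₂ : g₂ ∈ facesOn F N c x := by simp [hgs]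
  have hall : ∀ g ∈ F, c ∈ N g → x ∈ N g → g = g₁ ∨ g = g₂ := by
    intro g hgF h1 h2
    have : g ∈ facesOn F N c x := by simp [facesOn, hgF, h1, h2]
    simpa [hgs] using this
  obtain ⟨u, huS, huc, hux, hu⟩ := facesOn_third h.toIsFaceSystem hcx.ne hg₁
  obtain ⟨w, hwS, hwc, hwx, hw⟩ := facesOn_third h.toIsFaceSystem hcx.ne hg₂
  have hg₁F : g₁ ∈ F := (Finset.mem_filter.1 hg₁).1
  have hg₂F : g₂ ∈ F := (Finset.mem_filter.1 hg₂).1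
  refine ⟨x, hx, hx1, hx2, hcx, h2', u, w, g₁, g₂, hg₁F, hg₂F, hg, hu, hw, ?_, hall, ?_⟩
  · rintro rfl
    have hcu : T.Adj c u := h.clique g₁ hg₁F _ (by simp [hu]) _ (by simp [hu]) huc.symm
    have hxu : T.Adj x u := h.clique g₁ hg₁F _ (by simp [hu]) _ (by simp [hu]) hux.symm
    have hcard := h'.card_facesOn h2' (Finset.mem_erase.2 ⟨hcx.ne, hc⟩)
      (Finset.mem_erase.2 ⟨hux, huS⟩) (contractGraph_pair_adj hc huS hcx.ne hux hcu)
    obtain ⟨g, hgm⟩ := Finset.card_pos.1 (by rw [hcard]; omega)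
    simp only [facesOn, facesOff, Finset.mem_filter, mem_image_collapse_self,
      mem_image_collapse_of_ne huc] at hgm
    obtain ⟨⟨hgF, hgn⟩, hgc, hgu, -⟩ := hgm
    have hpair : ∀ z, T.Adj z u → z ∈ S → z ∈ N g₁ → z ∈ N g₂ → z ∈ N g → g = g₁ ∨ g = g₂ := by
      intro z hzu hzS hz1 hz2 hz
      have e : {g₁, g₂} = facesOn F N z u := by
        apply Finset.eq_of_subset_of_card_le
        · intro k hk
          simp only [Finset.mem_insert, Finset.mem_singleton] at hk
          rcases hk with rfl | rfl
          · exact Finset.mem_filter.2 ⟨hg₁F, hz1, by simp [hu]⟩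
          · exact Finset.mem_filter.2 ⟨hg₂F, hz2, by simp [hw]⟩
        · rw [h.card_facesOn h2 hzS huS hzu, Finset.card_pair hg]
      have : g ∈ facesOn F N z u := by simp [facesOn, hgF, hz, hgu]
      rw [← e] at this
      simpa using this
    have : g = g₁ ∨ g = g₂ := by
      rcases hgc with hz | hz
      · exact hpair c hcu hc (by simp [hu]) (by simp [hw]) hz
      · exact hpair x hxu hx (by simp [hu]) (by simp [hw]) hz
    rcases this with rfl | rfl
    · exact hgn (by simp [hu])
    · exact hgn (by simp [hw])
  · intro y hy hcy hxy
    by_contra hcon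
    push Not at hcon
    have hcard := h'.card_facesOn h2' (Finset.mem_erase.2 ⟨hcx.ne, hc⟩)
      (Finset.mem_erase.2 ⟨hxy.ne.symm, hy⟩) (contractGraph_pair_adj hc hy hcx.ne hxy.ne.symm hcy)
    have hno : ∀ g ∈ F, y ∈ N g → ¬ (c ∈ N g ∧ x ∈ N g) := by
      rintro g hgF hyg ⟨h1, h2⟩
      have := hcy.ne; have := hxy.ne
      rcases hall g hgF h1 h2 with rfl | rfl
      · rw [hu] at hyg; simp at hyg; grind
      · rw [hw] at hyg; simp at hyg; grind
    have hsub : facesOn F N c y ∪ facesOn F N x y ⊆ facesOn (facesOff F N c x)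
        (fun f => (N f).image (collapse {c, x} c)) c y := by
      intro g hg
      simp only [facesOn, facesOff, Finset.mem_union, Finset.mem_filter, mem_image_collapse_self,
        mem_image_collapse_of_ne hcy.ne.symm] at hg ⊢
      have := hxy.ne.symm
      rcases hg with hg | hg
      · exact ⟨⟨hg.1, hno g hg.1 hg.2.2⟩, Or.inl hg.2.1, hg.2.2, this⟩
      · exact ⟨⟨hg.1, hno g hg.1 hg.2.2⟩, Or.inr hg.2.1, hg.2.2, this⟩
    have hle := Finset.card_le_card hsub
    rw [Finset.card_union_of_disjoint, hcard, h.card_facesOn h2 hc hy hcy,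
      h.card_facesOn h2 hx hy hxy] at hle
    · omega
    · rw [Finset.disjoint_left]
      intro g hg1 hg2
      simp only [facesOn, Finset.mem_filter] at hg1 hg2
      exact hno g hg1.1 hg1.2.2 ⟨hg1.2.1, hg2.2.1⟩

end Contraction

/-- The faces `gs` are the triangles spanned by `v` and the consecutive pairs of the path. -/
inductive Fan {V ι : Type} [DecidableEq V] (N : ι → Finset V) (v : V) : List V → List ι → Prop
  | single (p : V) : Fan N v [p] []
  | cons {p q : V} {P : List V} {g : ι} {gs : List ι} : N g = {v, p, q} → Fan N v (q :: P) gs →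
      Fan N v (p :: q :: P) (g :: gs)

/-- Canonical constructions: starting from the base edge `v1 v2`, repeatedly a new vertex is
placed over a subpath of the outer path and joined to all its vertices. The data are the vertex
set, the outer path, the set of edges besides the base edge, and the list of faces. -/
inductive BuiltF {V ι : Type} [DecidableEq V] (N : ι → Finset V) (v1 v2 : V) :
    Finset V → List V → Set (Sym2 V) → List ι → Prop
  | base : v1 ≠ v2 → BuiltF N v1 v2 {v1, v2} [v1, v2] ∅ []
  | step {W : Finset V} {L Q R : List V} {p q v : V} {E : Set (Sym2 V)} {us gs : List ι} :
      BuiltF N v1 v2 W (L ++ p :: (Q ++ q :: R)) E us → v ∉ W → Fan N v (p :: (Q ++ [q])) gs →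
      BuiltF N v1 v2 (insert v W) (L ++ p :: v :: q :: R)
        (E ∪ {e | ∃ z ∈ p :: (Q ++ [q]), e = s(v, z)}) (gs ++ us)

section Fans

variable {V ι : Type} [DecidableEq V] {T : SimpleGraph V} {S : Finset V} {F : Finset ι}
  {N N' : ι → Finset V}

lemma Fan.length_eq {v : V} {P : List V} {gs : List ι} (h : Fan N v P gs) :
    P.length = gs.length + 1 := by
  induction h with
  | single p => rfl
  | cons _ _ ih => simp only [List.length_cons] at ih ⊢; omega

lemma Fan.append {v p : V} {L R : List V} {gs hs : List ι} (h : Fan N v (L ++ [p]) gs)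
    (h' : Fan N v (p :: R) hs) : Fan N v (L ++ p :: R) (gs ++ hs) := by
  induction L generalizing gs with
  | nil =>
    cases h
    exact h'
  | cons a L ih =>
    cases L with
    | nil =>
      cases h with
      | cons hN h =>
        cases h
        exact .cons hN h'
    | cons b L =>
      cases h with
      | cons hN h => exact .cons hN (ih h)

lemma Fan.split {v : V} {P : List V} {gs hs : List ι} (h : Fan N v P (gs ++ hs)) :
    ∃ L p R, P = L ++ p :: R ∧ Fan N v (L ++ [p]) gs ∧ Fan N v (p :: R) hs := by
  induction gs generalizing P with
  | nil =>
    cases P with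
    | nil => cases h
    | cons p P => exact ⟨[], p, P, rfl, .single p, h⟩
  | cons g gs ih =>
    cases h with
    | @cons p q P _ _ hN h =>
      obtain ⟨L, r, R, hP, h1, h2⟩ := ih h
      refine ⟨p :: L, r, R, by simp [hP], ?_, h2⟩
      cases L with
      | nil =>
        cases h1
        simp only [List.nil_append, List.cons.injEq] at hP
        exact .cons (hP.1 ▸ hN) (.single r)
      | cons b L =>
        simp only [List.cons_append, List.cons.injEq] at hP
        exact .cons (hP.1 ▸ hN) h1

lemma Fan.exists_mem {v : V} {P : List V} {gs : List ι} (h : Fan N v P gs) (hg : gs ≠ []) :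
    ∀ p ∈ P, ∃ g ∈ gs, v ∈ N g ∧ p ∈ N g := by
  induction h with
  | single p => exact absurd rfl hg
  | @cons p q P g gs hN h ih =>
    intro r hr
    by_cases hgs : gs = []
    · subst hgs
      cases h
      simp only [List.mem_cons, List.not_mem_nil, or_false] at hr
      exact ⟨g, by simp, by simp [hN], by rcases hr with rfl | rfl <;> simp [hN]⟩
    · rcases List.mem_cons.1 hr with rfl | hr
      · exact ⟨g, by simp, by simp [hN], by simp [hN]⟩
      · obtain ⟨k, hk, h1⟩ := ih hgs r hr
        exact ⟨k, by simp [hk], h1⟩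

lemma Fan.face_subset {v : V} {P : List V} {gs : List ι} (h : Fan N v P gs) :
    ∀ g ∈ gs, v ∈ N g ∧ ∀ z ∈ N g, z = v ∨ z ∈ P := by
  induction h with
  | single p => simp
  | @cons p q P g gs hN h ih =>
    intro k hk
    rcases List.mem_cons.1 hk with rfl | hk
    · refine ⟨by simp [hN], fun z hz => ?_⟩
      rw [hN] at hz
      simp only [Finset.mem_insert, Finset.mem_singleton] at hz
      rcases hz with rfl | rfl | rfl <;> simp
    · obtain ⟨h1, h2⟩ := ih k hk
      refine ⟨h1, fun z hz => ?_⟩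
      rcases h2 z hz with h3 | h3
      · exact Or.inl h3
      · exact Or.inr (List.mem_cons_of_mem _ h3)

lemma Fan.mono {v w : V} {P : List V} {gs : List ι} (h : Fan N v P gs)
    (hN : ∀ g ∈ gs, ∀ p ∈ P, ∀ q ∈ P, N g = {v, p, q} → N' g = {w, p, q}) : Fan N' w P gs := by
  induction h with
  | single p => exact .single p
  | @cons p q P g gs hg h ih =>
    exact .cons (hN g (by simp) p (by simp) q (by simp) hg)
      (ih fun k hk p hp q hq => hN k (by simp [hk]) p (List.mem_cons_of_mem _ hp) q
        (List.mem_cons_of_mem _ hq))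

namespace BuiltF

variable {v1 v2 : V} {W : Finset V} {P : List V} {E : Set (Sym2 V)} {us : List ι}

lemma mem_of_mem_path (h : BuiltF N v1 v2 W P E us) : ∀ p ∈ P, p ∈ W := by
  induction h with
  | base => simp
  | @step W L Q R p q v E us gs h hv hf ih =>
    intro z hz
    simp only [List.mem_append, List.mem_cons] at hz ih
    rw [Finset.mem_insert]
    grind

lemma path_nodup (h : BuiltF N v1 v2 W P E us) : P.Nodup := by
  induction h with
  | base h => simpa using h
  | @step W L Q R p q v E us gs h hv hf ih =>
    have hm := h.mem_of_mem_path
    have hvP : v ∉ L ++ p :: (Q ++ q :: R) := fun hh => hv (hm v hh)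
    simp only [List.nodup_append, List.nodup_cons, List.mem_append, List.mem_cons] at ih hvP ⊢
    grind

lemma head_last (h : BuiltF N v1 v2 W P E us) : P.head? = some v1 ∧ P.getLast? = some v2 := by
  induction h with
  | base => simp
  | @step W L Q R p q v E us gs h hv hf ih =>
    cases L <;> cases R <;> simp_all [List.getLast?_cons]

lemma face_subset (h : BuiltF N v1 v2 W P E us) : ∀ g ∈ us, N g ⊆ W := by
  induction h with
  | base => simp
  | @step W L Q R p q v E us gs h hv hf ih =>
    intro g hg z hz
    rcases List.mem_append.1 hg with hg | hg
    · rcases (hf.face_subset g hg).2 z hz with rfl | h1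
      · simp
      · refine Finset.mem_insert_of_mem (h.mem_of_mem_path z ?_)
        simp only [List.mem_append, List.mem_cons] at h1 ⊢
        grind
    · exact Finset.mem_insert_of_mem (ih g hg hz)

lemma congr (h : BuiltF N v1 v2 W P E us) (hN : ∀ g ∈ us, N g = N' g) :
    BuiltF N' v1 v2 W P E us := by
  induction h with
  | base h => exact .base h
  | @step W L Q R p q v E us gs h hv hf ih =>
    exact .step (ih fun g hg => hN g (List.mem_append_right _ hg)) hv
      (hf.mono fun g hg _ _ _ _ h => by rw [← hN g (List.mem_append_left _ hg), h])

end BuiltF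

lemma exists_first {α : Type} (p : α → Prop) (l : List α) (h : ∃ a ∈ l, p a) :
    ∃ A a C, l = A ++ a :: C ∧ p a ∧ ∀ b ∈ A, ¬ p b := by
  induction l with
  | nil => simp at h
  | cons b l ih =>
    by_cases hb : p b
    · exact ⟨[], b, l, rfl, hb, by simp⟩
    · obtain ⟨A, a, C, rfl, h1, h2⟩ := ih (by simpa [hb] using h)
      exact ⟨b :: A, a, C, rfl, h1, by simpa [hb] using h2⟩

lemma exists_maximal_initial_part {α : Type} (p : α → Prop) (l : List α) :
    ∃ A C, l = A ++ C ∧ (∀ b ∈ A, p b) ∧ (C = [] ∨ ∃ c C', C = c :: C' ∧ ¬ p c) := by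
  by_cases h : ∃ a ∈ l, ¬ p a
  · obtain ⟨A, a, C, rfl, h1, h2⟩ := exists_first _ l h
    exact ⟨A, a :: C, rfl, by simpa using h2, Or.inr ⟨a, C, rfl, h1⟩⟩
  · push Not at h
    exact ⟨l, [], by simp, h, Or.inl rfl⟩

end Fans

/-- A canonical construction of the full system: all vertices but `c` are built, the outer path
`P` consists of the neighbours of `c`, and every face except the outer face `o` occurs once. -/
structure IsCanonical {V ι : Type} [DecidableEq V] (T : SimpleGraph V) (S : Finset V)
    (F : Finset ι) (N : ι → Finset V) (v1 v2 c : V) (o : ι) (P : List V) (E : Set (Sym2 V))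
    (us gs : List ι) : Prop where
  built : BuiltF N v1 v2 (S.erase c) P E us
  fan : Fan N c P gs
  nodup : (gs ++ us).Nodup
  outer_notMem : o ∉ gs ++ us
  mem_faces : ∀ g ∈ gs ++ us, g ∈ F
  cover : ∀ g ∈ F, g ∈ us ∨ g ∈ gs ∨ g = o
  adj_last : ∀ y ∈ S, T.Adj c y → y ∈ P
  adj_edge : ∀ a ∈ S.erase c, ∀ b ∈ S.erase c, T.Adj a b → s(a, b) ∈ E ∨ s(a, b) = s(v1, v2)

section Canonical

variable {V ι : Type} [DecidableEq V] {T : SimpleGraph V} {S : Finset V} {F : Finset ι}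
  {N : ι → Finset V}

lemma image_collapse_of_notMem {c x : V} {X : Finset V} (h : x ∉ X) :
    X.image (collapse {c, x} c) = X := by
  ext z
  by_cases hz : z = c
  · subst hz
    rw [mem_image_collapse_self]
    simp [h]
  · rw [mem_image_collapse_of_ne hz]
    grind

lemma eq_of_image_collapse {c x p q : V} {X : Finset V} (hc : c ∉ X) (hx : x ∈ X) (hp : p ≠ c)
    (hq : q ≠ c) (h : X.image (collapse {c, x} c) = {c, p, q}) : X = {x, p, q} := by
  ext z
  simp only [Finset.mem_insert, Finset.mem_singleton]
  by_cases hz : z = c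
  · subst hz
    have : z ≠ x := fun e => hc (e ▸ hx)
    simp [hc, this, hp.symm, hq.symm]
  · have h2 := mem_image_collapse_of_ne (x := x) hz (X := X)
    rw [h] at h2
    simp only [Finset.mem_insert, Finset.mem_singleton, hz, false_or] at h2
    by_cases hzx : z = x
    · simp [hzx, hx]
    · simp [h2, hzx]

lemma perm_insert_two {α : Type} (A X C us : List α) (g h : α) :
    ((A ++ g :: h :: C) ++ (X ++ us)).Perm (g :: h :: ((A ++ (X ++ C)) ++ us)) := by
  classical
  rw [List.perm_iff_count]
  intro a
  simp only [List.count_append, List.count_cons]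
  omega

/-- The part of the fan of a contracted vertex `c` belonging to `x` is an interval. -/
lemma Fan.exists_interval {N : ι → Finset V} {c : V} {P : List V} {gs : List ι}
    (h : Fan N c P gs) (hP : P.Nodup) (t : ι → Prop) (ht : ∃ g ∈ gs, t g) {u w v1 v2 : V}
    (hhead : P.head? = some v1) (hlast : P.getLast? = some v2)
    (hchange : ∀ p ∈ P, (p = v1 ∨ p = v2 ∨ ∃ g ∈ gs, ¬ t g ∧ p ∈ N g) →
      (∃ g ∈ gs, t g ∧ p ∈ N g) → p = u ∨ p = w) :
    ∃ L p Q q R A X C, P = L ++ p :: (Q ++ q :: R) ∧ gs = A ++ (X ++ C) ∧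
      Fan N c (L ++ [p]) A ∧ Fan N c (p :: (Q ++ [q])) X ∧ Fan N c (q :: R) C ∧ X ≠ [] ∧
      (∀ g ∈ A, ¬ t g) ∧ (∀ g ∈ X, t g) ∧ (∀ g ∈ C, ¬ t g) ∧ (p = u ∧ q = w ∨ p = w ∧ q = u) := by
  obtain ⟨A, g, B, rfl, hg, hA⟩ := exists_first t gs ht
  obtain ⟨X, C, rfl, hX, hC⟩ := exists_maximal_initial_part t B
  rw [← List.cons_append] at h
  obtain ⟨L, p, R0, rfl, hLA, h'⟩ := h.split
  obtain ⟨L1, q, R, hR0, hXf, hCf⟩ := h'.split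
  obtain ⟨Q, rfl⟩ : ∃ Q, L1 = p :: Q := by
    cases L1 with
    | nil =>
      have := hXf.length_eq
      simp at this
    | cons a Q =>
      simp only [List.cons_append, List.cons.injEq] at hR0
      exact ⟨Q, by rw [hR0.1]⟩
  simp only [List.cons_append, List.cons.injEq, true_and] at hR0
  subst hR0
  rw [List.cons_append] at hXf
  have hpX : ∃ k ∈ A ++ g :: (X ++ C), t k ∧ p ∈ N k := by
    obtain ⟨k, hk, -, hk2⟩ := hXf.exists_mem (by simp) p (by simp)
    exact ⟨k, by simp at hk ⊢; tauto, by rcases List.mem_cons.1 hk with rfl | hk; exacts [hg, hX _ hk],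
      hk2⟩
  have hqX : ∃ k ∈ A ++ g :: (X ++ C), t k ∧ q ∈ N k := by
    obtain ⟨k, hk, -, hk2⟩ := hXf.exists_mem (by simp) q (by simp)
    exact ⟨k, by simp at hk ⊢; tauto, by rcases List.mem_cons.1 hk with rfl | hk; exacts [hg, hX _ hk],
      hk2⟩
  have hp : p = u ∨ p = w := by
    refine hchange p (by simp) ?_ hpX
    by_cases hA0 : A = []
    · subst hA0
      have := hLA.length_eq
      simp only [List.length_append, List.length_cons, List.length_nil] at this
      have hL : L = [] := List.eq_nil_of_length_eq_zero (by omega)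
      subst hL
      simp at hhead
      exact Or.inl hhead
    · obtain ⟨k, hk, -, hk2⟩ := hLA.exists_mem hA0 p (by simp)
      exact Or.inr (Or.inr ⟨k, by simp [hk], hA k hk, hk2⟩)
  have hq : q = u ∨ q = w := by
    refine hchange q (by simp) ?_ hqX
    rcases hC with rfl | ⟨k, C', rfl, hk⟩
    · have := hCf.length_eq
      simp only [List.length_cons, List.length_nil] at this
      have hL : R = [] := List.eq_nil_of_length_eq_zero (by omega)
      subst hL
      refine Or.inr (Or.inl ?_)
      simpa [List.getLast?_cons, List.getLast?_append] using hlast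
    · refine Or.inr (Or.inr ⟨k, by simp, hk, ?_⟩)
      cases hCf with
      | cons hN _ => simp [hN]
  have hpq : p ≠ q := by
    rintro rfl
    simp [List.nodup_append] at hP
  refine ⟨L, p, Q, q, R, A, g :: X, C, rfl, by simp, hLA, hXf, hCf, by simp, hA, ?_, ?_, by grind⟩
  · simpa [hg] using hX
  · intro k hk htk
    rcases hC with rfl | ⟨j, C', rfl, hj⟩
    · simp at hk
    obtain ⟨D, k, C'', hsp, hk, hD⟩ := exists_first t (j :: C') ⟨k, hk, htk⟩
    have hD0 : D ≠ [] := by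
      rintro rfl
      simp only [List.nil_append, List.cons.injEq] at hsp
      exact hj (hsp.1 ▸ hk)
    rw [hsp] at hCf
    obtain ⟨L2, r, R2, hR2, hD1, hD2⟩ := hCf.split
    obtain ⟨L3, rfl⟩ : ∃ L3, L2 = q :: L3 := by
      cases L2 with
      | nil =>
        have := hD1.length_eq
        simp only [List.nil_append, List.length_cons, List.length_nil] at this
        exact absurd (List.eq_nil_of_length_eq_zero (by omega)) hD0
      | cons a L3 =>
        simp only [List.cons_append, List.cons.injEq] at hR2
        exact ⟨L3, by rw [hR2.1]⟩
    simp only [List.cons_append, List.cons.injEq, true_and] at hR2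
    subst hR2
    have hr : r = u ∨ r = w := by
      refine hchange r (by simp) ?_ ?_
      · obtain ⟨m, hm, -, hm2⟩ := hD1.exists_mem hD0 r (by simp)
        exact Or.inr (Or.inr ⟨m, by rw [hsp]; simp [hm], hD m hm, hm2⟩)
      · refine ⟨k, by rw [hsp]; simp, hk, ?_⟩
        cases hD2 with
        | cons hN _ => simp [hN]
    have hpr : p ≠ r := by
      rintro rfl
      simp [List.nodup_append] at hP
    have hqr : q ≠ r := by
      rintro rfl
      simp [List.nodup_append] at hP
    grind


lemma IsFullSystem.exists_canonical_triangle (h : IsFullSystem T S F N) (h3 : S.card = 3) {o : ι}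
    (ho : o ∈ F) {v1 v2 c : V} (hN : N o = {v1, v2, c}) :
    ∃ P E us gs, IsCanonical T S F N v1 v2 c o P E us gs := by
  classical
  have hSN : ∀ f ∈ F, N f = S := fun f hf =>
    Finset.eq_of_subset_of_card_le (h.sub f hf) (by rw [h.card f hf, h3])
  have hS : S = {v1, v2, c} := by rw [← hSN o ho, hN]
  have hF : F.card = 2 := by have := h.card_eq; omega
  obtain ⟨f, hf, hfo⟩ := Finset.exists_mem_ne (s := F) (by omega) o
  have hFe : F = {o, f} := by
    symm
    refine Finset.eq_of_subset_of_card_le ?_ (by rw [hF, Finset.card_pair hfo.symm])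
    intro z; simp only [Finset.mem_insert, Finset.mem_singleton]
    rintro (rfl | rfl) <;> assumption
  obtain ⟨h12, h1c, h2c⟩ := ne_of_card_eq_three (by rw [← hS, h3] : ({v1, v2, c} : Finset V).card = 3)
  have hSc : S.erase c = {v1, v2} := by
    rw [hS]; ext z; simp only [Finset.mem_erase, Finset.mem_insert, Finset.mem_singleton]; grind
  refine ⟨[v1, v2], ∅, [], [f], ?_, ?_, by simp, by simpa using hfo.symm, by simpa using hf, ?_, ?_, ?_⟩
  · rw [hSc]; exact .base h12
  · refine .cons ?_ (.single _)
    rw [hSN f hf, hS]; ext z; simp only [Finset.mem_insert, Finset.mem_singleton]; tauto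
  · intro g hg
    rw [hFe] at hg
    simp only [Finset.mem_insert, Finset.mem_singleton] at hg
    simp; tauto
  · intro y hy hcy
    have := hcy.ne
    rw [hS] at hy
    simp only [Finset.mem_insert, Finset.mem_singleton] at hy
    simp; tauto
  · intro a ha b hb hab
    have := hab.ne
    rw [hSc] at ha hb
    simp only [Finset.mem_insert, Finset.mem_singleton] at ha hb
    refine Or.inr ?_
    rcases ha with rfl | rfl <;> rcases hb with rfl | rfl <;> simp_all [Sym2.eq_swap]

lemma IsFullSystem.exists_canonical (h : IsFullSystem T S F N) (h2 : NoTwoCut T S) {o : ι}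
    (ho : o ∈ F) {v1 v2 c : V} (hN : N o = {v1, v2, c}) :
    ∃ P E us gs, IsCanonical T S F N v1 v2 c o P E us gs := by
  classical
  induction hn : S.card using Nat.strong_induction_on generalizing T S F N with
  | _ n ih =>
  subst hn
  rcases Nat.lt_or_ge 3 S.card with h4 | h3
  swap
  · exact h.exists_canonical_triangle (by have := h.three_le; omega) ho hN
  obtain ⟨x, hx, hx1, hx2, hcx, h2', u, w, g₁, g₂, hg₁, hg₂, hg12, hN1, hN2, huw, hon, hcom⟩ :=
    h.exists_contraction h2 h4 ho hN
  have hcN : c ∈ N o := by simp [hN]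
  have hc : c ∈ S := h.sub o ho hcN
  have hxo : x ∉ N o := by simp [hN, hx1, hx2, hcx.ne']
  have hoF' : o ∈ facesOff F N c x := by simp [facesOff, ho, hxo]
  obtain ⟨P, E, us, gs, hcan⟩ := ih (S.erase x).card (Finset.card_erase_lt_of_mem hx)
    (h.contractPair_full h2 hc hx hcx h4) h2' hoF' (by rw [image_collapse_of_notMem hxo, hN]) rfl
  obtain ⟨hB, hfan, hnd, hono, hmf, hcov, hadl, hade⟩ := hcan
  have hPS : ∀ p ∈ P, p ∈ S ∧ p ≠ c ∧ p ≠ x := fun p hp => by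
    have := hB.mem_of_mem_path p hp
    simp only [Finset.mem_erase] at this
    tauto
  have hF' : ∀ g ∈ gs ++ us, g ∈ F ∧ ¬ (c ∈ N g ∧ x ∈ N g) := fun g hg => by
    simpa [facesOff] using hmf g hg
  have hgsN : ∀ g ∈ gs, c ∈ N g ∨ x ∈ N g := fun g hg =>
    mem_image_collapse_self.1 (hfan.face_subset g hg).1
  have husN : ∀ g ∈ us, c ∉ N g ∧ x ∉ N g := fun g hg => by
    have h1 : c ∉ (N g).image (collapse {c, x} c) := fun h3 => by
      simpa using hB.face_subset g hg h3
    rw [mem_image_collapse_self] at h1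
    tauto
  have hadjx : ∀ g ∈ gs, x ∈ N g → ∀ p ∈ P, p ∈ (N g).image (collapse {c, x} c) → T.Adj x p := by
    intro g hg hxg p hp hpg
    rw [mem_image_collapse_of_ne (hPS p hp).2.1] at hpg
    exact h.clique g (hF' g (by simp [hg])).1 x hxg p hpg.1 hpg.2.symm
  have hadjc : ∀ g ∈ gs, ¬ x ∈ N g → ∀ p ∈ P, p ∈ (N g).image (collapse {c, x} c) → T.Adj c p := by
    intro g hg hxg p hp hpg
    rw [mem_image_collapse_of_ne (hPS p hp).2.1] at hpg
    exact h.clique g (hF' g (by simp [hg])).1 c ((hgsN g hg).resolve_right hxg) p hpg.1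
      (hPS p hp).2.1.symm
  have hxt : ∃ g ∈ gs, x ∈ N g := by
    have hne := ne_of_card_eq_three (by rw [← hN1, h.card g₁ hg₁] : ({c, x, u} : Finset V).card = 3)
    have hu : u ∈ S := h.sub g₁ hg₁ (by simp [hN1])
    have h1 := h.card_facesOn h2 hx hu (h.clique g₁ hg₁ x (by simp [hN1]) u (by simp [hN1]) hne.2.2)
    obtain ⟨k, hk, hk1⟩ := Finset.exists_mem_ne (s := facesOn F N x u) (by omega) g₁
    simp only [facesOn, Finset.mem_filter] at hk
    have hck : c ∉ N k := by
      intro hck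
      rcases hon k hk.1 hck hk.2.1 with rfl | rfl
      · exact hk1 rfl
      · have := hk.2.2
        rw [hN2] at this
        simp only [Finset.mem_insert, Finset.mem_singleton] at this
        grind
    rcases hcov k (by simp [facesOff, hk.1, hck]) with h3 | h3 | rfl
    · exact absurd hk.2.1 (husN k h3).2
    · exact ⟨k, h3, hk.2.1⟩
    · exact absurd hcN hck
  have hadjo : ∀ p, p = v1 ∨ p = v2 → p ≠ c → T.Adj c p := fun p hp hpc =>
    h.clique o ho c hcN p (by rw [hN]; rcases hp with rfl | rfl <;> simp) hpc.symm
  obtain ⟨L, p, Q, q, R, A, X, C, rfl, rfl, hA, hX, hC, hX0, htA, htX, htC, hpq⟩ :=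
    hfan.exists_interval hB.path_nodup (fun g => x ∈ N g) hxt (u := u) (w := w) hB.head_last.1
      hB.head_last.2 (by
        rintro p hp h3 ⟨g, hg, hxg, hpg⟩
        refine hcom p (hPS p hp).1 ?_ (hadjx g hg hxg p hp hpg)
        rcases h3 with h3 | h3 | ⟨k, hk, hxk, hpk⟩
        · exact hadjo p (Or.inl h3) (hPS p hp).2.1
        · exact hadjo p (Or.inr h3) (hPS p hp).2.1
        · exact hadjc k hk hxk p hp hpk)
  obtain ⟨gu, gw, hgu, hgw, hguw, hNu, hNw, hon'⟩ : ∃ gu gw, gu ∈ F ∧ gw ∈ F ∧ gu ≠ gw ∧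
      N gu = {c, p, x} ∧ N gw = {c, x, q} ∧
      ∀ g ∈ F, c ∈ N g → x ∈ N g → g = gu ∨ g = gw := by
    have e : ∀ a : V, ({c, x, a} : Finset V) = {c, a, x} := fun a => by
      ext z; simp only [Finset.mem_insert, Finset.mem_singleton]; tauto
    rcases hpq with ⟨rfl, rfl⟩ | ⟨rfl, rfl⟩
    · exact ⟨g₁, g₂, hg₁, hg₂, hg12, by rw [hN1, e], hN2, hon⟩
    · exact ⟨g₂, g₁, hg₂, hg₁, hg12.symm, by rw [hN2, e], hN1, fun g h1 h3 h5 => (hon g h1 h3 h5).symm⟩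
  have hcomm' : ∀ y ∈ S, T.Adj c y → T.Adj x y → y = p ∨ y = q := fun y hy h1 h3 => by
    have := hcom y hy h1 h3
    grind
  have hfc : ∀ D, (∀ g ∈ D, g ∈ A ++ (X ++ C)) → (∀ g ∈ D, x ∉ N g) → ∀ M,
      Fan (fun f => (N f).image (collapse {c, x} c)) c M D → Fan N c M D := fun D _ hD M hf =>
    hf.mono fun g hg _ _ _ _ h1 => by rwa [image_collapse_of_notMem (hD g hg)] at h1
  have hXN : Fan N x (p :: (Q ++ [q])) X := hX.mono fun g hg a ha b hb h1 => by
    have hmem : ∀ a ∈ p :: (Q ++ [q]), a ∈ L ++ p :: (Q ++ q :: R) := fun a ha => by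
      simp at ha ⊢; tauto
    exact eq_of_image_collapse (fun h3 => (hF' g (by simp [hg])).2 ⟨h3, htX g hg⟩) (htX g hg)
      (hPS a (hmem a ha)).2.1 (hPS b (hmem b hb)).2.1 h1
  have hAN := hfc A (by simp +contextual) htA _ hA
  have hCN := hfc C (by simp +contextual) htC _ hC
  have hWx : insert x ((S.erase x).erase c) = S.erase c := by
    ext z; simp only [Finset.mem_insert, Finset.mem_erase]
    have := hcx.ne'
    grind
  have hB' : BuiltF N v1 v2 (S.erase c) (L ++ p :: x :: q :: R)
      (E ∪ {e | ∃ z ∈ p :: (Q ++ [q]), e = s(x, z)}) (X ++ us) := by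
    rw [← hWx]
    exact .step (hB.congr fun g hg => image_collapse_of_notMem (husN g hg).2) (by simp) hXN
  have hxadj : ∀ b ∈ S.erase c, T.Adj x b → b ∈ p :: (Q ++ [q]) := by
    intro b hb hxb
    simp only [Finset.mem_erase] at hb
    have hbP := hadl b (by simp [hb.2, hxb.ne'])
      ⟨hb.1.symm, x, hx, b, hb.2, collapse_pair_right c x, collapse_pair_of_ne_right hxb.ne', hxb⟩
    have hkey : T.Adj c b → b = p ∨ b = q := fun h1 => hcomm' b hb.2 h1 hxb
    have hLc : b ∈ L → T.Adj c b := fun hbL => by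
      obtain ⟨g, hg, -, hgb⟩ := hA.exists_mem (by
        rintro rfl
        have := hA.length_eq
        have hL : L = [] := List.eq_nil_of_length_eq_zero (by simpa using this)
        simp [hL] at hbL) b (by simp [hbL])
      exact hadjc g (by simp [hg]) (htA g hg) b (by simp [hbL]) hgb
    have hRc : b ∈ R → T.Adj c b := fun hbR => by
      obtain ⟨g, hg, -, hgb⟩ := hC.exists_mem (by
        rintro rfl
        have := hC.length_eq
        have hL : R = [] := List.eq_nil_of_length_eq_zero (by simpa using this)
        simp [hL] at hbR) b (by simp [hbR])
      exact hadjc g (by simp [hg]) (htC g hg) b (by simp [hbR]) hgb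
    simp only [List.mem_append, List.mem_cons, List.not_mem_nil, or_false] at hbP ⊢
    clear * - hbP hkey hLc hRc
    tauto
  have hguF' : gu ∉ A ++ (X ++ C) ++ us := fun h1 => (hF' gu h1).2 (by simp [hNu])
  have hgwF' : gw ∉ A ++ (X ++ C) ++ us := fun h1 => (hF' gw h1).2 (by simp [hNw])
  have hou : o ≠ gu := by rintro rfl; exact hxo (by simp [hNu])
  have how : o ≠ gw := by rintro rfl; exact hxo (by simp [hNw])
  have hperm := perm_insert_two A X C us gu gw
  refine ⟨_, _, _, A ++ gu :: gw :: C, hB', hAN.append (.cons hNu (.cons hNw hCN)), ?_, ?_, ?_, ?_,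
    ?_, ?_⟩
  · rw [hperm.nodup_iff, List.nodup_cons, List.nodup_cons, List.mem_cons, not_or]
    exact ⟨⟨hguw, hguF'⟩, hgwF', hnd⟩
  · rw [hperm.mem_iff, List.mem_cons, List.mem_cons, not_or, not_or]
    exact ⟨hou, how, hono⟩
  · intro g hg
    rw [hperm.mem_iff, List.mem_cons, List.mem_cons] at hg
    rcases hg with rfl | rfl | hg
    exacts [hgu, hgw, (hF' g hg).1]
  · intro g hg
    by_cases h1 : g = o
    · exact Or.inr (Or.inr h1)
    have h3 : g ∈ (A ++ gu :: gw :: C) ++ (X ++ us) := by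
      rw [hperm.mem_iff, List.mem_cons, List.mem_cons]
      by_cases h3 : c ∈ N g ∧ x ∈ N g
      · rcases hon' g hg h3.1 h3.2 with h5 | h5
        exacts [Or.inl h5, Or.inr (Or.inl h5)]
      · refine Or.inr (Or.inr (List.mem_append.2 ?_))
        rcases hcov g (by simp only [facesOff, Finset.mem_filter]; exact ⟨hg, h3⟩) with h5 | h5 | h5
        exacts [Or.inr h5, Or.inl h5, absurd h5 h1]
    rcases List.mem_append.1 h3 with h5 | h5
    exacts [Or.inr (Or.inl h5), Or.inl h5]
  · intro y hy hcy
    by_cases hyx : y = x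
    · simp [hyx]
    have h1 := hadl y (by simp [hy, hyx]) (contractGraph_pair_adj hc hy hcx.ne hyx hcy)
    have h3 : y ∈ Q → y = p ∨ y = q := fun hyQ => by
      obtain ⟨g, hg, -, hgb⟩ := hX.exists_mem hX0 y (by simp [hyQ])
      exact hcomm' y hy hcy (hadjx g (by simp [hg]) (htX g hg) y (by simp [hyQ]) hgb)
    simp only [List.mem_append, List.mem_cons] at h1 ⊢
    clear * - h1 h3
    tauto
  · intro a ha b hb hab
    by_cases hax : a = x
    · subst hax
      exact Or.inl (Or.inr ⟨b, hxadj b hb hab, rfl⟩)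
    by_cases hbx : b = x
    · subst hbx
      exact Or.inl (Or.inr ⟨a, hxadj a ha hab.symm, Sym2.eq_swap⟩)
    simp only [Finset.mem_erase] at ha hb
    rcases hade a (by simp [ha, hax]) b (by simp [hb, hbx])
      (contractGraph_pair_adj ha.2 hb.2 hax hbx hab) with h1 | h1
    · exact Or.inl (Or.inl h1)
    · exact Or.inr h1

end Canonical

section Parity

open Complex

lemma isSimplyConnected_univ {X : Type} [TopologicalSpace X] [ContractibleSpace X] :
    IsSimplyConnected (Set.univ : Set X) := by
  have : ContractibleSpace (Set.univ : Set X) := (Homeomorph.Set.univ X).contractibleSpace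
  unfold IsSimplyConnected
  infer_instance

lemma exists_log_square {g : ℝ × ℝ → ℂ} (hg : Continuous g) (h0 : ∀ t, g t ≠ 0) :
    ∃ l : ℝ × ℝ → ℂ, Continuous l ∧ ∀ t, exp (l t) = g t := by
  obtain ⟨f, hf, he⟩ := exists_continuousOn_eqOn_exp_comp (U := (Set.univ : Set (ℝ × ℝ)))
    isSimplyConnected_univ isOpen_univ
    hg.continuousOn (by rintro ⟨t, -, ht⟩; exact h0 t ht)
  exact ⟨f, continuousOn_univ.1 hf, fun t => he (Set.mem_univ t)⟩

/-- Two logarithms of the same curve have the same increment. -/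
lemma log_increment_unique {l l' : ℝ → ℂ} (h : Continuous l) (h' : Continuous l')
    (he : ∀ t, exp (l t) = exp (l' t)) : l 1 - l 0 = l' 1 - l' 0 := by
  have hperiod : ∀ t, ∃ n : ℤ, l t = l' t + n * (2 * Real.pi * I) := fun t =>
    exp_eq_exp_iff_exists_int.1 (he t)
  choose n hn using hperiod
  have hpi : (2 * Real.pi * I : ℂ) ≠ 0 := two_pi_I_ne_zero
  have hc : Continuous fun t => (((l t - l' t) / (2 * Real.pi * I)).re : ℝ) := by fun_prop
  have hval : ∀ t, ((l t - l' t) / (2 * Real.pi * I)).re = n t := fun t => by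
    rw [hn t]
    have : (l' t + n t * (2 * Real.pi * I) - l' t) / (2 * Real.pi * I) = n t := by
      field_simp
      ring
    rw [this]; simp
  have hcn : Continuous n := by
    have h1 : Continuous fun t => ((n t : ℤ) : ℝ) := by
      convert hc using 2 with t
      exact (hval t).symm
    exact Int.isClosedEmbedding_coe_real.isInducing.continuous_iff.2 h1
  have h01 : n 1 = n 0 := PreconnectedSpace.constant inferInstance hcn
  rw [hn 1, hn 0, h01]; ring

variable {V : Type} {G : SimpleGraph V}

/-- The position of a vertex as a complex number. -/
noncomputable def PlaneDrawing.pt (D : PlaneDrawing G) (v : V) : ℂ :=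
  equivRealProdCLM.symm (D.vert v)

lemma PlaneDrawing.vert_mem_edgeImage_iff (D : PlaneDrawing G) {a b y : V} (h : G.Adj a b) :
    D.vert y ∈ D.edgeImage s(a, b) → y = a ∨ y = b := by
  rintro ⟨t, ht, hty⟩
  have hends := D.edge_ends a b h
  rcases eq_or_lt_of_le ht.1 with h0 | h0
  · have : D.vert y ∈ ({D.vert a, D.vert b} : Set _) := by
      rw [← hends, ← hty, ← h0]; simp
    rcases this with h1 | h1
    · exact Or.inl (D.vert_inj h1)
    · exact Or.inr (D.vert_inj h1)
  rcases eq_or_lt_of_le ht.2 with h1 | h1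
  · have : D.vert y ∈ ({D.vert a, D.vert b} : Set _) := by
      rw [← hends, ← hty, h1]; simp
    rcases this with h1 | h1
    · exact Or.inl (D.vert_inj h1)
    · exact Or.inr (D.vert_inj h1)
  · exact absurd ⟨t, ⟨h0, h1⟩, hty⟩ (D.edge_int_vert _ h y)

lemma PlaneDrawing.edge_mem_cases (D : PlaneDrawing G) {a b : V} (h : G.Adj a b) {t : ℝ}
    (ht : t ∈ Set.Icc (0 : ℝ) 1) : (t ∈ Set.Ioo (0 : ℝ) 1) ∨
      D.edge s(a, b) t = D.vert a ∨ D.edge s(a, b) t = D.vert b := by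
  have hends := D.edge_ends a b h
  rcases eq_or_lt_of_le ht.1 with h0 | h0
  · refine Or.inr ?_
    have : D.edge s(a, b) t ∈ ({D.vert a, D.vert b} : Set _) := by
      rw [← hends, ← h0]; simp
    exact this
  rcases eq_or_lt_of_le ht.2 with h1 | h1
  · refine Or.inr ?_
    have : D.edge s(a, b) t ∈ ({D.vert a, D.vert b} : Set _) := by
      rw [← hends, h1]; simp
    exact this
  · exact Or.inl ⟨h0, h1⟩

lemma PlaneDrawing.disjoint_edgeImage (D : PlaneDrawing G) {a b c d : V} (h : G.Adj a b)
    (h' : G.Adj c d) (hac : a ≠ c) (had : a ≠ d) (hbc : b ≠ c) (hbd : b ≠ d) {P : ℝ × ℝ}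
    (hP : P ∈ D.edgeImage s(a, b)) (hP' : P ∈ D.edgeImage s(c, d)) : False := by
  obtain ⟨t, ht, rfl⟩ := id hP
  obtain ⟨t', ht', hE⟩ := id hP'
  rcases D.edge_mem_cases h ht with h1 | h1 | h1
  · rcases D.edge_mem_cases h' ht' with h2 | h2 | h2
    · have hne : s(a, b) ≠ s(c, d) := by
        intro e
        rw [Sym2.eq_iff] at e
        tauto
      have := D.edge_disjoint _ h _ h' hne
      exact absurd (this ▸ ⟨⟨t, h1, rfl⟩, ⟨t', h2, hE⟩⟩ :
        D.edge s(a, b) t ∈ (∅ : Set (ℝ × ℝ))) (Set.notMem_empty _)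
    · rw [← hE, h2] at hP
      have := D.vert_mem_edgeImage_iff h hP
      tauto
    · rw [← hE, h2] at hP
      have := D.vert_mem_edgeImage_iff h hP
      tauto
  · rw [h1] at hP'
    have := D.vert_mem_edgeImage_iff h' hP'
    tauto
  · rw [h1] at hP'
    have := D.vert_mem_edgeImage_iff h' hP'
    tauto

/-- A parametrization of an edge from `a` to `b` by the real line. -/
lemma PlaneDrawing.exists_curve (D : PlaneDrawing G) {a b : V} (h : G.Adj a b) :
    ∃ γ : ℝ → ℂ, Continuous γ ∧ γ 0 = D.pt a ∧ γ 1 = D.pt b ∧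
      ∀ t, ∃ P ∈ D.edgeImage s(a, b), γ t = equivRealProdCLM.symm P := by
  have hends := D.edge_ends a b h
  let e : ℝ → ℂ := fun t => equivRealProdCLM.symm (D.edge s(a, b) (Set.projIcc 0 1 zero_le_one t))
  have he : Continuous e := by
    refine equivRealProdCLM.symm.continuous.comp ?_
    have := (D.edge_cont s(a, b) h).domRestrict
    exact this.comp continuous_projIcc
  have hmem : ∀ t, ∃ P ∈ D.edgeImage s(a, b), e t = equivRealProdCLM.symm P := fun t =>
    ⟨_, ⟨_, (Set.projIcc 0 1 zero_le_one t).2, rfl⟩, rfl⟩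
  have e0 : e 0 = equivRealProdCLM.symm (D.edge s(a, b) 0) := by simp [e]
  have e1 : e 1 = equivRealProdCLM.symm (D.edge s(a, b) 1) := by simp [e]
  have hcases : (D.edge s(a, b) 0 = D.vert a ∧ D.edge s(a, b) 1 = D.vert b) ∨
      (D.edge s(a, b) 0 = D.vert b ∧ D.edge s(a, b) 1 = D.vert a) := by
    rwa [Set.pair_eq_pair_iff] at hends
  rcases hcases with ⟨h0, h1⟩ | ⟨h0, h1⟩
  · exact ⟨e, he, by rw [e0, h0]; rfl, by rw [e1, h1]; rfl, hmem⟩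
  · refine ⟨fun t => e (1 - t), by fun_prop, ?_, ?_, fun t => hmem _⟩
    · simp only [sub_zero]; rw [e1, h1]; rfl
    · simp only [sub_self]; rw [e0, h0]; rfl

/-- Parity data of a plane drawing: for independent edges the winding parities of the endpoints
add up to a quantity which depends only on the endpoints. -/
lemma PlaneDrawing.exists_parity (D : PlaneDrawing G) :
    ∃ (n : V → V → V → ZMod 2) (σ : V → V → ZMod 2), (∀ u w, u ≠ w → σ u w + σ w u = 1) ∧
      ∀ x x' y y', G.Adj x x' → G.Adj y y' → x ≠ y → x ≠ y' → x' ≠ y → x' ≠ y' →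
        n y x x' + n y' x x' + n x y y' + n x' y y' = σ x' y' + σ x' y + σ x y' + σ x y := by
  classical
  have hpi : (2 * Real.pi * I : ℂ) ≠ 0 := two_pi_I_ne_zero
  have hinj : ∀ u w, u ≠ w → D.pt u - D.pt w ≠ 0 := fun u w h h' =>
    h (D.vert_inj (equivRealProdCLM.symm.injective (sub_eq_zero.1 h')))
  have hγ : ∀ a b, ∃ γ : ℝ → ℂ, G.Adj a b → Continuous γ ∧ γ 0 = D.pt a ∧ γ 1 = D.pt b ∧
      ∀ t, ∃ P ∈ D.edgeImage s(a, b), γ t = equivRealProdCLM.symm P := fun a b => by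
    by_cases h : G.Adj a b
    · obtain ⟨γ, hγ⟩ := D.exists_curve h
      exact ⟨γ, fun _ => hγ⟩
    · exact ⟨0, fun h' => absurd h' h⟩
  choose γ hγ using hγ
  let A : V → V → ℂ := fun u w => log (D.pt u - D.pt w)
  have hA : ∀ u w, u ≠ w → exp (A u w) = D.pt u - D.pt w := fun u w h => exp_log (hinj u w h)
  have hβ : ∀ u w, ∃ β : ℤ, u ≠ w → A u w = A w u + Real.pi * I + β * (2 * Real.pi * I) := by
    intro u w
    by_cases h : u = w
    · exact ⟨0, fun h' => absurd h h'⟩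
    have : exp (A u w) = exp (A w u + Real.pi * I) := by
      rw [exp_add, exp_pi_mul_I, hA u w h, hA w u (Ne.symm h)]; ring
    obtain ⟨β, hβ⟩ := exp_eq_exp_iff_exists_int.1 this
    exact ⟨β, fun _ => hβ⟩
  choose β hβ using hβ
  have hm : ∀ y x x', ∃ m : ℤ, G.Adj x x' → y ≠ x → y ≠ x' → ∀ l : ℝ → ℂ, Continuous l →
      (∀ t, exp (l t) = γ x x' t - D.pt y) →
      l 1 - l 0 = A x' y - A x y + m * (2 * Real.pi * I) := by
    intro y x x'
    by_cases h : G.Adj x x' ∧ y ≠ x ∧ y ≠ x' ∧ ∃ l : ℝ → ℂ, Continuous l ∧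
      ∀ t, exp (l t) = γ x x' t - D.pt y
    swap
    · exact ⟨0, fun h1 h2 h3 l h4 h5 => absurd ⟨h1, h2, h3, l, h4, h5⟩ h⟩
    obtain ⟨h, h1, h2, l, hl, hle⟩ := h
    obtain ⟨-, g0, g1, -⟩ := hγ x x' h
    have : exp (l 1 - l 0) = exp (A x' y - A x y) := by
      rw [exp_sub, exp_sub, hle, hle, g0, g1, hA _ _ h1.symm, hA _ _ h2.symm]
    obtain ⟨m, hm⟩ := exp_eq_exp_iff_exists_int.1 this
    refine ⟨m, fun _ _ _ l' hl' hle' => ?_⟩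
    rw [← hm]
    exact log_increment_unique hl' hl fun t => by rw [hle, hle']
  choose m hm using hm
  refine ⟨fun y x x' => (m y x x' : ZMod 2), fun u w => (β u w : ZMod 2), fun u w h => ?_, ?_⟩
  · have h1 := hβ u w h
    have h2 := hβ w u h.symm
    have h3 : ((β u w + β w u + 1 : ℤ) : ℂ) * (2 * Real.pi * I) = 0 := by
      push_cast
      linear_combination -h1 - h2
    have h4 : β u w + β w u + 1 = 0 := by
      rcases mul_eq_zero.1 h3 with h | h
      · exact_mod_cast h
      · exact absurd h hpi
    have h5 : ((β u w + β w u + 1 : ℤ) : ZMod 2) = 0 := by rw [h4]; simp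
    push_cast at h5
    have h6 : (2 : ZMod 2) = 0 := rfl
    linear_combination h5 - h6
  · intro x x' y y' hx hy h1 h2 h3 h4
    obtain ⟨hc, c0, c1, cm⟩ := hγ x x' hx
    obtain ⟨hd, d0, d1, dm⟩ := hγ y y' hy
    obtain ⟨L, hL, hLe⟩ := exists_log_square (g := fun p => γ x x' p.1 - γ y y' p.2) (by fun_prop) (by
      rintro ⟨s, t⟩ h0
      obtain ⟨P, hP, hPs⟩ := cm s
      obtain ⟨P', hP', hPt⟩ := dm t
      have : P = P' := equivRealProdCLM.symm.injective (by
        rw [← hPs, ← hPt]; exact sub_eq_zero.1 h0)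
      exact D.disjoint_edgeImage hx hy h1 h2 h3 h4 hP (this ▸ hP'))
    have e1 := hm y x x' hx h1.symm h3.symm (fun s => L (s, 0)) (by fun_prop) fun s => by
      rw [hLe, d0]
    have e2 := hm y' x x' hx h2.symm h4.symm (fun s => L (s, 1)) (by fun_prop) fun s => by
      rw [hLe, d1]
    have e3 := hm x y y' hy h1 h2 (fun s => L (0, s) + Real.pi * I) (by fun_prop) fun s => by
      rw [exp_add, exp_pi_mul_I, hLe, c0]; ring
    have e4 := hm x' y y' hy h3 h4 (fun s => L (1, s) + Real.pi * I) (by fun_prop) fun s => by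
      rw [exp_add, exp_pi_mul_I, hLe, c1]; ring
    have b1 := hβ x' y' h4
    have b2 := hβ x' y h3
    have b3 := hβ x y' h2
    have b4 := hβ x y h1
    have h5 : ((m y x x' + m x' y y' - m x y y' - m y' x x' - β x' y' + β x' y + β x y' - β x y : ℤ)
        : ℂ) * (2 * Real.pi * I) = 0 := by
      push_cast
      linear_combination -e1 + e2 + e3 - e4 + b1 - b2 - b3 + b4
    have h6 : m y x x' + m x' y y' - m x y y' - m y' x x' - β x' y' + β x' y + β x y' - β x y = 0 := by
      rcases mul_eq_zero.1 h5 with h | h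
      · exact_mod_cast h
      · exact absurd h hpi
    have h7 := congrArg (Int.cast : ℤ → ZMod 2) h6
    push_cast at h7
    have h8 : (2 : ZMod 2) = 0 := rfl
    linear_combination h7 + ((m y' x x' : ZMod 2) + m x y y' - β x' y - β x y') * h8

/-- The winding parity of a walk around a vertex. -/
def walkParity (n : V → V → V → ZMod 2) (y : V) : {a b : V} → G.Walk a b → ZMod 2
  | _, _, .nil => 0
  | a, _, .cons (v := c) _ p => n y a c + walkParity n y p

lemma walkParity_edge {n : V → V → V → ZMod 2} {σ : V → V → ZMod 2}
    (h : ∀ x x' y y', G.Adj x x' → G.Adj y y' → x ≠ y → x ≠ y' → x' ≠ y → x' ≠ y' →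
      n y x x' + n y' x x' + n x y y' + n x' y y' = σ x' y' + σ x' y + σ x y' + σ x y)
    {y y' : V} (hy : G.Adj y y') {a b : V} (p : G.Walk a b) (hyp : y ∉ p.support)
    (hyp' : y' ∉ p.support) :
    walkParity n y p + walkParity n y' p + n a y y' + n b y y' =
      σ b y' + σ b y + σ a y' + σ a y := by
  have h2 : (2 : ZMod 2) = 0 := rfl
  induction p with
  | nil =>
    simp only [walkParity]
    linear_combination (n _ y y' - σ _ y' - σ _ y) * h2
  | @cons a c b hac p ih =>
    simp only [SimpleGraph.Walk.support_cons, List.mem_cons, not_or] at hyp hyp'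
    have h1 := ih hyp.2 hyp'.2
    have h3 := h a c y y' hac hy (Ne.symm hyp.1) (Ne.symm hyp'.1)
      (fun e => hyp.2 (e ▸ p.start_mem_support)) (fun e => hyp'.2 (e ▸ p.start_mem_support))
    simp only [walkParity]
    linear_combination h1 + h3 + (σ c y' + σ c y - n c y y') * h2

lemma walkParity_walk {n : V → V → V → ZMod 2} {σ : V → V → ZMod 2}
    (h : ∀ x x' y y', G.Adj x x' → G.Adj y y' → x ≠ y → x ≠ y' → x' ≠ y → x' ≠ y' →
      n y x x' + n y' x x' + n x y y' + n x' y y' = σ x' y' + σ x' y + σ x y' + σ x y)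
    {a b c d : V} (p : G.Walk a b) (q : G.Walk c d) (hd : ∀ z ∈ p.support, z ∉ q.support) :
    walkParity n c p + walkParity n d p + walkParity n a q + walkParity n b q =
      σ b d + σ b c + σ a d + σ a c := by
  have h2 : (2 : ZMod 2) = 0 := rfl
  induction q with
  | nil =>
    simp only [walkParity]
    linear_combination (walkParity n _ p - σ b _ - σ a _) * h2
  | @cons c e d hce q ih =>
    have h1 := ih fun z hz hzq => hd z hz (by simp [hzq])
    have h3 := walkParity_edge h hce p (fun hc => hd c hc (by simp))
      (fun he => hd e he (by simp))
    simp only [walkParity]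
    linear_combination h1 + h3 + (σ b e + σ a e - walkParity n e p) * h2

lemma ConnIn.exists_walk {X : Finset V} (h : ConnIn G X) {a b : V} (ha : a ∈ X) (hb : b ∈ X) :
    ∃ p : G.Walk a b, ∀ z ∈ p.support, z ∈ X := by
  classical
  by_contra hcon
  obtain ⟨c, hc, d, hd, hdA, hcd⟩ := h.2
    (X.filter fun b => ∃ p : G.Walk a b, ∀ z ∈ p.support, z ∈ X) (Finset.filter_subset _ _)
    ⟨a, by simp only [Finset.mem_filter]; exact ⟨ha, .nil, by simpa using ha⟩⟩
    ⟨b, hb, by simp only [Finset.mem_filter]; exact fun h => hcon h.2⟩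
  simp only [Finset.mem_filter] at hc hdA
  obtain ⟨-, p, hp⟩ := hc
  refine hdA ⟨hd, p.concat hcd, fun z hz => ?_⟩
  simp only [SimpleGraph.Walk.support_concat, List.concat_eq_append, List.mem_append,
    List.mem_singleton] at hz
  grind

/-- The parity count excluding `K₃,₃`. -/
lemma parity_contradiction (P Q : Fin 3 → Fin 3 → Fin 3 → ZMod 2)
    (ff fa af aa : Fin 3 → Fin 3 → ZMod 2)
    (hR : ∀ i j i' j', i ≠ i' → j ≠ j' →
      P i j j' + Q i j i' + P i' j' j + Q i' j' i = ff i i' + fa i j' + af j i' + aa j j')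
    (haa : ∀ j j', j ≠ j' → aa j j' + aa j' j = 1) : False := by
  have h2 : (2 : ZMod 2) = 0 := rfl
  have hP : ∀ j j', j ≠ j' →
      Q 0 j 1 + Q 1 j' 0 + (Q 0 j 2 + Q 2 j' 0) + (Q 1 j 2 + Q 2 j' 1) +
      (P 0 j j' + P 1 j' j + (P 0 j j' + P 2 j' j) + (P 1 j j' + P 2 j' j)) =
      ff 0 1 + ff 0 2 + ff 1 2 + fa 1 j' + af j 1 + aa j j' := fun j j' hj => by
    linear_combination hR 0 j 1 j' (by decide) hj + hR 0 j 2 j' (by decide) hj +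
      hR 1 j 2 j' (by decide) hj + (fa 0 j' + af j 2 + aa j j') * h2
  have h01 := hP 0 1 (by decide)
  have h02 := hP 0 2 (by decide)
  have h12 := hP 1 2 (by decide)
  have h10 := hP 1 0 (by decide)
  have h20 := hP 2 0 (by decide)
  have h21 := hP 2 1 (by decide)
  have a01 := haa 0 1 (by decide)
  have a02 := haa 0 2 (by decide)
  have a12 := haa 1 2 (by decide)
  clear h2
  grind

/-- A plane graph has no `K₃,₃` minor in which one side consists of single vertices. -/
lemma PlaneDrawing.no_minor (D : PlaneDrawing G) (X : Fin 3 → Finset V)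
    (hX : ∀ j, ConnIn G (X j)) (hdis : ∀ i j, i ≠ j → Disjoint (X i) (X j)) (f : Fin 3 → V)
    (hf : Function.Injective f) (hfX : ∀ i j, f i ∉ X j) (hadj : ∀ i j, ∃ y ∈ X j, G.Adj y (f i)) :
    False := by
  obtain ⟨n, σ, hσ, hn⟩ := D.exists_parity
  have ha : ∀ j, ∃ a, a ∈ X j := fun j => (hX j).1
  choose a ha using ha
  have hw : ∀ i j, ∃ p : G.Walk (a j) (f i), ∀ z ∈ p.support, z ∈ X j ∨ z = f i := by
    intro i j
    obtain ⟨y, hy, hyf⟩ := hadj i j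
    obtain ⟨p, hp⟩ := (hX j).exists_walk (ha j) hy
    refine ⟨p.concat hyf, fun z hz => ?_⟩
    simp only [SimpleGraph.Walk.support_concat, List.concat_eq_append, List.mem_append,
    List.mem_singleton] at hz
    rcases hz with hz | hz
    · exact Or.inl (hp z hz)
    · exact Or.inr hz
  choose w hw using hw
  have hR : ∀ i j i' j', i ≠ i' → j ≠ j' →
      walkParity n (a j') (w i j) + walkParity n (f i') (w i j) + walkParity n (a j) (w i' j') +
        walkParity n (f i) (w i' j') =
      σ (f i) (f i') + σ (f i) (a j') + σ (a j) (f i') + σ (a j) (a j') := by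
    intro i j i' j' hi hj
    refine walkParity_walk hn _ _ fun z hz hz' => ?_
    rcases hw i j z hz with h1 | h1 <;> rcases hw i' j' z hz' with h2 | h2
    · exact Finset.disjoint_left.1 (hdis j j' hj) h1 h2
    · exact hfX i' j (h2 ▸ h1)
    · exact hfX i j' (h1 ▸ h2)
    · exact hi (hf (h1.symm.trans h2))
  have haa : ∀ j j', j ≠ j' → σ (a j) (a j') + σ (a j') (a j) = 1 := fun j j' hj =>
    hσ _ _ fun e => Finset.disjoint_left.1 (hdis j j' hj) (ha j) (e ▸ ha j')
  exact parity_contradiction _ _ _ _ _ _ hR haa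

end Parity

/-- Canonical constructions without faces: starting from the base edge `v1 v2`, repeatedly a new
vertex is placed over a subpath of the outer path and joined to all its vertices. -/
inductive Built {V : Type} [DecidableEq V] (v1 v2 : V) :
    Finset V → List V → Set (Sym2 V) → Prop
  | base : v1 ≠ v2 → Built v1 v2 {v1, v2} [v1, v2] ∅
  | step {W : Finset V} {L Q R : List V} {p q v : V} {E : Set (Sym2 V)} :
      Built v1 v2 W (L ++ p :: (Q ++ q :: R)) E → v ∉ W →
      Built v1 v2 (insert v W) (L ++ p :: v :: q :: R)
        (E ∪ {e | ∃ z ∈ p :: (Q ++ [q]), e = s(v, z)})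

/-- `x` lies strictly between `a` and `b`. -/
def StrictBetween (a b x : ℝ) : Prop := (a < x ∧ x < b) ∨ (b < x ∧ x < a)

/-- A plane drawing by graphs of functions `φ e` over the spans of the edges, lying below the
envelope `h`, which passes through the vertices of the outer path. -/
structure Sketch {V : Type} (W : Finset V) (P : List V) (E : Set (Sym2 V)) (X Y : V → ℝ)
    (φ : Sym2 V → ℝ → ℝ) (h : ℝ → ℝ) : Prop where
  x_inj : ∀ a ∈ W, ∀ b ∈ W, X a = X b → a = b
  path_mem : ∀ p ∈ P, p ∈ W
  sorted : P.Pairwise fun a b => X a < X b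
  env_cont : Continuous h
  vert_le : ∀ w ∈ W, Y w ≤ h (X w)
  vert_eq : ∀ p ∈ P, Y p = h (X p)
  edge_mem : ∀ a b, s(a, b) ∈ E → a ∈ W ∧ a ≠ b
  edge_cont : ∀ e ∈ E, Continuous (φ e)
  edge_end : ∀ a b, s(a, b) ∈ E → φ s(a, b) (X a) = Y a
  edge_le : ∀ a b, s(a, b) ∈ E → ∀ x, StrictBetween (X a) (X b) x → φ s(a, b) x ≤ h x
  edge_vert : ∀ a b, s(a, b) ∈ E → ∀ w ∈ W, StrictBetween (X a) (X b) (X w) →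
    φ s(a, b) (X w) ≠ Y w
  edge_edge : ∀ a b, s(a, b) ∈ E → ∀ c d, s(c, d) ∈ E → s(a, b) ≠ s(c, d) → ∀ x,
    StrictBetween (X a) (X b) x → StrictBetween (X c) (X d) x → φ s(a, b) x ≠ φ s(c, d) x

section Sketches

variable {V : Type}

lemma StrictBetween.symm {a b x : ℝ} (h : StrictBetween a b x) : StrictBetween b a x := Or.symm h

lemma strictBetween_lineMap {a b t : ℝ} (hab : a ≠ b) (ht : t ∈ Set.Ioo (0 : ℝ) 1) :
    StrictBetween a b (a + t * (b - a)) := by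
  obtain ⟨h0, h1⟩ := ht
  rcases lt_or_gt_of_ne hab with h | h
  · exact Or.inl ⟨by nlinarith, by nlinarith⟩
  · exact Or.inr ⟨by nlinarith, by nlinarith⟩

lemma Sketch.isPlanar {W : Finset V} {P : List V} {E : Set (Sym2 V)} {X Y : V → ℝ}
    {φ : Sym2 V → ℝ → ℝ} {h : ℝ → ℝ} (hs : Sketch W P E X Y φ h) {V' : Type} (H : SimpleGraph V')
    (ψ : V' → V) (hψ : Function.Injective ψ) (hW : ∀ a, ψ a ∈ W)
    (hE : ∀ a b, H.Adj a b → s(ψ a, ψ b) ∈ E) : IsPlanar H := by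
  let x : Sym2 V' → ℝ → ℝ := fun e t =>
    X (ψ e.out.1) + t * (X (ψ e.out.2) - X (ψ e.out.1))
  have hout : ∀ e : Sym2 V', s(e.out.1, e.out.2) = e := fun e => Quot.out_eq e
  have hadj : ∀ e ∈ H.edgeSet, H.Adj e.out.1 e.out.2 := fun e he => by
    rw [← SimpleGraph.mem_edgeSet, hout]; exact he
  have hne : ∀ e ∈ H.edgeSet, X (ψ e.out.1) ≠ X (ψ e.out.2) := fun e he h' =>
    (hadj e he).ne (hψ (hs.x_inj _ (hW _) _ (hW _) h'))
  have hmap : ∀ e : Sym2 V', s(ψ e.out.1, ψ e.out.2) = e.map ψ := fun e => by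
    conv_rhs => rw [← hout e]
    rfl
  have hmem : ∀ e ∈ H.edgeSet, s(ψ e.out.1, ψ e.out.2) ∈ E := fun e he => hE _ _ (hadj e he)
  have hbtw : ∀ e ∈ H.edgeSet, ∀ t ∈ Set.Ioo (0 : ℝ) 1,
      StrictBetween (X (ψ e.out.1)) (X (ψ e.out.2)) (x e t) := fun e he t ht =>
    strictBetween_lineMap (hne e he) ht
  refine ⟨⟨fun a => (X (ψ a), Y (ψ a)), fun e t => (x e t, φ (s(ψ e.out.1, ψ e.out.2)) (x e t)),
    ?_, ?_, ?_, ?_, ?_, ?_⟩⟩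
  · intro a b hab
    exact hψ (hs.x_inj _ (hW _) _ (hW _) (Prod.mk.inj hab).1)
  · intro e he
    have := hs.edge_cont _ (hmem e he)
    refine Continuous.continuousOn ?_
    fun_prop
  · intro e he t _ t' _ htt
    have h1 : X (ψ e.out.2) - X (ψ e.out.1) ≠ 0 := sub_ne_zero.2 (hne e he).symm
    have h2 := (Prod.mk.inj htt).1
    simp only [x] at h2
    exact mul_right_cancel₀ h1 (by linarith)
  · intro a b hab
    have he := hmem s(a, b) hab
    have h0 : x s(a, b) 0 = X (ψ (s(a, b) : Sym2 V').out.1) := by simp [x]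
    have h1 : x s(a, b) 1 = X (ψ (s(a, b) : Sym2 V').out.2) := by simp [x]
    have h2 := hs.edge_end _ _ he
    have h3 := hs.edge_end _ _ (by rw [Sym2.eq_swap]; exact he)
    rw [Sym2.eq_swap] at h3
    simp only [h0, h1, h2, h3]
    have := hout s(a, b)
    rw [Sym2.eq_iff] at this
    rcases this with ⟨h4, h5⟩ | ⟨h4, h5⟩
    · rw [h4, h5]
    · rw [h4, h5, Set.pair_comm]
  · rintro e he w ⟨t, ht, htw⟩
    have h1 := (Prod.mk.inj htw).1
    have h2 := (Prod.mk.inj htw).2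
    rw [h1] at h2
    exact hs.edge_vert _ _ (hmem e he) _ (hW w) (h1 ▸ hbtw e he t ht) h2
  · intro e he f hf hef
    refine Set.eq_empty_of_forall_notMem ?_
    rintro _ ⟨⟨t, ht, rfl⟩, t', ht', htt⟩
    have h1 := (Prod.mk.inj htt).1
    have h2 := (Prod.mk.inj htt).2
    rw [h1] at h2
    refine hs.edge_edge _ _ (hmem e he) _ _ (hmem f hf) ?_ _ (hbtw e he t ht)
      (h1 ▸ hbtw f hf t' ht') h2.symm
    rw [hmap, hmap]
    exact fun h' => hef (Sym2.map.injective hψ h')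

variable [DecidableEq V]

lemma sketch_base {v1 v2 : V} (h : v1 ≠ v2) :
    ∃ X Y φ k, Sketch {v1, v2} [v1, v2] {s(v1, v2)} X Y φ k := by
  have h12 : ∀ a b, s(a, b) = s(v1, v2) → (a = v1 ∧ b = v2) ∨ (a = v2 ∧ b = v1) := fun a b hab => by
    simpa using hab
  refine ⟨fun a => if a = v1 then 0 else 1, fun _ => 0, fun _ _ => 0, fun _ => 0, ?_, ?_, ?_,
    continuous_const, by simp, by simp, ?_, fun _ _ => continuous_const, by simp, by simp, ?_, ?_⟩
  · intro a ha b hb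
    simp only [Finset.mem_insert, Finset.mem_singleton] at ha hb
    rcases ha with rfl | rfl <;> rcases hb with rfl | rfl <;> simp [h, h.symm]
  · simp
  · simp [h.symm]
  · intro a b hab
    rcases h12 a b hab with ⟨rfl, rfl⟩ | ⟨rfl, rfl⟩
    · simp [h]
    · simp [h.symm]
  · intro a b hab w hw hb
    simp only [Finset.mem_insert, Finset.mem_singleton] at hw
    exfalso
    rcases h12 a b hab with ⟨rfl, rfl⟩ | ⟨rfl, rfl⟩ <;> rcases hw with rfl | rfl <;>
      simp [StrictBetween, h, h.symm] at hb <;> linarith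
  · intro a b hab c d hcd hne
    exact absurd (hab.trans hcd.symm) hne

end Sketches

section SketchStep

variable {V : Type} [DecidableEq V]

/-- The affine parameter that is `0` at `a` and `1` at `c`. -/
noncomputable def rampTo (c a x : ℝ) : ℝ := (x - a) / (c - a)

lemma rampTo_continuous (c a : ℝ) : Continuous (rampTo c a) := by
  unfold rampTo; fun_prop

lemma rampTo_self (c a : ℝ) : rampTo c a a = 0 := by simp [rampTo]

lemma rampTo_top {c a : ℝ} (h : c ≠ a) : rampTo c a c = 1 := div_self (sub_ne_zero.2 h)

lemma rampTo_pos {c a x : ℝ} (h : StrictBetween c a x) : 0 < rampTo c a x := by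
  unfold rampTo
  rcases h with ⟨h1, h2⟩ | ⟨h1, h2⟩
  · exact div_pos_of_neg_of_neg (by linarith) (by linarith)
  · exact div_pos (by linarith) (by linarith)

lemma rampTo_ne {c a b x : ℝ} (hca : c ≠ a) (hcb : c ≠ b) (hab : a ≠ b) (hx : x ≠ c) :
    rampTo c a x ≠ rampTo c b x := by
  unfold rampTo
  intro h
  rw [div_eq_div_iff (sub_ne_zero.2 hca) (sub_ne_zero.2 hcb)] at h
  have : (x - c) * (a - b) = 0 := by linarith
  rcases mul_eq_zero.1 this with h | h
  · exact hx (by linarith)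
  · exact hab (by linarith)

lemma rampTo_le_of_le {c p q a x : ℝ} (hpc : p < c) (hcq : c < q) (hpa : p ≤ a) (haq : a ≤ q)
    (h : StrictBetween c a x) : rampTo c a x ≤ min (rampTo c p x) (rampTo c q x) := by
  unfold rampTo
  rcases h with ⟨h1, h2⟩ | ⟨h1, h2⟩
  · have e1 : (x - a) / (c - a) = (a - x) / (a - c) := by
      rw [← neg_div_neg_eq]; ring_nf
    have e2 : (x - q) / (c - q) = (q - x) / (q - c) := by
      rw [← neg_div_neg_eq]; ring_nf
    rw [e1, e2]
    refine le_min ?_ ?_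
    · rw [div_le_div_iff₀ (by linarith) (by linarith)]
      nlinarith
    · rw [div_le_div_iff₀ (by linarith) (by linarith)]
      nlinarith
  · have e2 : (x - q) / (c - q) = (q - x) / (q - c) := by
      rw [← neg_div_neg_eq]; ring_nf
    rw [e2]
    refine le_min ?_ ?_
    · rw [div_le_div_iff₀ (by linarith) (by linarith)]
      nlinarith
    · rw [div_le_div_iff₀ (by linarith) (by linarith)]
      nlinarith

lemma rampTo_nonpos_left {c a x : ℝ} (hac : a < c) (h : x ≤ a) : rampTo c a x ≤ 0 :=
  div_nonpos_of_nonpos_of_nonneg (by linarith) (by linarith)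

lemma rampTo_nonpos_right {c a x : ℝ} (hac : c < a) (h : a ≤ x) : rampTo c a x ≤ 0 :=
  div_nonpos_of_nonneg_of_nonpos (by linarith) (by linarith)

lemma Sketch.step {W : Finset V} {L Q R : List V} {p q v : V} {E : Set (Sym2 V)} {X Y : V → ℝ}
    {φ : Sym2 V → ℝ → ℝ} {h : ℝ → ℝ} (hs : Sketch W (L ++ p :: (Q ++ q :: R)) E X Y φ h)
    (hv : v ∉ W) : ∃ X' Y' φ' h', Sketch (insert v W) (L ++ p :: v :: q :: R)
      (E ∪ {e | ∃ z ∈ p :: (Q ++ [q]), e = s(v, z)}) X' Y' φ' h' := by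
  obtain ⟨hso1, hso2, hso3⟩ := List.pairwise_append.1 hs.sorted
  obtain ⟨hso4, hso5⟩ := List.pairwise_cons.1 hso2
  obtain ⟨hso6, hso7, hso8⟩ := List.pairwise_append.1 hso5
  obtain ⟨hso9, hso10⟩ := List.pairwise_cons.1 hso7
  have hpq : X p < X q := hso4 q (by simp)
  obtain ⟨c, ⟨hpc, hcq⟩, hcW⟩ : ∃ c ∈ Set.Ioo (X p) (X q), c ∉ X '' (W : Set V) :=
    (Set.Ioo_infinite hpq).exists_notMem_finite (W.finite_toSet.image X)
  replace hcW : ∀ w ∈ W, c ≠ X w := fun w hw h' => hcW ⟨w, hw, h'.symm⟩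
  have hZ : ∀ z ∈ p :: (Q ++ [q]), z ∈ W ∧ X p ≤ X z ∧ X z ≤ X q := by
    intro z hz
    refine ⟨hs.path_mem z (by simp at hz ⊢; tauto), ?_⟩
    simp only [List.mem_cons, List.mem_append, List.not_mem_nil, or_false] at hz
    rcases hz with rfl | hz | rfl
    · exact ⟨le_rfl, hpq.le⟩
    · exact ⟨(hso4 z (by simp [hz])).le, (hso8 z hz q (by simp)).le⟩
    · exact ⟨hpq.le, le_rfl⟩
  have hvw : ∀ w ∈ W, w ≠ v := fun w hw h' => hv (h' ▸ hw)
  set X' : V → ℝ := Function.update X v c with hX'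
  set Y' : V → ℝ := Function.update Y v (h c + 1) with hY'
  have hXv : X' v = c := by simp [hX']
  have hXw : ∀ w ∈ W, X' w = X w := fun w hw => by simp [hX', hvw w hw]
  have hYv : Y' v = h c + 1 := by simp [hY']
  have hYw : ∀ w ∈ W, Y' w = Y w := fun w hw => by simp [hY', hvw w hw]
  classical
  let φ' : Sym2 V → ℝ → ℝ := fun e x =>
    if he : ∃ z, e = s(v, z) then h x + rampTo c (X he.choose) x else φ e x
  have hφv : ∀ z, φ' s(v, z) = fun x => h x + rampTo c (X z) x := fun z => by
    have he : ∃ z', s(v, z) = s(v, z') := ⟨z, rfl⟩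
    have : he.choose = z := (Sym2.congr_right.1 he.choose_spec).symm
    funext x
    simp only [φ']
    rw [dif_pos he, this]
  have hφw : ∀ a b, s(a, b) ∈ E → φ' s(a, b) = φ s(a, b) := fun a b hab => by
    have h1 := (hs.edge_mem a b hab).1
    have h2 := (hs.edge_mem b a (Sym2.eq_swap ▸ hab)).1
    funext x
    refine dif_neg ?_
    rintro ⟨z, hz⟩
    rcases Sym2.eq_iff.1 hz with ⟨rfl, -⟩ | ⟨-, rfl⟩ <;> contradiction
  let h' : ℝ → ℝ := fun x => h x + max 0 (min (rampTo c (X p) x) (rampTo c (X q) x))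
  have hh' : ∀ x, h x ≤ h' x := fun x => le_add_of_nonneg_right (le_max_left _ _)
  have hcl : ∀ a b, s(a, b) ∈ E ∪ {e | ∃ z ∈ p :: (Q ++ [q]), e = s(v, z)} →
      (s(a, b) ∈ E ∧ X' a = X a ∧ X' b = X b ∧ Y' a = Y a ∧ a ∈ W ∧ a ≠ b) ∨
      ∃ z ∈ p :: (Q ++ [q]), s(a, b) = s(v, z) ∧
        (∀ x, StrictBetween (X' a) (X' b) x ↔ StrictBetween c (X z) x) ∧
        ((a = v ∧ b = z) ∨ a = z ∧ b = v) := by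
    rintro a b (hab | ⟨z, hz, hab⟩)
    · have h1 := (hs.edge_mem a b hab)
      have h2 := (hs.edge_mem b a (Sym2.eq_swap ▸ hab)).1
      exact Or.inl ⟨hab, hXw a h1.1, hXw b h2, hYw a h1.1, h1⟩
    · refine Or.inr ⟨z, hz, hab, fun x => ?_, Sym2.eq_iff.1 hab⟩
      rcases Sym2.eq_iff.1 hab with ⟨rfl, rfl⟩ | ⟨rfl, rfl⟩
      · rw [hXv, hXw _ (hZ _ hz).1]
      · rw [hXv, hXw _ (hZ _ hz).1]
        exact ⟨StrictBetween.symm, StrictBetween.symm⟩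
  have hLp : ∀ l ∈ L, X l < X p := fun l hl => hso3 l hl p (by simp)
  have hLW : ∀ l ∈ L, l ∈ W := fun l hl => hs.path_mem l (by simp [hl])
  have hRW : ∀ l ∈ R, l ∈ W := fun l hl => hs.path_mem l (by simp [hl])
  have hpW := (hZ p (by simp)).1
  have hqW := (hZ q (by simp)).1
  refine ⟨X', Y', φ', h', ?_, ?_, ?_, ?_, ?_, ?_, ?_, ?_, ?_, ?_, ?_, ?_⟩
  · intro a ha b hb hab
    rcases Finset.mem_insert.1 ha with h1 | h1 <;> rcases Finset.mem_insert.1 hb with h2 | h2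
    · rw [h1, h2]
    · rw [h1, hXv, hXw b h2] at hab; exact absurd hab (hcW b h2)
    · rw [h2, hXv, hXw a h1] at hab; exact absurd hab.symm (hcW a h1)
    · rw [hXw a h1, hXw b h2] at hab; exact hs.x_inj a h1 b h2 hab
  · intro z hz
    simp only [List.mem_append, List.mem_cons] at hz
    rcases hz with hz | rfl | rfl | rfl | hz
    · exact Finset.mem_insert_of_mem (hLW z hz)
    · exact Finset.mem_insert_of_mem hpW
    · exact Finset.mem_insert_self _ _
    · exact Finset.mem_insert_of_mem hqW
    · exact Finset.mem_insert_of_mem (hRW z hz)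
  · have hRq : ∀ r ∈ R, X q < X r := fun r hr => hso9 r hr
    rw [List.pairwise_append]
    refine ⟨hso1.imp_of_mem fun ha hb hab => ?_, ?_, ?_⟩
    · rwa [hXw _ (hLW _ ha), hXw _ (hLW _ hb)]
    · simp only [List.pairwise_cons, List.mem_cons]
      refine ⟨?_, ?_, ?_, hso10.imp_of_mem fun ha hb hab => ?_⟩
      · rintro a (rfl | rfl | ha)
        · rwa [hXv, hXw p hpW]
        · rwa [hXw p hpW, hXw _ hqW]
        · rw [hXw p hpW, hXw _ (hRW _ ha)]; exact hpq.trans (hRq _ ha)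
      · rintro a (rfl | ha)
        · rwa [hXv, hXw _ hqW]
        · rw [hXv, hXw _ (hRW _ ha)]; exact hcq.trans (hRq _ ha)
      · intro a ha
        rw [hXw _ hqW, hXw _ (hRW _ ha)]; exact hRq _ ha
      · rwa [hXw _ (hRW _ ha), hXw _ (hRW _ hb)]
    · intro l hl b hb
      rw [hXw _ (hLW _ hl)]
      simp only [List.mem_cons] at hb
      rcases hb with rfl | rfl | rfl | hb
      · rw [hXw _ hpW]; exact hLp l hl
      · rw [hXv]; exact (hLp l hl).trans hpc
      · rw [hXw _ hqW]; exact (hLp l hl).trans hpq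
      · rw [hXw _ (hRW _ hb)]; exact (hLp l hl).trans (hpq.trans (hRq _ hb))
  · have := hs.env_cont
    have := rampTo_continuous c (X p)
    have := rampTo_continuous c (X q)
    fun_prop
  · intro w hw
    rcases Finset.mem_insert.1 hw with rfl | hw
    · rw [hXv, hYv]
      simp only [h']
      rw [rampTo_top hpc.ne', rampTo_top hcq.ne]
      simp
    · rw [hXw w hw, hYw w hw]
      exact (hs.vert_le w hw).trans (hh' _)
  · intro z hz
    have key : ∀ z ∈ W, z ∈ L ++ p :: (Q ++ q :: R) →
        (rampTo c (X p) (X z) ≤ 0 ∨ rampTo c (X q) (X z) ≤ 0) → Y' z = h' (X' z) := by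
      intro z hz hz' hle
      rw [hXw z hz, hYw z hz, hs.vert_eq z hz']
      simp only [h']
      rw [max_eq_left (min_le_iff.2 hle), add_zero]
    simp only [List.mem_append, List.mem_cons] at hz
    rcases hz with hz | rfl | rfl | rfl | hz
    · exact key z (hLW z hz) (by simp [hz]) (Or.inl (rampTo_nonpos_left hpc (hLp z hz).le))
    · exact key z hpW (by simp) (Or.inl (rampTo_self _ _).le)
    · rw [hXv, hYv]
      simp only [h']
      rw [rampTo_top hpc.ne', rampTo_top hcq.ne]
      simp
    · exact key z hqW (by simp) (Or.inr (rampTo_self _ _).le)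
    · exact key z (hRW z hz) (by simp [hz]) (Or.inr (rampTo_nonpos_right hcq (hso9 z hz).le))
  · intro a b hab
    rcases hcl a b hab with ⟨-, -, -, -, h1, h2⟩ | ⟨z, hz, -, -, ⟨rfl, rfl⟩ | ⟨rfl, rfl⟩⟩
    · exact ⟨Finset.mem_insert_of_mem h1, h2⟩
    · exact ⟨Finset.mem_insert_self _ _, (hvw _ (hZ _ hz).1).symm⟩
    · exact ⟨Finset.mem_insert_of_mem (hZ _ hz).1, (hvw _ (hZ _ hz).1)⟩
  · intro e he
    induction e using Sym2.ind with
    | _ a b =>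
      rcases hcl a b he with ⟨h1, -⟩ | ⟨z, hz, h1, -⟩
      · rw [hφw a b h1]; exact hs.edge_cont _ h1
      · rw [h1, hφv]
        exact hs.env_cont.add (rampTo_continuous _ _)
  · intro a b hab
    rcases hcl a b hab with ⟨h1, h2, -, h3, -⟩ | ⟨z, hz, h1, -, ⟨rfl, rfl⟩ | ⟨rfl, rfl⟩⟩
    · rw [hφw a b h1, h2, h3, hs.edge_end a b h1]
    · rw [hφv, hXv, hYv]
      simp only
      rw [rampTo_top (hcW _ (hZ _ hz).1)]
    · rw [h1, hφv, hXw _ (hZ _ hz).1, hYw _ (hZ _ hz).1]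
      simp only
      rw [rampTo_self, add_zero, hs.vert_eq _ (by simp at hz ⊢; tauto)]
  · intro a b hab x hx
    rcases hcl a b hab with ⟨h1, h2, h3, -⟩ | ⟨z, hz, h1, h2, -⟩
    · rw [h2, h3] at hx
      rw [hφw a b h1]
      exact (hs.edge_le a b h1 x hx).trans (hh' x)
    · rw [h2] at hx
      rw [h1, hφv]
      have := rampTo_le_of_le hpc hcq (hZ z hz).2.1 (hZ z hz).2.2 hx
      exact add_le_add_right (this.trans (le_max_right _ _)) _
  · intro a b hab w hw hx
    rcases hcl a b hab with ⟨h1, h2, h3, -⟩ | ⟨z, hz, h1, h2, -⟩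
    · rw [h2, h3] at hx
      rw [hφw a b h1]
      rcases Finset.mem_insert.1 hw with rfl | hw
      · rw [hXv] at hx ⊢
        have := hs.edge_le a b h1 _ hx
        rw [hYv]
        linarith
      · rw [hXw w hw] at hx ⊢
        rw [hYw w hw]
        exact hs.edge_vert a b h1 w hw hx
    · rw [h2] at hx
      rw [h1, hφv]
      rcases Finset.mem_insert.1 hw with rfl | hw
      · rw [hXv] at hx
        rcases hx with hx | hx <;> linarith [hx.1, hx.2]
      · rw [hXw w hw] at hx ⊢
        rw [hYw w hw]
        have h4 := rampTo_pos hx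
        have h5 := hs.vert_le w hw
        simp only
        linarith
  · have aux : ∀ a b, s(a, b) ∈ E → ∀ z x, StrictBetween (X a) (X b) x →
        StrictBetween c (X z) x → φ s(a, b) x ≠ h x + rampTo c (X z) x := by
      intro a b hab z x hx hx'
      have := hs.edge_le a b hab x hx
      have := rampTo_pos hx'
      linarith
    intro a b hab a' b' hab' hne x hx hx'
    rcases hcl a b hab with ⟨h1, h2, h3, -⟩ | ⟨z, hz, h1, h2, -⟩ <;>
      rcases hcl a' b' hab' with ⟨h1', h2', h3', -⟩ | ⟨z', hz', h1', h2', -⟩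
    · rw [h2, h3] at hx
      rw [h2', h3'] at hx'
      rw [hφw a b h1, hφw a' b' h1']
      exact hs.edge_edge a b h1 a' b' h1' hne x hx hx'
    · rw [h2, h3] at hx
      rw [h2'] at hx'
      rw [hφw a b h1, h1', hφv]
      exact aux a b h1 z' x hx hx'
    · rw [h2', h3'] at hx'
      rw [h2] at hx
      rw [hφw a' b' h1', h1, hφv]
      exact (aux a' b' h1' z x hx' hx).symm
    · rw [h2] at hx
      rw [h1, h1', hφv, hφv]
      intro h4
      refine rampTo_ne (hcW _ (hZ z hz).1) (hcW _ (hZ z' hz').1) ?_ ?_ (add_left_cancel h4)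
      · intro h5
        exact hne (by rw [h1, h1', hs.x_inj z (hZ z hz).1 z' (hZ z' hz').1 h5])
      · rintro rfl
        rcases hx with hx | hx <;> linarith [hx.1, hx.2]

lemma Built.exists_sketch {v1 v2 : V} {W : Finset V} {P : List V} {E : Set (Sym2 V)}
    (hb : Built v1 v2 W P E) : ∃ X Y φ h, Sketch W P (E ∪ {s(v1, v2)}) X Y φ h := by
  induction hb with
  | base h => simpa using sketch_base h
  | step _ hv ih =>
    obtain ⟨X, Y, φ, h, hs⟩ := ih
    obtain ⟨X', Y', φ', h', hs'⟩ := hs.step hv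
    rw [Set.union_right_comm] at hs'
    exact ⟨X', Y', φ', h', hs'⟩

/-- A graph that embeds into a canonically built graph is planar. -/
lemma Built.isPlanar {v1 v2 : V} {W : Finset V} {P : List V} {E : Set (Sym2 V)}
    (hb : Built v1 v2 W P E) {V' : Type} (H : SimpleGraph V') (ψ : V' → V)
    (hψ : Function.Injective ψ) (hW : ∀ a, ψ a ∈ W)
    (hE : ∀ a b, H.Adj a b → s(ψ a, ψ b) ∈ E ∨ s(ψ a, ψ b) = s(v1, v2)) : IsPlanar H := by
  obtain ⟨X, Y, φ, h, hs⟩ := hb.exists_sketch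
  exact hs.isPlanar H ψ hψ hW hE

end SketchStep

section Amalgam

variable {V ι : Type} [DecidableEq V]

lemma BuiltF.built {N : ι → Finset V} {v1 v2 : V} {W : Finset V} {P : List V} {E : Set (Sym2 V)}
    {us : List ι} (h : BuiltF N v1 v2 W P E us) : Built v1 v2 W P E := by
  induction h with
  | base h => exact .base h
  | step _ hv _ ih => exact .step ih hv

lemma exists_cons_concat {M : List V} {p q : V} (hp : M.head? = some p)
    (hq : M.getLast? = some q) (hlen : 2 ≤ M.length) : ∃ Q, M = p :: (Q ++ [q]) := by
  cases M with
  | nil => simp at hlen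
  | cons a M =>
    simp only [List.head?_cons, Option.some.injEq] at hp
    subst hp
    rcases List.eq_nil_or_concat M with rfl | ⟨Q, b, rfl⟩
    · simp at hlen
    · refine ⟨Q, ?_⟩
      rw [List.concat_eq_append, ← List.cons_append, List.getLast?_concat] at hq
      simp only [Option.some.injEq] at hq
      simp [hq]

namespace Built

variable {v1 v2 : V} {W : Finset V} {P : List V} {E : Set (Sym2 V)}

lemma stepOver {L M R : List V} {p q v : V} (hb : Built v1 v2 W (L ++ M ++ R) E) (hv : v ∉ W)
    (hp : M.head? = some p) (hq : M.getLast? = some q) (hlen : 2 ≤ M.length) :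
    Built v1 v2 (insert v W) (L ++ p :: v :: q :: R) (E ∪ {e | ∃ z ∈ M, e = s(v, z)}) := by
  obtain ⟨Q, rfl⟩ := exists_cons_concat hp hq hlen
  refine .step ?_ hv
  simpa using hb

lemma path_mem (hb : Built v1 v2 W P E) : ∀ p ∈ P, p ∈ W := by
  obtain ⟨X, Y, φ, h, hs⟩ := hb.exists_sketch
  exact hs.path_mem

lemma edge_mem (hb : Built v1 v2 W P E) {a b : V} (hab : s(a, b) ∈ E) : a ∈ W ∧ b ∈ W ∧ a ≠ b := by
  obtain ⟨X, Y, φ, h, hs⟩ := hb.exists_sketch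
  exact ⟨(hs.edge_mem a b (Or.inl hab)).1, (hs.edge_mem b a (Or.inl (Sym2.eq_swap ▸ hab))).1,
    (hs.edge_mem a b (Or.inl hab)).2⟩

lemma path_nodup (hb : Built v1 v2 W P E) : P.Nodup := by
  obtain ⟨X, Y, φ, h, hs⟩ := hb.exists_sketch
  exact hs.sorted.imp fun h => by rintro rfl; exact lt_irrefl _ h

lemma head_last (hb : Built v1 v2 W P E) :
    P.head? = some v1 ∧ P.getLast? = some v2 ∧ 2 ≤ P.length := by
  induction hb with
  | base h => simp
  | @step W L Q R p q v E _ _ ih =>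
    obtain ⟨h1, h2, h3⟩ := ih
    refine ⟨?_, ?_, by simp; omega⟩
    · cases L <;> simpa using h1
    · rcases List.eq_nil_or_concat R with rfl | ⟨R, b, rfl⟩
      · have e : L ++ p :: (Q ++ [q]) = (L ++ p :: Q) ++ [q] := by simp
        have e' : L ++ [p, v, q] = (L ++ [p, v]) ++ [q] := by simp
        rw [e, List.getLast?_concat] at h2
        rw [e', List.getLast?_concat, h2]
      · have e : L ++ p :: (Q ++ q :: (R ++ [b])) = (L ++ p :: (Q ++ q :: R)) ++ [b] := by simp
        have e' : L ++ p :: v :: q :: (R ++ [b]) = (L ++ p :: v :: q :: R) ++ [b] := by simp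
        rw [List.concat_eq_append, e, List.getLast?_concat] at h2
        rw [List.concat_eq_append, e', List.getLast?_concat, h2]

lemma ends_mem (hb : Built v1 v2 W P E) : v1 ∈ W ∧ v2 ∈ W := by
  obtain ⟨h1, h2, h3⟩ := hb.head_last
  obtain ⟨Q, rfl⟩ := exists_cons_concat h1 h2 h3
  exact ⟨hb.path_mem _ (by simp), hb.path_mem _ (by simp)⟩

lemma exists_last_step {c : V} (hb : Built v1 v2 W [v1, c, v2] E) :
    ∃ W' Q E', Built v1 v2 W' (v1 :: (Q ++ [v2])) E' ∧ c ∉ W' ∧ W = insert c W' ∧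
      E = E' ∪ {e | ∃ z ∈ v1 :: (Q ++ [v2]), e = s(c, z)} := by
  generalize hP : [v1, c, v2] = P at hb
  cases hb with
  | base h => simp at hP
  | @step W L Q R p q v E hb hv =>
    have hlen := congrArg List.length hP
    simp only [List.length_cons, List.length_nil, List.length_append] at hlen
    obtain rfl : L = [] := List.length_eq_zero_iff.1 (by omega)
    obtain rfl : R = [] := List.length_eq_zero_iff.1 (by omega)
    simp only [List.nil_append, List.cons.injEq, and_true] at hP
    obtain ⟨rfl, rfl, rfl⟩ := hP
    exact ⟨W, Q, E, hb, hv, rfl, rfl⟩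

/-- A construction can be replayed on top of an edge of the outer path. -/
lemma replay {L R : List V} {a d : V} {W₂ : Finset V} {P₂ : List V} {E₂ : Set (Sym2 V)}
    (hb : Built v1 v2 W (L ++ a :: d :: R) E) (hb₂ : Built a d W₂ P₂ E₂)
    (hW : ∀ x ∈ W₂, x ∈ W → x = a ∨ x = d) :
    Built v1 v2 (W ∪ W₂) (L ++ P₂ ++ R) (E ∪ E₂) := by
  induction hb₂ with
  | base _ =>
    have h1 : W ∪ {a, d} = W := by
      refine Finset.union_eq_left.2 ?_
      intro x hx
      simp only [Finset.mem_insert, Finset.mem_singleton] at hx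
      exact hb.path_mem x (by simp; tauto)
    rw [h1, Set.union_empty]
    simpa using hb
  | @step W' L' Q R' p q v E' hb' hv ih =>
    have h1 := ih fun x hx => hW x (Finset.mem_insert_of_mem hx)
    have hvW : v ∉ W ∪ W' := by
      rw [Finset.mem_union, not_or]
      refine ⟨fun h => ?_, hv⟩
      rcases hW v (Finset.mem_insert_self _ _) h with rfl | rfl
      · exact hv hb'.ends_mem.1
      · exact hv hb'.ends_mem.2
    have h2 := Built.step (L := L ++ L') (p := p) (Q := Q) (q := q) (R := R' ++ R) (v := v)
      (by simpa using h1) hvW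
    rw [Finset.union_insert, ← Set.union_assoc]
    simpa using h2

/-- Two constructions sharing an edge can be amalgamated, with an additional edge. -/
lemma amalgam (hb : Built v1 v2 W P E) {a b d : V} (hab : s(a, b) ∈ E) {W₂ : Finset V}
    {M : Set (Sym2 V)} (hW : ∀ x ∈ W, x ∈ W₂ → x = a ∨ x = b) (hd : d ∈ W₂)
    (hda : d ≠ a) (hdb : d ≠ b)
    (hM : ∀ x y z, ({x, y, z} : Finset V) = {a, b, d} →
      ∃ E₂, Built x y W₂ [x, z, y] E₂ ∧ M ⊆ E₂ ∪ {s(x, y)}) :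
    ∃ E', Built v1 v2 (W ∪ W₂) P E' ∧ E ⊆ E' ∧ M ⊆ E' ∧
      ∃ y ∈ W, y ≠ a ∧ y ≠ b ∧ s(d, y) ∈ E' := by
  induction hb with
  | base => simp at hab
  | @step W L Q R p q v E hb hv ih =>
  have hdW : d ∉ insert v W := fun h => by rcases hW d h hd with h | h <;> contradiction
  rcases hab with hab | ⟨z, hz, hab⟩
  · obtain ⟨E', h1, h2, h3, y, hy, hya, hyb, hdy⟩ :=
      ih hab fun x hx => hW x (Finset.mem_insert_of_mem hx)
    have hvW : v ∉ W ∪ W₂ := by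
      rw [Finset.mem_union, not_or]
      refine ⟨hv, fun h => ?_⟩
      obtain ⟨h4, h5, -⟩ := hb.edge_mem hab
      rcases hW v (Finset.mem_insert_self _ _) h with rfl | rfl <;> contradiction
    refine ⟨_, by rw [Finset.insert_union]; exact h1.step hvW, Set.union_subset_union_left _ h2,
      h3.trans Set.subset_union_left, y, Finset.mem_insert_of_mem hy, hya, hyb, Or.inl hdy⟩
  have hzW : z ∈ W := hb.path_mem z (by clear * - hz; simp at hz ⊢; tauto)
  have hvz : v ≠ z := fun h => hv (h ▸ hzW)
  have hset : ({a, b, d} : Finset V) = {v, z, d} := by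
    rcases Sym2.eq_iff.1 hab with ⟨rfl, rfl⟩ | ⟨rfl, rfl⟩
    · rfl
    · exact Finset.insert_comm _ _ _
  have hab' : ∀ x, x ≠ v → x ≠ z → x ≠ a ∧ x ≠ b := by
    rcases Sym2.eq_iff.1 hab with ⟨rfl, rfl⟩ | ⟨rfl, rfl⟩ <;> tauto
  have hW' : ∀ x ∈ insert v W, x ∈ W₂ → x = v ∨ x = z := by
    rcases Sym2.eq_iff.1 hab with ⟨rfl, rfl⟩ | ⟨rfl, rfl⟩
    · exact hW
    · exact fun x hx hx' => (hW x hx hx').symm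
  have hdW' : d ∉ W := fun h => hdW (Finset.mem_insert_of_mem h)
  have hdv : v ≠ d := fun h => hdW (h ▸ Finset.mem_insert_self _ _)
  have hnd := hb.path_nodup
  -- a pair of consecutive vertices of the subpath, one of which is `z`
  obtain ⟨Q₁, x, y, Q₂, hQ, hxy⟩ : ∃ Q₁ x y Q₂, p :: (Q ++ [q]) = Q₁ ++ x :: y :: Q₂ ∧
      (z = x ∨ z = y) := by
    obtain ⟨Q₁, Q₂, hQ⟩ := List.append_of_mem hz
    cases Q₂ with
    | cons y Q₂ => exact ⟨Q₁, z, y, Q₂, hQ, Or.inl rfl⟩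
    | nil =>
      rcases List.eq_nil_or_concat Q₁ with rfl | ⟨Q₁, x, rfl⟩
      · simp at hQ
      · exact ⟨Q₁, x, z, [], by simpa using hQ, Or.inr rfl⟩
  have hP : L ++ p :: (Q ++ q :: R) = L ++ (Q₁ ++ x :: y :: Q₂) ++ R := by rw [← hQ]; simp
  have hxyne : x ≠ y := by
    rintro rfl
    rw [hP] at hnd
    simp [List.nodup_append] at hnd
  have hxW : x ∈ W := hb.path_mem x (by rw [hP]; simp)
  have hyW : y ∈ W := hb.path_mem y (by rw [hP]; simp)
  have hhead : (Q₁ ++ x :: y :: Q₂).head? = some p := by rw [← hQ]; rfl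
  have hlast : (Q₁ ++ x :: y :: Q₂).getLast? = some q := by
    rw [← hQ, ← List.cons_append, List.getLast?_concat]
  have h1 : Built v1 v2 (insert d W) (L ++ Q₁ ++ x :: d :: y :: (Q₂ ++ R))
      (E ∪ {e | ∃ z ∈ [x, y], e = s(d, z)}) :=
    Built.stepOver (M := [x, y]) (by rw [hP] at hb; simpa using hb) hdW' rfl rfl le_rfl
  -- finishing with `v` on top
  have finish : ∀ (W₃ : Finset V) (E₃ : Set (Sym2 V)) (P₃ : List V),
      Built v1 v2 (insert d W ∪ W₃) (L ++ (Q₁ ++ P₃ ++ Q₂) ++ R)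
        (E ∪ {e | ∃ z ∈ [x, y], e = s(d, z)} ∪ E₃) → v ∉ W₃ → W₂ = insert v W₃ →
      P₃.head? = some x → P₃.getLast? = some y → 2 ≤ P₃.length →
      M ⊆ (E₃ ∪ {e | ∃ w ∈ P₃, e = s(v, w)}) ∪ {s(z, d)} →
      ∃ E', Built v1 v2 (insert v W ∪ W₂) (L ++ p :: v :: q :: R) E' ∧
        (E ∪ {e | ∃ z ∈ p :: (Q ++ [q]), e = s(v, z)}) ⊆ E' ∧ M ⊆ E' ∧
        ∃ y ∈ insert v W, y ≠ a ∧ y ≠ b ∧ s(d, y) ∈ E' := by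
    intro W₃ E₃ P₃ hb₃ hv₃ hW₂ hP₃ hP₃' hlen hM₃
    obtain ⟨Q₃, rfl⟩ := exists_cons_concat hP₃ hP₃' hlen
    have h5 : (Q₁ ++ x :: (Q₃ ++ [y]) ++ Q₂).head? = some p := by
      cases Q₁ <;> simpa using hhead
    have h6 : (Q₁ ++ x :: (Q₃ ++ [y]) ++ Q₂).getLast? = some q := by
      rcases List.eq_nil_or_concat Q₂ with rfl | ⟨Q₂, r, rfl⟩
      · rw [List.append_nil, ← List.cons_append, ← List.append_assoc, List.getLast?_concat]
        have e : Q₁ ++ [x, y] = (Q₁ ++ [x]) ++ [y] := by simp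
        rw [e, List.getLast?_concat] at hlast
        exact hlast
      · rw [List.concat_eq_append, ← List.append_assoc, List.getLast?_concat]
        have e : Q₁ ++ x :: y :: (Q₂ ++ [r]) = (Q₁ ++ x :: y :: Q₂) ++ [r] := by simp
        rw [List.concat_eq_append, e, List.getLast?_concat] at hlast
        exact hlast
    have hvn : v ∉ insert d W ∪ W₃ := by simp [hdv, hv, hv₃]
    have h7 := hb₃.stepOver hvn h5 h6 (by simp; omega)
    have hd₃ : d ∈ W₃ := by
      rw [hW₂, Finset.mem_insert] at hd
      exact hd.resolve_left fun h => hdv h.symm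
    have hWe : insert v (insert d W ∪ W₃) = insert v W ∪ W₂ := by
      rw [hW₂]
      ext t
      clear * - hd₃
      simp only [Finset.mem_insert, Finset.mem_union]
      constructor
      · rintro (h | (rfl | h) | h) <;> tauto
      · tauto
    rw [hWe] at h7
    have hsub : ∀ t ∈ p :: (Q ++ [q]), t ∈ Q₁ ++ x :: (Q₃ ++ [y]) ++ Q₂ := by
      rw [hQ]; intro t; clear * -; simp; tauto
    refine ⟨_, h7, ?_, ?_, ?_⟩
    · rintro e (he | ⟨t, ht, rfl⟩)
      · exact Or.inl (Or.inl (Or.inl he))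
      · exact Or.inr ⟨t, hsub t ht, rfl⟩
    · intro e he
      rcases hM₃ he with (he | ⟨t, ht, rfl⟩) | he
      · exact Or.inl (Or.inr he)
      · exact Or.inr ⟨t, by clear * - ht; simp at ht ⊢; tauto, rfl⟩
      · refine Or.inl (Or.inl (Or.inr ⟨z, by simpa using hxy, ?_⟩))
        rw [Set.mem_singleton_iff.1 he, Sym2.eq_swap]
    · rcases hxy with rfl | rfl
      · refine ⟨y, Finset.mem_insert_of_mem hyW, ?_⟩
        obtain ⟨h8, h9⟩ := hab' y (fun h => hv (h ▸ hyW)) hxyne.symm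
        exact ⟨h8, h9, Or.inl (Or.inl (Or.inr ⟨y, by simp, rfl⟩))⟩
      · refine ⟨x, Finset.mem_insert_of_mem hxW, ?_⟩
        obtain ⟨h8, h9⟩ := hab' x (fun h => hv (h ▸ hxW)) hxyne
        exact ⟨h8, h9, Or.inl (Or.inl (Or.inr ⟨x, by simp, rfl⟩))⟩
  have hreplay : ∀ W₃ : Finset V, v ∉ W₃ → W₂ = insert v W₃ →
      ∀ t ∈ W₃, t ∈ insert d W → t = z ∨ t = d := by
    intro W₃ hv₃ hW₂ t ht ht'
    rcases Finset.mem_insert.1 ht' with h | h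
    · exact Or.inr h
    · rcases hW' t (Finset.mem_insert_of_mem h) (hW₂ ▸ Finset.mem_insert_of_mem ht) with h8 | h8
      · exact absurd (h8 ▸ ht) hv₃
      · exact Or.inl h8
  rcases hxy with rfl | rfl
  · obtain ⟨E₂, h2, h3⟩ := hM z d v (by rw [hset]; ext t; clear * -; simp; tauto)
    obtain ⟨W₃, Q₃, E₃, hb₃, hv₃, rfl, rfl⟩ := h2.exists_last_step
    have h4 := Built.replay h1 hb₃ (hreplay W₃ hv₃ rfl)
    refine finish W₃ E₃ (z :: (Q₃ ++ [d, y])) (by simpa using h4) hv₃ rfl rfl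
      (by rw [show z :: (Q₃ ++ [d, y]) = (z :: (Q₃ ++ [d])) ++ [y] by simp, List.getLast?_concat])
      (by simp) (h3.trans (Set.union_subset_union_left _ (Set.union_subset_union_right _ ?_)))
    rintro e ⟨t, ht, rfl⟩
    exact ⟨t, by clear * - ht; simp at ht ⊢; tauto, rfl⟩
  · obtain ⟨E₂, h2, h3⟩ := hM d z v (by rw [hset]; ext t; clear * -; simp; tauto)
    obtain ⟨W₃, Q₃, E₃, hb₃, hv₃, rfl, rfl⟩ := h2.exists_last_step
    have h4 := Built.replay (L := L ++ Q₁ ++ [x]) (by simpa using h1) hb₃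
      fun t ht ht' => (hreplay W₃ hv₃ rfl t ht ht').symm
    refine finish W₃ E₃ (x :: d :: (Q₃ ++ [z])) (by simpa using h4) hv₃ rfl rfl
      (by rw [show x :: d :: (Q₃ ++ [z]) = (x :: d :: Q₃) ++ [z] by simp, List.getLast?_concat])
      (by simp) (h3.trans (Set.union_subset_union (Set.union_subset_union_right _ ?_) ?_))
    · rintro e ⟨t, ht, rfl⟩
      exact ⟨t, by clear * - ht; simp at ht ⊢; tauto, rfl⟩
    · rw [Sym2.eq_swap]

/-- Amalgamation along the base edge. -/
lemma amalgam_base (hb : Built v1 v2 W P E) {d : V} {W₂ : Finset V} {E₂ : Set (Sym2 V)}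
    (hW : ∀ x ∈ W, x ∈ W₂ → x = v1 ∨ x = v2) (hb₂ : Built v1 v2 W₂ [v1, d, v2] E₂) :
    (W = {v1, v2} ∧ P = [v1, v2] ∧ E = ∅) ∨
    ∃ E', Built v1 v2 (W ∪ W₂) P E' ∧ E ⊆ E' ∧ E₂ ⊆ E' ∧
      ∃ y ∈ W, y ≠ v1 ∧ y ≠ v2 ∧ s(d, y) ∈ E' := by
  induction hb with
  | base => exact Or.inl ⟨rfl, rfl, rfl⟩
  | @step W L Q R p q v E hb hv ih =>
  right
  obtain ⟨he1, he2⟩ := hb.ends_mem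
  have hvW₂ : v ∉ W₂ := fun h => by
    rcases hW v (Finset.mem_insert_self _ _) h with rfl | rfl <;> contradiction
  rcases ih fun x hx => hW x (Finset.mem_insert_of_mem hx) with
    ⟨rfl, hP, rfl⟩ | ⟨E', h1, h2, h3, y, hy, hya, hyb, hdy⟩
  · have hlen := congrArg List.length hP
    simp only [List.length_cons, List.length_nil, List.length_append] at hlen
    obtain rfl : L = [] := List.length_eq_zero_iff.1 (by omega)
    obtain rfl : R = [] := List.length_eq_zero_iff.1 (by omega)
    obtain rfl : Q = [] := List.length_eq_zero_iff.1 (by omega)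
    simp only [List.nil_append, List.cons.injEq, and_true] at hP
    obtain ⟨rfl, rfl⟩ := hP
    have h4 := Built.stepOver (L := []) (M := [p, d, q]) (R := []) (by simpa using hb₂) hvW₂ rfl rfl
      (by simp)
    have h5 : insert v {p, q} ∪ W₂ = insert v W₂ := by
      rw [Finset.insert_union, Finset.union_eq_right.2]
      intro t ht
      simp only [Finset.mem_insert, Finset.mem_singleton] at ht
      rcases ht with rfl | rfl
      · exact hb₂.ends_mem.1
      · exact hb₂.ends_mem.2
    refine ⟨_, by rw [h5]; exact h4, ?_, Set.subset_union_left, v, Finset.mem_insert_self _ _,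
      fun h => hv (h ▸ he1), fun h => hv (h ▸ he2),
      Or.inr (show ∃ z ∈ [p, d, q], s(d, v) = s(v, z) from ⟨d, by simp, Sym2.eq_swap⟩)⟩
    rintro e (he | ⟨t, ht, rfl⟩)
    · exact he.elim
    · exact Or.inr ⟨t, by clear * - ht; simp at ht ⊢; tauto, rfl⟩
  · refine ⟨_, by rw [Finset.insert_union]; exact h1.step (by simp [hv, hvW₂]),
      Set.union_subset_union_left _ h2, h3.trans Set.subset_union_left, y,
      Finset.mem_insert_of_mem hy, hya, hyb, Or.inl hdy⟩

end Built

end Amalgam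

section TwoCuts

variable {V ι : Type} [DecidableEq V] {T : SimpleGraph V} {S : Finset V} {F : Finset ι}
  {N : ι → Finset V}

lemma IsCanonical.exists_built {v1 v2 c : V} {o : ι} {P : List V} {E : Set (Sym2 V)}
    {us gs : List ι} (hcan : IsCanonical T S F N v1 v2 c o P E us gs) (hc : c ∈ S) :
    ∃ E', Built v1 v2 S [v1, c, v2] E' ∧
      ∀ a ∈ S, ∀ b ∈ S, T.Adj a b → s(a, b) ∈ E' ∨ s(a, b) = s(v1, v2) := by
  have hbu := hcan.built.built
  obtain ⟨h1, h2, h3⟩ := hbu.head_last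
  have h4 := Built.stepOver (L := []) (R := []) (by simpa using hbu) (Finset.notMem_erase c S)
    h1 h2 h3
  rw [Finset.insert_erase hc] at h4
  refine ⟨_, h4, fun a ha b hb hab => ?_⟩
  by_cases hac : a = c
  · subst hac
    exact Or.inl (Or.inr ⟨b, hcan.adj_last b hb hab, rfl⟩)
  by_cases hbc : b = c
  · subst hbc
    exact Or.inl (Or.inr ⟨a, hcan.adj_last a ha hab.symm, Sym2.eq_swap⟩)
  rcases hcan.adj_edge a (by simp [hac, ha]) b (by simp [hbc, hb]) hab with h | h
  · exact Or.inl (Or.inl h)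
  · exact Or.inr h

/-- A separation of a full system by two vertices splits it into two full systems, and each of
them has a face on the two separating vertices. -/
lemma IsFullSystem.split (h : IsFullSystem T S F N) {a b : V} (ha : a ∈ S) (hb : b ∈ S)
    (hab : a ≠ b) {A B : Finset V} (hA : A.Nonempty) (hB : B.Nonempty) (hAB : Disjoint A B)
    (hun : A ∪ B = S \ {a, b}) (hno : ∀ x ∈ A, ∀ y ∈ B, ¬ T.Adj x y) :
    IsFullSystem T (A ∪ {a, b}) (facesIn F N (A ∪ {a, b})) N ∧
    IsFullSystem T (B ∪ {a, b}) (facesIn F N (B ∪ {a, b})) N ∧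
    ∃ f ∈ facesIn F N (B ∪ {a, b}), ∃ d ∈ B, N f = {a, b, d} := by
  have hmem : ∀ z, z ∈ A ∨ z ∈ B ↔ z ∈ S ∧ z ≠ a ∧ z ≠ b := fun z => by
    simpa using congrArg (z ∈ ·) hun
  have hAS : A ∪ {a, b} ⊆ S := by
    intro z hz
    simp only [Finset.mem_union, Finset.mem_insert, Finset.mem_singleton] at hz
    rcases hz with hz | rfl | rfl
    · exact ((hmem z).1 (Or.inl hz)).1
    · exact ha
    · exact hb
  have hBS : B ∪ {a, b} ⊆ S := by
    intro z hz
    simp only [Finset.mem_union, Finset.mem_insert, Finset.mem_singleton] at hz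
    rcases hz with hz | rfl | rfl
    · exact ((hmem z).1 (Or.inr hz)).1
    · exact ha
    · exact hb
  have hcA : (A ∪ {a, b}).card = A.card + 2 := by
    rw [Finset.card_union_of_disjoint, Finset.card_pair hab]
    simp only [Finset.disjoint_insert_right, Finset.disjoint_singleton_right]
    exact ⟨fun h' => ((hmem a).1 (Or.inl h')).2.1 rfl, fun h' => ((hmem b).1 (Or.inl h')).2.2 rfl⟩
  have hcB : (B ∪ {a, b}).card = B.card + 2 := by
    rw [Finset.card_union_of_disjoint, Finset.card_pair hab]
    simp only [Finset.disjoint_insert_right, Finset.disjoint_singleton_right]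
    exact ⟨fun h' => ((hmem a).1 (Or.inr h')).2.1 rfl, fun h' => ((hmem b).1 (Or.inr h')).2.2 rfl⟩
  have hcS : A.card + B.card + 2 = S.card := by
    rw [← Finset.card_union_of_disjoint hAB, hun, Finset.card_sdiff_of_subset (by
      intro z; simp; rintro (rfl | rfl) <;> assumption), Finset.card_pair hab]
    have := h.three_le
    omega
  have hA' := hA.card_pos
  have hB' := hB.card_pos
  have h1 := h.facesIn_card_le hAS
  have h2 := h.facesIn_card_le hBS
  have h3 := h.card_le_facesIn (A := A) (B := B) (Z := {a, b})
    (by rw [hun, Finset.sdiff_union_self_eq_union]; exact Finset.subset_union_left) hAB hno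
  have h4 := h.card_eq
  refine ⟨⟨h.facesIn hAS, by omega, by omega⟩, ⟨h.facesIn hBS, by omega, by omega⟩, ?_⟩
  have hconn : ConnIn T (A ∪ {a, b}) := connIn_side hab ha hb (h.noOneCut ha) (h.noOneCut hb) hA
    hAB.symm (by rw [Finset.union_comm]; exact hun) fun x hx y hy hxy => hno y hy x hx hxy.symm
  have hSC : (S \ (A ∪ {a, b})).card = B.card := by
    rw [Finset.card_sdiff_of_subset hAS]; omega
  by_contra hcon
  push Not at hcon
  have h5 := h.contract_card_le (F' := facesIn F N (B ∪ {a, b})) hAS hconn (x := a) (by simp) (by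
    intro f hf
    have hf' := hf
    simp only [facesIn, Finset.mem_filter] at hf
    refine ⟨hf.1, fun x hx y hy hxC hyC => ?_⟩
    by_contra hxy
    have hcl : ∀ x ∈ N f, x ∈ A ∪ {a, b} → x = a ∨ x = b := by
      intro x hx hxC
      have h6 := hf.2 hx
      have h7 : x ∈ A → x ∉ B := fun h1 h2 => Finset.disjoint_left.1 hAB h1 h2
      simp only [Finset.mem_union, Finset.mem_insert, Finset.mem_singleton] at hxC h6
      tauto
    have hx' := hcl x hx hxC
    have hy' := hcl y hy hyC
    have haN : a ∈ N f := by rcases hx' with rfl | rfl <;> rcases hy' with rfl | rfl <;> tauto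
    have hbN : b ∈ N f := by rcases hx' with rfl | rfl <;> rcases hy' with rfl | rfl <;> tauto
    obtain ⟨w, -, hwa, hwb, hN⟩ := facesOn_third h.toIsFaceSystem hab
      (by simp [facesOn, hf.1, haN, hbN] : f ∈ facesOn F N a b)
    refine hcon f hf' w ?_ hN
    have h8 := hf.2 (show w ∈ N f by simp [hN])
    simp only [Finset.mem_union, Finset.mem_insert, Finset.mem_singleton] at h8
    tauto)
  omega

/-- A full system can be built canonically from any of its faces; if it has a separating pair, the
construction can be chosen to contain an additional edge. -/
lemma IsFullSystem.exists_built (h : IsFullSystem T S F N) {o : ι} (ho : o ∈ F) {v1 v2 c : V}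
    (hN : N o = {v1, v2, c}) :
    ∃ E, Built v1 v2 S [v1, c, v2] E ∧
      (∀ a ∈ S, ∀ b ∈ S, T.Adj a b → s(a, b) ∈ E ∨ s(a, b) = s(v1, v2)) ∧
      (¬ NoTwoCut T S → ∃ a b, s(a, b) ∈ E ∧ ¬ T.Adj a b) := by
  induction hn : S.card using Nat.strong_induction_on generalizing S F o v1 v2 c with
  | _ n ih =>
  subst hn
  have hcS : c ∈ S := h.sub o ho (by simp [hN])
  by_cases h2 : NoTwoCut T S
  · obtain ⟨P, E, us, gs, hcan⟩ := h.exists_canonical h2 ho hN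
    obtain ⟨E', h3, h4⟩ := hcan.exists_built hcS
    exact ⟨E', h3, h4, fun h5 => absurd h2 h5⟩
  have h2' := h2
  unfold NoTwoCut at h2
  push Not at h2
  obtain ⟨a, ha, b, hb, hab, hnc⟩ := h2
  have hne : (S \ {a, b}).Nonempty := by
    rw [Finset.sdiff_nonempty]
    intro hsub
    have := Finset.card_le_card hsub
    rw [Finset.card_pair hab] at this
    have := h.three_le
    omega
  obtain ⟨A, B, hA, hB, hAB, hun, hno, hoA⟩ : ∃ A B : Finset V, A.Nonempty ∧ B.Nonempty ∧
      Disjoint A B ∧ A ∪ B = S \ {a, b} ∧ (∀ a ∈ A, ∀ b ∈ B, ¬ T.Adj a b) ∧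
      N o ⊆ A ∪ {a, b} := by
    obtain ⟨A, B, hA, hB, hAB, hun, hno⟩ := exists_split hne hnc
    rcases h.subset_or_subset (A := A) (B := B) (Z := {a, b})
      (by rw [hun, Finset.sdiff_union_self_eq_union]; exact Finset.subset_union_left)
      hAB hno ho with h3 | h3
    · exact ⟨A, B, hA, hB, hAB, hun, hno, h3⟩
    · exact ⟨B, A, hB, hA, hAB.symm, by rw [Finset.union_comm]; exact hun,
        fun x hx y hy hxy => hno y hy x hx hxy.symm, h3⟩
  obtain ⟨hfA, hfB, f, hf, d, hd, hNf⟩ := h.split ha hb hab hA hB hAB hun hno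
  have hmem : ∀ z, z ∈ A ∨ z ∈ B ↔ z ∈ S ∧ z ≠ a ∧ z ≠ b := fun z => by
    simpa using congrArg (z ∈ ·) hun
  have hdis : ∀ z, z ∈ A → z ∉ B := fun z h1 h2 => Finset.disjoint_left.1 hAB h1 h2
  have hda : d ≠ a ∧ d ≠ b := ((hmem d).1 (Or.inr hd)).2
  have hSA : ∀ z, z ∈ A ∪ {a, b} ↔ z ∈ S ∧ z ∉ B := fun z => by
    have h1 := hmem z
    have h2 := hdis z
    simp only [Finset.mem_union, Finset.mem_insert, Finset.mem_singleton]
    constructor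
    · rintro (h3 | rfl | rfl) <;> tauto
    · tauto
  have hSB : ∀ z, z ∈ B ∪ {a, b} ↔ z ∈ S ∧ z ∉ A := fun z => by
    have h1 := hmem z
    have h2 := hdis z
    simp only [Finset.mem_union, Finset.mem_insert, Finset.mem_singleton]
    constructor
    · rintro (h3 | rfl | rfl) <;> tauto
    · tauto
  have hltA : (A ∪ {a, b}).card < S.card := by
    obtain ⟨x, hx⟩ := hB
    exact Finset.card_lt_card ⟨fun z hz => ((hSA z).1 hz).1, fun h1 =>
      ((hSA x).1 (h1 ((hmem x).1 (Or.inr hx)).1)).2 hx⟩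
  have hltB : (B ∪ {a, b}).card < S.card := by
    obtain ⟨x, hx⟩ := hA
    exact Finset.card_lt_card ⟨fun z hz => ((hSB z).1 hz).1, fun h1 =>
      ((hSB x).1 (h1 ((hmem x).1 (Or.inl hx)).1)).2 hx⟩
  have huS : A ∪ {a, b} ∪ (B ∪ {a, b}) = S := by
    ext z
    have h1 := hSA z
    have h2 := hSB z
    have h3 := hdis z
    rw [Finset.mem_union]
    tauto
  have hTab : T.Adj a b := hfB.clique f hf a (by simp [hNf]) b (by simp [hNf]) hab
  obtain ⟨E₁, hb₁, hE₁, -⟩ := ih _ hltA hfA (Finset.mem_filter.2 ⟨ho, hoA⟩) hN rfl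
  set M : Set (Sym2 V) := {e | ∃ x ∈ B ∪ {a, b}, ∃ y ∈ B ∪ {a, b}, T.Adj x y ∧ e = s(x, y)}
    with hMdef
  have hM : ∀ x y z, ({x, y, z} : Finset V) = {a, b, d} →
      ∃ E₂, Built x y (B ∪ {a, b}) [x, z, y] E₂ ∧ M ⊆ E₂ ∪ {s(x, y)} := by
    intro x y z hxyz
    obtain ⟨E₂, hb₂, hE₂, -⟩ := ih _ hltB hfB hf (hNf.trans hxyz.symm) rfl
    refine ⟨E₂, hb₂, ?_⟩
    rintro _ ⟨u, hu, w, hw, huw, rfl⟩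
    exact hE₂ u hu w hw huw
  have hinter : ∀ x ∈ A ∪ {a, b}, x ∈ B ∪ {a, b} → x = a ∨ x = b := by
    intro x hx hx'
    have := (hSA x).1 hx
    simp only [Finset.mem_union, Finset.mem_insert, Finset.mem_singleton] at hx'
    tauto
  have hdB : d ∈ B ∪ {a, b} := Finset.mem_union_left _ hd
  -- conclusion from an amalgam
  have finish : ∀ E', Built v1 v2 S [v1, c, v2] E' → E₁ ⊆ E' → M ⊆ E' ∪ {s(v1, v2)} →
      (∃ y ∈ A ∪ {a, b}, y ≠ a ∧ y ≠ b ∧ s(d, y) ∈ E') →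
      ∃ E, Built v1 v2 S [v1, c, v2] E ∧
      (∀ a ∈ S, ∀ b ∈ S, T.Adj a b → s(a, b) ∈ E ∨ s(a, b) = s(v1, v2)) ∧
      (¬ NoTwoCut T S → ∃ a b, s(a, b) ∈ E ∧ ¬ T.Adj a b) := by
    rintro E' hb' hE' hME ⟨y, hy, hya, hyb, hdy⟩
    refine ⟨E', hb', fun x hx z hz hxz => ?_, fun _ => ⟨d, y, hdy, fun hadj => ?_⟩⟩
    · by_cases hxB : x ∈ B
      · refine hME ⟨x, Finset.mem_union_left _ hxB, z, (hSB z).2 ⟨hz, fun hzA => ?_⟩, hxz, rfl⟩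
        exact hno z hzA x hxB hxz.symm
      by_cases hzB : z ∈ B
      · refine hME ⟨x, (hSB x).2 ⟨hx, fun hxA => ?_⟩, z, Finset.mem_union_left _ hzB, hxz, rfl⟩
        exact hno x hxA z hzB hxz
      · exact (hE₁ x ((hSA x).2 ⟨hx, hxB⟩) z ((hSA z).2 ⟨hz, hzB⟩) hxz).imp_left fun h => hE' h
    · simp only [Finset.mem_union, Finset.mem_insert, Finset.mem_singleton] at hy
      exact hno y (by tauto) d hd hadj.symm
  rcases hE₁ a (by simp) b (by simp) hTab with h3 | h3
  · obtain ⟨E', h4, h5, h6, h7⟩ := hb₁.amalgam h3 hinter hdB hda.1 hda.2 hM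
    rw [huS] at h4
    exact finish E' h4 h5 (h6.trans Set.subset_union_left) h7
  · have hv : (a = v1 ∧ b = v2) ∨ (a = v2 ∧ b = v1) := Sym2.eq_iff.1 h3
    obtain ⟨E₂, h4, h5⟩ := hM v1 v2 d (by
      rcases hv with ⟨rfl, rfl⟩ | ⟨rfl, rfl⟩
      · rfl
      · exact Finset.insert_comm _ _ _)
    rcases hb₁.amalgam_base (fun x hx hx' => by
      rcases hv with ⟨rfl, rfl⟩ | ⟨rfl, rfl⟩
      · exact hinter x hx hx'
      · exact (hinter x hx hx').symm) h4 with ⟨-, h6, -⟩ | ⟨E', h6, h7, h8, y, hy, hy1, hy2, hdy⟩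
    · simp at h6
    · rw [huS] at h6
      refine finish E' h6 h7 (h5.trans (Set.union_subset_union_left _ h8)) ⟨y, hy, ?_, ?_, hdy⟩
      · rcases hv with ⟨rfl, rfl⟩ | ⟨rfl, rfl⟩ <;> assumption
      · rcases hv with ⟨rfl, rfl⟩ | ⟨rfl, rfl⟩ <;> assumption

/-- The full face system of a triangulation has no separating pair. -/
lemma IsFullSystem.noTwoCut (h : IsFullSystem T S F N)
    (hT : ∀ a b : (S : Set V), a ≠ b → ¬ (T.induce (S : Set V)).Adj a b →
      ¬ IsPlanar (T.induce (S : Set V) ⊔ SimpleGraph.fromEdgeSet {s(a, b)})) : NoTwoCut T S := by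
  by_contra hc
  have hF : 0 < F.card := by
    have := h.card_eq
    have := h.three_le
    omega
  obtain ⟨o, ho⟩ := Finset.card_pos.1 hF
  obtain ⟨v1, v2, c, -, -, -, hN⟩ := Finset.card_eq_three.1 (h.card o ho)
  obtain ⟨E, hb, hE, hx⟩ := h.exists_built ho hN
  obtain ⟨a, b, hab, hadj⟩ := hx hc
  obtain ⟨ha, hb', hne⟩ := hb.edge_mem hab
  refine hT ⟨a, ha⟩ ⟨b, hb'⟩ (by simpa using hne) (by simpa using hadj)
    (hb.isPlanar _ Subtype.val Subtype.val_injective (fun x => x.2) ?_)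
  rintro ⟨x, hx⟩ ⟨y, hy⟩ hxy
  rw [SimpleGraph.sup_adj, SimpleGraph.fromEdgeSet_adj] at hxy
  rcases hxy with hxy | ⟨hxy, -⟩
  · exact hE x hx y hy (by simpa using hxy)
  · left
    have h1 := congrArg (Sym2.map Subtype.val) (Set.mem_singleton_iff.1 hxy)
    simp only [Sym2.map_mk] at h1
    simpa [h1] using hab

end TwoCuts

/-- `A` draws the edges `Es` on the vertices `U` without crossings. The set `Z` contains all used
points of the spine, and `Up` and `Lo` contain all halfcircles above and below the spine. -/
structure Drawn {V : Type} [DecidableEq V] (A : ArcDiagram V) (U : Finset V)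
    (Es : Finset (Sym2 V)) (Z : Set ℝ) (Up Lo : Set (ℝ × ℝ)) (b : ℕ) : Prop where
  inj : Set.InjOn A.pos U
  ends : ∀ x y, s(x, y) ∈ Es → x ∈ U ∧ x ≠ y
  pos_mem : ∀ x ∈ U, A.pos x ∈ Z
  fin : Z.Finite
  cross : ∀ e ∈ Es, A.kind e = ArcKind.biarc → A.lo e < A.crossPt e ∧ A.crossPt e < A.hi e ∧
    (∀ x ∈ U, A.crossPt e ≠ A.pos x) ∧ A.crossPt e ∈ Z
  cross_inj : ∀ e ∈ Es, ∀ f ∈ Es, e ≠ f → A.kind e = ArcKind.biarc → A.kind f = ArcKind.biarc →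
    A.crossPt e ≠ A.crossPt f
  up_mem : ∀ e ∈ Es, ∀ a ∈ A.upperArcs e, a ∈ Up
  lo_mem : ∀ e ∈ Es, ∀ a ∈ A.lowerArcs e, a ∈ Lo
  up_ends : ∀ a ∈ Up, a.1 ∈ Z ∧ a.2 ∈ Z
  lo_ends : ∀ a ∈ Lo, a.1 ∈ Z ∧ a.2 ∈ Z
  up_nc : ∀ a ∈ Up, ∀ c ∈ Up, ¬ Interleaved a c
  lo_nc : ∀ a ∈ Lo, ∀ c ∈ Lo, ¬ Interleaved a c
  count : (Es.filter fun e => A.kind e = ArcKind.biarc).card ≤ b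

namespace Drawn

variable {V : Type} [DecidableEq V] {A : ArcDiagram V} {U : Finset V} {Es : Finset (Sym2 V)}
  {Z : Set ℝ} {Up Lo : Set (ℝ × ℝ)} {b : ℕ}

lemma lo_mk (A : ArcDiagram V) (x y : V) : A.lo s(x, y) = min (A.pos x) (A.pos y) := rfl

lemma hi_mk (A : ArcDiagram V) (x y : V) : A.hi s(x, y) = max (A.pos x) (A.pos y) := rfl

lemma interleaved_irrefl (a : ℝ × ℝ) : ¬ Interleaved a a := fun h => lt_irrefl _ h.1

lemma addVertex (h : Drawn A U Es Z Up Lo b) {x : V} (hx : x ∉ U) {t : ℝ} (ht : t ∉ Z) :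
    ∃ A', Drawn A' (insert x U) Es (insert t Z) Up Lo b ∧ A'.pos x = t ∧
      (∀ y ∈ U, A'.pos y = A.pos y) ∧ A'.kind = A.kind := by
  have hp : ∀ y ∈ U, Function.update A.pos x t y = A.pos y := fun y hy =>
    Function.update_of_ne (by rintro rfl; exact hx hy) _ _
  set A' : ArcDiagram V := { A with pos := Function.update A.pos x t } with hA'
  have hpx : A'.pos x = t := Function.update_self _ _ _
  have hp' : ∀ y ∈ U, A'.pos y = A.pos y := hp
  have hlohi : ∀ e ∈ Es, A'.lo e = A.lo e ∧ A'.hi e = A.hi e := by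
    intro e he
    induction e using Sym2.ind with
    | _ y z =>
      have h1 := (h.ends y z he).1
      have h2 := (h.ends z y (Sym2.eq_swap ▸ he)).1
      rw [lo_mk, lo_mk, hi_mk, hi_mk, hp' y h1, hp' z h2]
      exact ⟨rfl, rfl⟩
  have hup : ∀ e ∈ Es, A'.upperArcs e = A.upperArcs e := fun e he => by
    simp only [ArcDiagram.upperArcs, (hlohi e he).1, (hlohi e he).2]
    rfl
  have hlo : ∀ e ∈ Es, A'.lowerArcs e = A.lowerArcs e := fun e he => by
    simp only [ArcDiagram.lowerArcs, (hlohi e he).1, (hlohi e he).2]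
    rfl
  refine ⟨A', ⟨?_, ?_, ?_, h.fin.insert t, ?_, h.cross_inj, ?_, ?_, ?_, ?_, h.up_nc, h.lo_nc,
    h.count⟩, hpx, hp', rfl⟩
  · rw [Finset.coe_insert, Set.injOn_insert (by simpa using hx)]
    refine ⟨fun y hy z hz hyz => h.inj hy hz ?_, ?_⟩
    · rwa [hp' y hy, hp' z hz] at hyz
    · rintro ⟨y, hy, hyx⟩
      rw [hpx, hp' y hy] at hyx
      exact ht (hyx ▸ h.pos_mem y hy)
  · intro y z hyz
    exact ⟨Finset.mem_insert_of_mem (h.ends y z hyz).1, (h.ends y z hyz).2⟩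
  · intro y hy
    rcases Finset.mem_insert.1 hy with h1 | hy
    · rw [h1]; exact Or.inl hpx
    · exact Or.inr (hp' y hy ▸ h.pos_mem y hy)
  · intro e he hk
    obtain ⟨h1, h2, h3, h4⟩ := h.cross e he hk
    rw [(hlohi e he).1, (hlohi e he).2]
    refine ⟨h1, h2, fun y hy => ?_, Or.inr h4⟩
    rcases Finset.mem_insert.1 hy with h5 | hy
    · rw [h5, hpx]; intro h6; exact ht (h6 ▸ h4)
    · rw [hp' y hy]; exact h3 y hy
  · intro e he; rw [hup e he]; exact h.up_mem e he
  · intro e he; rw [hlo e he]; exact h.lo_mem e he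
  · exact fun a ha => ⟨Or.inr (h.up_ends a ha).1, Or.inr (h.up_ends a ha).2⟩
  · exact fun a ha => ⟨Or.inr (h.lo_ends a ha).1, Or.inr (h.lo_ends a ha).2⟩

lemma nc_insert {S : Set (ℝ × ℝ)} (hS : ∀ a ∈ S, ∀ c ∈ S, ¬ Interleaved a c) {q : ℝ × ℝ}
    (hq : ∀ a ∈ S, ¬ Interleaved a q ∧ ¬ Interleaved q a) :
    ∀ a ∈ insert q S, ∀ c ∈ insert q S, ¬ Interleaved a c := by
  rintro a (rfl | ha) c (rfl | hc)
  · exact interleaved_irrefl _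
  · exact (hq c hc).2
  · exact (hq a ha).1
  · exact hS a ha c hc

lemma ends_insert (h : Drawn A U Es Z Up Lo b) {x y : V} (hx : x ∈ U) (hy : y ∈ U)
    (hxy : x ≠ y) : ∀ u w, s(u, w) ∈ insert s(x, y) Es → u ∈ U ∧ u ≠ w := by
  intro u w huw
  rcases Finset.mem_insert.1 huw with huw | huw
  · rcases Sym2.eq_iff.1 huw with ⟨rfl, rfl⟩ | ⟨rfl, rfl⟩
    · exact ⟨hx, hxy⟩
    · exact ⟨hy, hxy.symm⟩
  · exact h.ends u w huw

lemma addMountain (h : Drawn A U Es Z Up Lo b) {x y : V} (hx : x ∈ U) (hy : y ∈ U)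
    (hxy : A.pos x < A.pos y)
    (hnc : ∀ a ∈ Up, ¬ Interleaved a (A.pos x, A.pos y) ∧ ¬ Interleaved (A.pos x, A.pos y) a) :
    ∃ A', Drawn A' U (insert s(x, y) Es) Z (insert (A.pos x, A.pos y) Up) Lo b ∧
      A'.pos = A.pos ∧ A'.kind s(x, y) = ArcKind.mountain ∧
      ∀ e, A.kind e = ArcKind.mountain → A'.kind e = ArcKind.mountain := by
  set A' : ArcDiagram V := { A with kind := Function.update A.kind s(x, y) ArcKind.mountain }
    with hA'
  have hk : A'.kind s(x, y) = ArcKind.mountain := Function.update_self _ _ _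
  have hk' : ∀ e, e ≠ s(x, y) → A'.kind e = A.kind e := fun e he =>
    Function.update_of_ne he _ _
  have hlo : ∀ e, A'.lo e = A.lo e := fun _ => rfl
  have hhi : ∀ e, A'.hi e = A.hi e := fun _ => rfl
  have hcr : ∀ e, A'.crossPt e = A.crossPt e := fun _ => rfl
  have hps : ∀ e, A'.pos e = A.pos e := fun _ => rfl
  have hbi : ∀ e, A'.kind e = ArcKind.biarc → e ≠ s(x, y) ∧ A.kind e = ArcKind.biarc := by
    intro e he
    have hne : e ≠ s(x, y) := by rintro rfl; rw [hk] at he; cases he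
    exact ⟨hne, hk' e hne ▸ he⟩
  have hne : x ≠ y := by rintro rfl; exact lt_irrefl _ hxy
  refine ⟨A', ⟨h.inj, h.ends_insert hx hy hne, h.pos_mem, h.fin, ?_, ?_, ?_, ?_, ?_, h.lo_ends,
    nc_insert h.up_nc hnc, h.lo_nc, ?_⟩, rfl, hk, ?_⟩
  · intro e he hke
    obtain ⟨h1, h2⟩ := hbi e hke
    exact h.cross e (Finset.mem_of_mem_insert_of_ne he h1) h2
  · intro e he f hf hef hke hkf
    obtain ⟨h1, h2⟩ := hbi e hke
    obtain ⟨h3, h4⟩ := hbi f hkf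
    exact h.cross_inj e (Finset.mem_of_mem_insert_of_ne he h1) f
      (Finset.mem_of_mem_insert_of_ne hf h3) hef h2 h4
  · intro e he a ha
    by_cases hexy : e = s(x, y)
    · subst hexy
      simp only [ArcDiagram.upperArcs, hk, List.mem_singleton] at ha
      rw [ha, hlo, hhi, lo_mk, hi_mk, min_eq_left hxy.le, max_eq_right hxy.le]
      exact Or.inl rfl
    · simp only [ArcDiagram.upperArcs, hk' e hexy, hlo, hhi, hcr] at ha
      exact Or.inr (h.up_mem e (Finset.mem_of_mem_insert_of_ne he hexy) a ha)
  · intro e he a ha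
    by_cases hexy : e = s(x, y)
    · subst hexy
      simp only [ArcDiagram.lowerArcs, hk, List.not_mem_nil] at ha
    · simp only [ArcDiagram.lowerArcs, hk' e hexy, hlo, hhi, hcr] at ha
      exact h.lo_mem e (Finset.mem_of_mem_insert_of_ne he hexy) a ha
  · rintro a (rfl | ha)
    · exact ⟨h.pos_mem x hx, h.pos_mem y hy⟩
    · exact h.up_ends a ha
  · refine le_trans (Finset.card_le_card ?_) h.count
    intro e he
    rw [Finset.mem_filter] at he ⊢
    obtain ⟨h1, h2⟩ := hbi e he.2
    exact ⟨Finset.mem_of_mem_insert_of_ne he.1 h1, h2⟩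
  · intro e he
    by_cases hexy : e = s(x, y)
    · rw [hexy]; exact hk
    · rw [hk' e hexy]; exact he

lemma addPocket (h : Drawn A U Es Z Up Lo b) {x y : V} (hx : x ∈ U) (hy : y ∈ U)
    (hxy : A.pos x < A.pos y) (hnew : s(x, y) ∉ Es)
    (hnc : ∀ a ∈ Lo, ¬ Interleaved a (A.pos x, A.pos y) ∧ ¬ Interleaved (A.pos x, A.pos y) a) :
    ∃ A', Drawn A' U (insert s(x, y) Es) Z Up (insert (A.pos x, A.pos y) Lo) b ∧
      A'.pos = A.pos ∧ ∀ e ∈ Es, A.kind e = ArcKind.mountain → A'.kind e = ArcKind.mountain := by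
  set A' : ArcDiagram V := { A with kind := Function.update A.kind s(x, y) ArcKind.pocket }
    with hA'
  have hk : A'.kind s(x, y) = ArcKind.pocket := Function.update_self _ _ _
  have hk' : ∀ e, e ≠ s(x, y) → A'.kind e = A.kind e := fun e he =>
    Function.update_of_ne he _ _
  have hlo : ∀ e, A'.lo e = A.lo e := fun _ => rfl
  have hhi : ∀ e, A'.hi e = A.hi e := fun _ => rfl
  have hcr : ∀ e, A'.crossPt e = A.crossPt e := fun _ => rfl
  have hbi : ∀ e, A'.kind e = ArcKind.biarc → e ≠ s(x, y) ∧ A.kind e = ArcKind.biarc := by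
    intro e he
    have hne : e ≠ s(x, y) := by rintro rfl; rw [hk] at he; cases he
    exact ⟨hne, hk' e hne ▸ he⟩
  have hne : x ≠ y := by rintro rfl; exact lt_irrefl _ hxy
  refine ⟨A', ⟨h.inj, h.ends_insert hx hy hne, h.pos_mem, h.fin, ?_, ?_, ?_, ?_, h.up_ends, ?_,
    h.up_nc, nc_insert h.lo_nc hnc, ?_⟩, rfl, ?_⟩
  · intro e he hke
    obtain ⟨h1, h2⟩ := hbi e hke
    exact h.cross e (Finset.mem_of_mem_insert_of_ne he h1) h2
  · intro e he f hf hef hke hkf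
    obtain ⟨h1, h2⟩ := hbi e hke
    obtain ⟨h3, h4⟩ := hbi f hkf
    exact h.cross_inj e (Finset.mem_of_mem_insert_of_ne he h1) f
      (Finset.mem_of_mem_insert_of_ne hf h3) hef h2 h4
  · intro e he a ha
    by_cases hexy : e = s(x, y)
    · subst hexy
      simp only [ArcDiagram.upperArcs, hk, List.not_mem_nil] at ha
    · simp only [ArcDiagram.upperArcs, hk' e hexy, hlo, hhi, hcr] at ha
      exact h.up_mem e (Finset.mem_of_mem_insert_of_ne he hexy) a ha
  · intro e he a ha
    by_cases hexy : e = s(x, y)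
    · subst hexy
      simp only [ArcDiagram.lowerArcs, hk, List.mem_singleton] at ha
      rw [ha, hlo, hhi, lo_mk, hi_mk, min_eq_left hxy.le, max_eq_right hxy.le]
      exact Or.inl rfl
    · simp only [ArcDiagram.lowerArcs, hk' e hexy, hlo, hhi, hcr] at ha
      exact Or.inr (h.lo_mem e (Finset.mem_of_mem_insert_of_ne he hexy) a ha)
  · rintro a (rfl | ha)
    · exact ⟨h.pos_mem x hx, h.pos_mem y hy⟩
    · exact h.lo_ends a ha
  · refine le_trans (Finset.card_le_card ?_) h.count
    intro e he
    rw [Finset.mem_filter] at he ⊢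
    obtain ⟨h1, h2⟩ := hbi e he.2
    exact ⟨Finset.mem_of_mem_insert_of_ne he.1 h1, h2⟩
  · intro e he hm
    rw [hk' e (by rintro rfl; exact hnew he)]; exact hm

lemma toBiarc (h : Drawn A U Es Z Up Lo b) {x y : V} (hxy : A.pos x < A.pos y)
    (he : s(x, y) ∈ Es) (hm : A.kind s(x, y) = ArcKind.mountain) {t : ℝ} (ht : t ∉ Z)
    (hxt : A.pos x < t) (hty : t < A.pos y)
    (hup : ∀ a ∈ Up, ¬ Interleaved a (t, A.pos y) ∧ ¬ Interleaved (t, A.pos y) a)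
    (hlow : ∀ a ∈ Lo, ¬ Interleaved a (A.pos x, t) ∧ ¬ Interleaved (A.pos x, t) a) :
    ∃ A', Drawn A' U Es (insert t Z) (insert (t, A.pos y) (Up \ {(A.pos x, A.pos y)}))
        (insert (A.pos x, t) Lo) (b + 1) ∧
      A'.pos = A.pos ∧ ∀ e, e ≠ s(x, y) → A'.kind e = A.kind e := by
  set A' : ArcDiagram V := { A with
    kind := Function.update A.kind s(x, y) ArcKind.biarc
    crossPt := Function.update A.crossPt s(x, y) t } with hA'
  have hk : A'.kind s(x, y) = ArcKind.biarc := Function.update_self _ _ _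
  have hk' : ∀ e, e ≠ s(x, y) → A'.kind e = A.kind e := fun e he =>
    Function.update_of_ne he _ _
  have hc : A'.crossPt s(x, y) = t := Function.update_self _ _ _
  have hc' : ∀ e, e ≠ s(x, y) → A'.crossPt e = A.crossPt e := fun e he =>
    Function.update_of_ne he _ _
  have hlo : ∀ e, A'.lo e = A.lo e := fun _ => rfl
  have hhi : ∀ e, A'.hi e = A.hi e := fun _ => rfl
  have hps : ∀ e, A'.pos e = A.pos e := fun _ => rfl
  have hxU := (h.ends x y he).1
  have hyU := (h.ends y x (Sym2.eq_swap ▸ he)).1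
  have hloxy : A.lo s(x, y) = A.pos x := by rw [lo_mk, min_eq_left hxy.le]
  have hhixy : A.hi s(x, y) = A.pos y := by rw [hi_mk, max_eq_right hxy.le]
  refine ⟨A', ⟨h.inj, h.ends, fun z hz => Or.inr (h.pos_mem z hz), h.fin.insert t, ?_, ?_, ?_, ?_,
    ?_, ?_, nc_insert ?_ ?_, nc_insert h.lo_nc hlow, ?_⟩, rfl, hk'⟩
  · intro e hee hke
    by_cases hexy : e = s(x, y)
    · subst hexy
      rw [hlo, hhi, hc, hloxy, hhixy]
      exact ⟨hxt, hty, fun z hz h' => ht (h' ▸ h.pos_mem z hz), Or.inl rfl⟩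
    · rw [hk' e hexy] at hke
      rw [hlo, hhi, hc' e hexy]
      obtain ⟨h1, h2, h3, h4⟩ := h.cross e hee hke
      exact ⟨h1, h2, h3, Or.inr h4⟩
  · intro e hee f hf hef hke hkf
    by_cases hexy : e = s(x, y)
    · have hfxy : f ≠ s(x, y) := fun h' => hef (hexy.trans h'.symm)
      rw [hexy, hc, hc' f hfxy]
      rw [hk' f hfxy] at hkf
      exact fun h' => ht (h' ▸ (h.cross f hf hkf).2.2.2)
    · rw [hk' e hexy] at hke
      rw [hc' e hexy]
      by_cases hfxy : f = s(x, y)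
      · rw [hfxy, hc]
        exact fun h' => ht (h' ▸ (h.cross e hee hke).2.2.2)
      · rw [hk' f hfxy] at hkf
        rw [hc' f hfxy]
        exact h.cross_inj e hee f hf hef hke hkf
  · intro e hee a ha
    by_cases hexy : e = s(x, y)
    · subst hexy
      simp only [ArcDiagram.upperArcs, hk, List.mem_singleton] at ha
      rw [ha, hc, hhi, hhixy]
      exact Or.inl rfl
    · simp only [ArcDiagram.upperArcs, hk' e hexy, hlo, hhi, hc' e hexy] at ha
      have ha' : a ∈ A.upperArcs e := ha
      refine Or.inr ⟨h.up_mem e hee a ha', ?_⟩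
      rintro rfl
      cases hke : A.kind e with
      | mountain =>
        simp only [hke, List.mem_singleton, Prod.mk.injEq] at ha
        induction e using Sym2.ind with
        | _ u w =>
          have hu := (h.ends u w hee)
          have hw := (h.ends w u (Sym2.eq_swap ▸ hee)).1
          rw [lo_mk, hi_mk] at ha
          rcases le_total (A.pos u) (A.pos w) with h1 | h1
          · rw [min_eq_left h1, max_eq_right h1] at ha
            exact hexy (by rw [h.inj hxU hu.1 ha.1, h.inj hyU hw ha.2])
          · rw [min_eq_right h1, max_eq_left h1] at ha
            exact hexy (by rw [h.inj hxU hw ha.1, h.inj hyU hu.1 ha.2, Sym2.eq_swap])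
      | pocket => simp [hke] at ha
      | biarc =>
        simp only [hke, List.mem_singleton, Prod.mk.injEq] at ha
        exact (h.cross e hee hke).2.2.1 x hxU ha.1.symm
  · intro e hee a ha
    by_cases hexy : e = s(x, y)
    · subst hexy
      simp only [ArcDiagram.lowerArcs, hk, List.mem_singleton] at ha
      rw [ha, hc, hlo, hloxy]
      exact Or.inl rfl
    · simp only [ArcDiagram.lowerArcs, hk' e hexy, hlo, hhi, hc' e hexy] at ha
      exact Or.inr (h.lo_mem e hee a ha)
  · rintro a (rfl | ha)
    · exact ⟨Or.inl rfl, Or.inr (h.pos_mem y hyU)⟩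
    · exact ⟨Or.inr (h.up_ends a ha.1).1, Or.inr (h.up_ends a ha.1).2⟩
  · rintro a (rfl | ha)
    · exact ⟨Or.inr (h.pos_mem x hxU), Or.inl rfl⟩
    · exact ⟨Or.inr (h.lo_ends a ha).1, Or.inr (h.lo_ends a ha).2⟩
  · exact fun a ha c hc => h.up_nc a ha.1 c hc.1
  · exact fun a ha => hup a ha.1
  · refine le_trans (Finset.card_le_card (t := insert s(x, y)
      (Es.filter fun e => A.kind e = ArcKind.biarc)) ?_) ((Finset.card_insert_le _ _).trans
      (Nat.add_le_add_right h.count 1))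
    intro e he'
    rw [Finset.mem_filter] at he'
    rw [Finset.mem_insert, Finset.mem_filter]
    by_cases hexy : e = s(x, y)
    · exact Or.inl hexy
    · exact Or.inr ⟨he'.1, hk' e hexy ▸ he'.2⟩

end Drawn

/-- Consecutive vertices `x.1`, `y.1` of the upper envelope. The flag `x.2` tells whether the edge
between them is a mountain; otherwise the spine is free between them. -/
def EnvelopeRel {V : Type} (A : ArcDiagram V) (Es : Finset (Sym2 V)) (Z : Set ℝ)
    (Up : Set (ℝ × ℝ)) (x y : V × Bool) : Prop :=
  A.pos x.1 < A.pos y.1 ∧ (∀ a ∈ Up, a.1 = A.pos x.1 → x.2 = true ∧ a.2 = A.pos y.1) ∧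
    (x.2 = true → s(x.1, y.1) ∈ Es ∧ A.kind s(x.1, y.1) = ArcKind.mountain) ∧
    (x.2 = false → ∀ z ∈ Z, ¬ (A.pos x.1 < z ∧ z < A.pos y.1))

/-- `Q` is a part of the upper envelope of the diagram: consecutive vertices are related by
`EnvelopeRel`, and no vertex lies strictly below a halfcircle. -/
structure Envelope {V : Type} (A : ArcDiagram V) (Es : Finset (Sym2 V)) (Z : Set ℝ)
    (Up : Set (ℝ × ℝ)) (Q : List (V × Bool)) : Prop where
  link : Q.IsChain (EnvelopeRel A Es Z Up)
  clear : ∀ x ∈ Q, ∀ a ∈ Up, ¬ (a.1 < A.pos x.1 ∧ A.pos x.1 < a.2)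

namespace Envelope

variable {V : Type} {A A' : ArcDiagram V} {Es Es' : Finset (Sym2 V)} {Z Z' : Set ℝ}
  {Up Up' : Set (ℝ × ℝ)} {L R Q : List (V × Bool)} {p : V} {t t' : Bool} {x y : V × Bool}

lemma sorted (h : Envelope A Es Z Up Q) : Q.Pairwise fun x y => A.pos x.1 < A.pos y.1 := by
  have h1 : Q.IsChain fun x y => A.pos x.1 < A.pos y.1 := h.link.imp fun _ _ h => h.1
  have : Trans (fun x y : V × Bool => A.pos x.1 < A.pos y.1)
      (fun x y : V × Bool => A.pos x.1 < A.pos y.1)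
      (fun x y : V × Bool => A.pos x.1 < A.pos y.1) := ⟨fun h1 h2 => lt_trans h1 h2⟩
  exact h1.pairwise

lemma lt_of_append (h : Envelope A Es Z Up (L ++ x :: R)) : ∀ y ∈ L, A.pos y.1 < A.pos x.1 :=
  fun y hy => (List.pairwise_append.1 h.sorted).2.2 y hy x (by simp)

lemma lt_of_cons (h : Envelope A Es Z Up (x :: R)) : ∀ y ∈ R, A.pos x.1 < A.pos y.1 :=
  fun y hy => (List.pairwise_cons.1 h.sorted).1 y hy

lemma right (h : Envelope A Es Z Up (L ++ R)) : Envelope A Es Z Up R :=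
  ⟨(List.isChain_append.1 h.link).2.1, fun x hx => h.clear x (List.mem_append_right _ hx)⟩

lemma tail (h : Envelope A Es Z Up (x :: R)) : Envelope A Es Z Up R :=
  right (L := [x]) h

lemma left (h : Envelope A Es Z Up (L ++ R)) : Envelope A Es Z Up L :=
  ⟨(List.isChain_append.1 h.link).1, fun x hx => h.clear x (List.mem_append_left _ hx)⟩

lemma left_cons (h : Envelope A Es Z Up (L ++ x :: R)) : Envelope A Es Z Up (L ++ [x]) :=
  left (R := R) (by simpa using h)

lemma rel (h : Envelope A Es Z Up (L ++ x :: y :: R)) : EnvelopeRel A Es Z Up x y :=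
  (List.isChain_cons_cons.1 (right h).link).1

lemma glue (h : Envelope A Es Z Up (L ++ [x])) (h' : Envelope A Es Z Up (y :: R))
    (hxy : EnvelopeRel A Es Z Up x y) : Envelope A Es Z Up (L ++ x :: y :: R) := by
  refine ⟨List.isChain_split.2 ⟨h.link, List.isChain_cons_cons.2 ⟨hxy, h'.link⟩⟩, ?_⟩
  intro z hz
  rcases List.mem_append.1 hz with hz | hz
  · exact h.clear z (List.mem_append_left _ hz)
  · rcases List.mem_cons.1 hz with rfl | hz
    · exact h.clear z (by simp)
    · exact h'.clear z hz

lemma cons (h' : Envelope A Es Z Up (y :: R)) (hxy : EnvelopeRel A Es Z Up x y)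
    (hc : ∀ a ∈ Up, ¬ (a.1 < A.pos x.1 ∧ A.pos x.1 < a.2)) : Envelope A Es Z Up (x :: y :: R) :=
  glue (L := []) ⟨List.isChain_singleton _, by simpa using hc⟩ h' hxy

lemma le_last (h : Envelope A Es Z Up (L ++ [(p, t)])) :
    ∀ y ∈ L ++ [(p, t)], A.pos y.1 ≤ A.pos p := by
  intro y hy
  rcases List.mem_append.1 hy with hy | hy
  · exact (h.lt_of_append y hy).le
  · rw [List.mem_singleton.1 hy]

/-- A change to the right of its last vertex keeps the left part of an envelope. -/
lemma mono_left (h : Envelope A Es Z Up (L ++ [(p, t)])) (hpos : ∀ x ∈ L ++ [(p, t)],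
    A'.pos x.1 = A.pos x.1) (hEs : Es ⊆ Es')
    (hk : ∀ x ∈ L ++ [(p, t)], ∀ y ∈ L ++ [(p, t)], s(x.1, y.1) ∈ Es →
      A.kind s(x.1, y.1) = ArcKind.mountain → A'.kind s(x.1, y.1) = ArcKind.mountain)
    (hZ : ∀ z ∈ Z', z ∈ Z ∨ A.pos p ≤ z) (hUp : ∀ a ∈ Up', a ∈ Up ∨ A.pos p ≤ a.1) :
    Envelope A' Es' Z' Up' (L ++ [(p, t')]) := by
  have hle := h.le_last
  have key : Envelope A' Es' Z' Up' (L ++ [(p, t)]) := by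
    refine ⟨List.IsChain.imp_of_mem_imp ?_ h.link, ?_⟩
    · intro x y hx hy hxy
      obtain ⟨h1, h2, h3, h4⟩ := hxy
      have hy' := hle y hy
      rw [EnvelopeRel, hpos x hx, hpos y hy]
      refine ⟨h1, fun a ha hax => ?_, fun hx' => ?_, fun hx' z hz hz' => ?_⟩
      · rcases hUp a ha with h5 | h5
        · exact h2 a h5 hax
        · linarith
      · exact ⟨hEs (h3 hx').1, hk x hx y hy (h3 hx').1 (h3 hx').2⟩
      · rcases hZ z hz with h5 | h5
        · exact h4 hx' z h5 hz'
        · linarith [hz'.2]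
    · intro x hx a ha
      rw [hpos x hx]
      rcases hUp a ha with h5 | h5
      · exact h.clear x hx a h5
      · intro h6
        linarith [hle x hx, h6.1]
  constructor
  · have h1 := key.link
    rw [List.isChain_append] at h1 ⊢
    refine ⟨h1.1, List.isChain_singleton _, ?_⟩
    intro x hx y hy
    obtain rfl : (p, t') = y := by simpa using hy
    exact h1.2.2 x hx (p, t) (by simp)
  · intro x hx
    rcases List.mem_append.1 hx with hx | hx
    · exact key.clear x (List.mem_append_left _ hx)
    · rw [List.mem_singleton.1 hx]
      exact key.clear (p, t) (by simp)

/-- A change to the left of its first vertex keeps the right part of an envelope. -/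
lemma mono_right (h : Envelope A Es Z Up (y :: R)) (hpos : ∀ x ∈ y :: R,
    A'.pos x.1 = A.pos x.1) (hEs : Es ⊆ Es')
    (hk : ∀ u ∈ y :: R, ∀ w ∈ y :: R, s(u.1, w.1) ∈ Es →
      A.kind s(u.1, w.1) = ArcKind.mountain → A'.kind s(u.1, w.1) = ArcKind.mountain)
    (hZ : ∀ z ∈ Z', z ∈ Z ∨ z ≤ A.pos y.1)
    (hUp : ∀ a ∈ Up', a ∈ Up ∨ a.1 < A.pos y.1 ∧ a.2 ≤ A.pos y.1) :
    Envelope A' Es' Z' Up' (y :: R) := by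
  have hle : ∀ x ∈ y :: R, A.pos y.1 ≤ A.pos x.1 := by
    intro x hx
    rcases List.mem_cons.1 hx with rfl | hx
    · exact le_rfl
    · exact (h.lt_of_cons x hx).le
  refine ⟨List.IsChain.imp_of_mem_imp ?_ h.link, ?_⟩
  · intro u w hu hw huw
    obtain ⟨h1, h2, h3, h4⟩ := huw
    have hu' := hle u hu
    rw [EnvelopeRel, hpos u hu, hpos w hw]
    refine ⟨h1, fun a ha hax => ?_, fun hx' => ?_, fun hx' z hz hz' => ?_⟩
    · rcases hUp a ha with h5 | h5
      · exact h2 a h5 hax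
      · linarith [h5.1]
    · exact ⟨hEs (h3 hx').1, hk u hu w hw (h3 hx').1 (h3 hx').2⟩
    · rcases hZ z hz with h5 | h5
      · exact h4 hx' z h5 hz'
      · linarith [hz'.1]
  · intro x hx a ha
    rw [hpos x hx]
    rcases hUp a ha with h5 | h5
    · exact h.clear x hx a h5
    · intro h6
      linarith [hle x hx, h6.2, h5.2]

end Envelope

/-- A diagram in which all used points of the spine are right of `l` and no halfcircle below the
spine separates `r` from the lower halfplane. -/
structure RootedDiagram {V : Type} [DecidableEq V] (l r : V) (A : ArcDiagram V) (U : Finset V)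
    (Es : Finset (Sym2 V)) (Z : Set ℝ) (Up Lo : Set (ℝ × ℝ)) (b : ℕ) : Prop
    extends Drawn A U Es Z Up Lo b where
  l_mem : l ∈ U
  r_mem : r ∈ U
  left : ∀ z ∈ Z, A.pos l ≤ z
  low : ∀ a ∈ Lo, ¬ (a.1 < A.pos r ∧ A.pos r < a.2)

namespace RootedDiagram

variable {V : Type} [DecidableEq V] {l r : V} {A : ArcDiagram V} {U : Finset V}
  {Es : Finset (Sym2 V)} {Z : Set ℝ} {Up Lo : Set (ℝ × ℝ)} {b : ℕ}

lemma vertex (h : RootedDiagram l r A U Es Z Up Lo b) {x : V} (hx : x ∉ U) {t : ℝ} (ht : t ∉ Z)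
    (hl : A.pos l ≤ t) :
    ∃ A', RootedDiagram l r A' (insert x U) Es (insert t Z) Up Lo b ∧ A'.pos x = t ∧
      (∀ y ∈ U, A'.pos y = A.pos y) ∧ A'.kind = A.kind := by
  obtain ⟨A', h1, h2, h3, h4⟩ := h.addVertex hx ht
  refine ⟨A', ⟨h1, Finset.mem_insert_of_mem h.l_mem, Finset.mem_insert_of_mem h.r_mem, ?_, ?_⟩,
    h2, h3, h4⟩
  · rw [h3 l h.l_mem]
    rintro z (rfl | hz)
    · exact hl
    · exact h.left z hz
  · rw [h3 r h.r_mem]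
    exact h.low

lemma mountain (h : RootedDiagram l r A U Es Z Up Lo b) {x y : V} (hx : x ∈ U) (hy : y ∈ U)
    {a c : ℝ} (hpx : A.pos x = a) (hpy : A.pos y = c) (hac : a < c)
    (hnc : ∀ d ∈ Up, ¬ Interleaved d (a, c) ∧ ¬ Interleaved (a, c) d) :
    ∃ A', RootedDiagram l r A' U (insert s(x, y) Es) Z (insert (a, c) Up) Lo b ∧
      A'.pos = A.pos ∧ A'.kind s(x, y) = ArcKind.mountain ∧
      ∀ e, A.kind e = ArcKind.mountain → A'.kind e = ArcKind.mountain := by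
  subst hpx hpy
  obtain ⟨A', h1, h2, h3, h4⟩ := h.addMountain hx hy hac hnc
  exact ⟨A', ⟨h1, h.l_mem, h.r_mem, h2 ▸ h.left, h2 ▸ h.low⟩, h2, h3, h4⟩

lemma pocket (h : RootedDiagram l r A U Es Z Up Lo b) {x y : V} (hx : x ∈ U) (hy : y ∈ U)
    {a c : ℝ} (hpx : A.pos x = a) (hpy : A.pos y = c) (hac : a < c) (hnew : s(x, y) ∉ Es)
    (hnc : ∀ d ∈ Lo, ¬ Interleaved d (a, c) ∧ ¬ Interleaved (a, c) d)
    (hr : ¬ (a < A.pos r ∧ A.pos r < c)) :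
    ∃ A', RootedDiagram l r A' U (insert s(x, y) Es) Z Up (insert (a, c) Lo) b ∧
      A'.pos = A.pos ∧
      ∀ e ∈ Es, A.kind e = ArcKind.mountain → A'.kind e = ArcKind.mountain := by
  subst hpx hpy
  obtain ⟨A', h1, h2, h3⟩ := h.addPocket hx hy hac hnew hnc
  refine ⟨A', ⟨h1, h.l_mem, h.r_mem, h2 ▸ h.left, ?_⟩, h2, h3⟩
  rw [h2]
  rintro a (rfl | ha)
  · exact hr
  · exact h.low a ha

lemma notMem_edges (h : RootedDiagram l r A U Es Z Up Lo b) {x y : V} (hx : x ∉ U) :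
    s(x, y) ∉ Es := fun h' => hx (h.ends x y h').1

lemma exists_gap (h : RootedDiagram l r A U Es Z Up Lo b) (p : ℝ) {q : ℝ} (hpq : p < q) :
    ∃ t, p < t ∧ t < q ∧ ∀ z ∈ Z, ¬ (p < z ∧ z ≤ t) := by
  have hf : (Z ∩ Set.Ioi p).Finite := h.fin.subset Set.inter_subset_left
  obtain ⟨m, hm1, hm2⟩ : ∃ m, p < m ∧ ∀ z ∈ Z, p < z → m ≤ z := by
    by_cases hne : (Z ∩ Set.Ioi p).Nonempty
    · obtain ⟨m, hm, hm'⟩ := Set.exists_min_image _ id hf hne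
      exact ⟨m, hm.2, fun z hz hpz => hm' z ⟨hz, hpz⟩⟩
    · exact ⟨q, hpq, fun z hz hpz => (hne ⟨z, hz, hpz⟩).elim⟩
  refine ⟨(p + min m q) / 2, ?_, ?_, ?_⟩
  · have := lt_min hm1 hpq
    linarith
  · have := min_le_right m q
    linarith
  · rintro z hz ⟨h1, h2⟩
    have := lt_min hm1 hpq
    have := min_le_left m q
    linarith [hm2 z hz h1]

end RootedDiagram

/-- The envelope is open between its consecutive vertices `p` and `y.1`: the spine is free from `p`
to `t`, and no halfcircle above the spine covers this part. -/
structure OpenAt {V : Type} [DecidableEq V] (l r : V) (A : ArcDiagram V) (U : Finset V)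
    (Es : Finset (Sym2 V)) (Z : Set ℝ) (Up Lo : Set (ℝ × ℝ)) (b : ℕ) (L : List (V × Bool)) (p : V)
    (y : V × Bool) (R : List (V × Bool)) (t : ℝ) : Prop
    extends RootedDiagram l r A U Es Z Up Lo b where
  envL : Envelope A Es Z Up (L ++ [(p, false)])
  envR : Envelope A Es Z Up (y :: R)
  lt : A.pos p < t
  le : t ≤ A.pos y.1
  gap : ∀ z ∈ Z, ¬ (A.pos p < z ∧ z < t)
  sep : ∀ a ∈ Up, (a.1 < A.pos p ∧ a.2 ≤ A.pos p) ∨ t ≤ a.1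

/-- There is a diagram with vertex set `U` containing the edges `E`, with upper envelope `P`, such
that the number of biarcs and of mountains on the envelope add up to at most `k`. -/
def HasDiagram {V : Type} [DecidableEq V] (l r : V) (U : Finset V) (E : Set (Sym2 V))
    (P : List (V × Bool)) (k : ℕ) : Prop :=
  ∃ A Es Z Up Lo b, RootedDiagram l r A U Es Z Up Lo b ∧ (∀ e ∈ E, e ∈ Es) ∧
    Envelope A Es Z Up P ∧ (∀ x ∈ P, x.1 ∈ U) ∧ b + P.countP (·.2) ≤ k

section Ops

variable {V : Type} [DecidableEq V] {l r : V} {A : ArcDiagram V} {U : Finset V}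
  {Es : Finset (Sym2 V)} {Z : Set ℝ} {Up Lo : Set (ℝ × ℝ)} {b : ℕ} {L R : List (V × Bool)}
  {p v f : V} {y : V × Bool} {t : Bool} {E : Set (Sym2 V)} {k : ℕ}

lemma RootedDiagram.exists_openAt (h : RootedDiagram l r A U Es Z Up Lo b)
    (hP : Envelope A Es Z Up (L ++ (p, t) :: y :: R))
    (hU : ∀ x ∈ L ++ (p, t) :: y :: R, x.1 ∈ U) :
    ∃ A' Z' Up' Lo' τ, OpenAt l r A' U Es Z' Up' Lo' (b + t.toNat) L p y R τ ∧
      A'.pos = A.pos ∧ (t = false → A.pos y.1 ≤ τ) := by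
  have hpU : p ∈ U := hU (p, t) (by simp)
  have hyU : y.1 ∈ U := hU y (by simp)
  obtain ⟨h1, h2, h3, h4⟩ := hP.rel
  simp only at h1 h2 h3 h4
  have hcp := hP.clear (p, t) (by simp)
  have hcy := hP.clear y (by simp)
  have hL := hP.left_cons
  have hR : Envelope A Es Z Up (y :: R) := hP.right.tail
  cases ht : t with
  | false =>
    subst ht
    refine ⟨A, Z, Up, Lo, A.pos y.1, ⟨h, hL, hR, h1, le_rfl, h4 rfl, ?_⟩, rfl, fun _ => le_rfl⟩
    intro a ha
    have ha1 := (h.up_ends a ha).1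
    rcases lt_trichotomy a.1 (A.pos p) with h5 | h5 | h5
    · left; refine ⟨h5, ?_⟩; by_contra h6; exact hcp a ha ⟨h5, not_le.1 h6⟩
    · exact absurd (h2 a ha h5).1 (by simp)
    · right; by_contra h6; exact h4 rfl _ ha1 ⟨h5, not_le.1 h6⟩
  | true =>
    subst ht
    obtain ⟨he, hm⟩ := h3 rfl
    obtain ⟨τ, hτ1, hτ2, hτ3⟩ := h.exists_gap (A.pos p) h1
    have hτZ : τ ∉ Z := fun h' => hτ3 τ h' ⟨hτ1, le_rfl⟩
    obtain ⟨A', hA, hpos, hk⟩ := h.toBiarc h1 he hm hτZ hτ1 hτ2 (by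
        intro a ha
        have ha1 := (h.up_ends a ha).1
        constructor
        · rintro ⟨h5, h6, h7⟩
          simp only at h5 h6 h7
          rcases lt_trichotomy a.1 (A.pos p) with h8 | h8 | h8
          · exact hcp a ha ⟨h8, by simp only; linarith⟩
          · linarith [(h2 a ha h8).2]
          · exact hτ3 _ ha1 ⟨h8, h5.le⟩
        · rintro ⟨h5, h6, h7⟩
          exact hcy a ha ⟨h6, h7⟩) (by
        intro a ha
        have ha1 := (h.lo_ends a ha)
        constructor
        · rintro ⟨h5, h6, h7⟩
          exact hτ3 _ ha1.2 ⟨h6, h7.le⟩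
        · rintro ⟨h5, h6, h7⟩
          exact hτ3 _ ha1.1 ⟨h5, h6.le⟩)
    have hltL := hL.le_last
    have hltR := hR.lt_of_cons
    refine ⟨A', _, _, _, τ, ⟨⟨hA, h.l_mem, h.r_mem, ?_, ?_⟩, ?_, ?_, ?_, ?_, ?_, ?_⟩, hpos, by simp⟩
    · rw [hpos]
      rintro z (rfl | hz)
      · linarith [h.left _ (h.pos_mem p hpU)]
      · exact h.left z hz
    · rw [hpos]
      rintro a (rfl | ha)
      · rintro ⟨h5, h6⟩
        exact hτ3 _ (h.pos_mem r h.r_mem) ⟨h5, h6.le⟩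
      · exact h.low a ha
    · refine hL.mono_left (fun _ _ => by rw [hpos]) (Finset.Subset.refl _) ?_ ?_ ?_
      · intro u hu w hw _ hm'
        rw [hk _ ?_]
        · exact hm'
        · intro h5
          rcases Sym2.eq_iff.1 h5 with ⟨-, h5⟩ | ⟨h5, -⟩
          · linarith [hltL w hw, h5 ▸ h1]
          · linarith [hltL u hu, h5 ▸ h1]
      · rintro z (rfl | hz)
        · exact Or.inr hτ1.le
        · exact Or.inl hz
      · rintro a (rfl | ha)
        · exact Or.inr hτ1.le
        · exact Or.inl ha.1
    · refine hR.mono_right (fun _ _ => by rw [hpos]) (Finset.Subset.refl _) ?_ ?_ ?_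
      · intro u hu w hw _ hm'
        have hge : ∀ x ∈ y :: R, A.pos p < A.pos x.1 := by
          intro x hx
          rcases List.mem_cons.1 hx with rfl | hx
          · exact h1
          · exact h1.trans (hltR x hx)
        rw [hk _ ?_]
        · exact hm'
        · intro h5
          rcases Sym2.eq_iff.1 h5 with ⟨h5, -⟩ | ⟨-, h5⟩
          · linarith [hge u hu, congrArg A.pos h5]
          · linarith [hge w hw, congrArg A.pos h5]
      · rintro z (rfl | hz)
        · exact Or.inr hτ2.le
        · exact Or.inl hz
      · rintro a (rfl | ha)
        · exact Or.inr ⟨hτ2, le_rfl⟩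
        · exact Or.inl ha.1
    · rw [hpos]; exact hτ1
    · rw [hpos]; exact hτ2.le
    · rw [hpos]
      rintro z (rfl | hz) ⟨h5, h6⟩
      · exact lt_irrefl _ h6
      · exact hτ3 z hz ⟨h5, h6.le⟩
    · rw [hpos]
      rintro a (rfl | ⟨ha, hne⟩)
      · exact Or.inr le_rfl
      have ha1 := (h.up_ends a ha).1
      rcases lt_trichotomy a.1 (A.pos p) with h5 | h5 | h5
      · left; refine ⟨h5, ?_⟩; by_contra h6; exact hcp a ha ⟨h5, not_le.1 h6⟩
      · exact absurd (Prod.ext h5 (h2 a ha h5).2) hne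
      · right; by_contra h6; exact hτ3 _ ha1 ⟨h5, (not_le.1 h6).le⟩

/-- Two new vertices `v` and `f` right of `p`, where `f` is the vertex of the face `v`, `p`, `y.1`;
the new edge to `y.1` is a mountain. -/
lemma HasDiagram.coverRight (h : HasDiagram l r U E (L ++ (p, t) :: y :: R) k) (hv : v ∉ U)
    (hf : f ∉ U) (hvf : v ≠ f) :
    HasDiagram l r (insert f (insert v U))
      (E ∪ {s(v, p), s(v, y.1), s(f, p), s(f, y.1), s(f, v)})
      (L ++ (p, false) :: (v, true) :: y :: R) (k + 1) := by
  obtain ⟨A0, Es, Z0, Up0, Lo0, b, h0, hE, hP, hU, hk⟩ := h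
  obtain ⟨A, Z, Up, Lo, τ, h1, -, -⟩ := h0.exists_openAt hP hU
  have hpU : p ∈ U := hU (p, t) (by simp)
  have hyU : y.1 ∈ U := hU y (by simp)
  have hlt := h1.lt
  have hle := h1.le
  obtain ⟨tv, hv1, hv2⟩ := exists_between hlt
  obtain ⟨tf, hf1, hf2⟩ := exists_between hv2
  have hlp : A.pos l ≤ A.pos p := h1.left _ (h1.pos_mem p hpU)
  have hrZ := h1.gap _ (h1.pos_mem r h1.r_mem)
  have hlo : ∀ a ∈ Lo, (a.1 ≤ A.pos p ∨ τ ≤ a.1) ∧ (a.2 ≤ A.pos p ∨ τ ≤ a.2) := by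
    intro a ha
    have h2 := h1.gap _ (h1.lo_ends a ha).1
    have h3 := h1.gap _ (h1.lo_ends a ha).2
    grind
  have hyc : ∀ a ∈ Up, ¬ (a.1 < A.pos y.1 ∧ A.pos y.1 < a.2) := h1.envR.clear y (by simp)
  obtain ⟨A2, g2, hp2v, hp2, hk2⟩ := h1.toRootedDiagram.vertex hv
    (t := tv) (fun h' => h1.gap tv h' ⟨hv1, hv2⟩) (by linarith)
  have hfU' : f ∉ insert v U := by simp [hf, hvf.symm]
  obtain ⟨A3, g3, hp3f, hp3, hk3⟩ := g2.vertex hfU'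
    (t := tf) (by
      rintro (h' | h')
      · linarith
      · exact h1.gap tf h' ⟨by linarith, hf2⟩) (by rw [hp2 l h1.l_mem]; linarith)
  have hp3U : ∀ x ∈ U, A3.pos x = A.pos x := fun x hx => by
    rw [hp3 x (Finset.mem_insert_of_mem hx), hp2 x hx]
  have hp3v : A3.pos v = tv := by rw [hp3 v (by simp), hp2v]
  have hpU3 : p ∈ insert f (insert v U) := by simp [hpU]
  have hyU3 : y.1 ∈ insert f (insert v U) := by simp [hyU]
  have hvU3 : v ∈ insert f (insert v U) := by simp
  have hfU3 : f ∈ insert f (insert v U) := by simp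
  have hr3 := hp3U r h1.r_mem
  have hpv : p ≠ v := fun h' => hv (h' ▸ hpU)
  have hpf : p ≠ f := fun h' => hf (h' ▸ hpU)
  obtain ⟨A4, g4, hp4, hk4⟩ := g3.pocket hpU3 hvU3 (hp3U p hpU) hp3v hv1
    (by rw [Sym2.eq_swap]; exact h1.notMem_edges hv)
    (fun a ha => by
      have := hlo a ha
      simp only [Interleaved]
      grind) (by rw [hr3]; grind)
  obtain ⟨A5, g5, hp5, hk5⟩ := g4.pocket hvU3 hfU3 (hp4 ▸ hp3v) (hp4 ▸ hp3f) hf1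
    (by
      rw [Sym2.eq_swap (a := v) (b := f), Finset.mem_insert, not_or]
      refine ⟨?_, h1.notMem_edges hf⟩
      simp [hpf.symm, hvf.symm])
    (by
      rintro a (rfl | ha)
      · simp only [Interleaved]
        grind
      have := hlo a ha
      simp only [Interleaved]
      grind) (by rw [hp4, hr3]; grind)
  obtain ⟨A6, g6, hp6, hk6⟩ := g5.pocket hpU3 hfU3 (hp5 ▸ hp4 ▸ hp3U p hpU) (hp5 ▸ hp4 ▸ hp3f)
    (hv1.trans hf1)
    (by
      rw [Sym2.eq_swap (a := p) (b := f), Finset.mem_insert, Finset.mem_insert, not_or, not_or]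
      refine ⟨?_, ?_, h1.notMem_edges hf⟩
      · simp [hpf.symm, hvf.symm, hpv]
      · simp [hpf.symm, hvf.symm])
    (by
      rintro a (rfl | rfl | ha)
      · simp only [Interleaved]
        grind
      · simp only [Interleaved]
        grind
      have := hlo a ha
      simp only [Interleaved]
      grind) (by rw [hp5, hp4, hr3]; grind)
  obtain ⟨A7, g7, hp7, hm7, hk7⟩ := g6.mountain hvU3 hyU3 (hp6 ▸ hp5 ▸ hp4 ▸ hp3v)
    (hp6 ▸ hp5 ▸ hp4 ▸ hp3U y.1 hyU) (by linarith)
    (by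
      intro a ha
      have h2 := h1.sep a ha
      have h3 := hyc a ha
      simp only [Interleaved]
      grind)
  obtain ⟨A8, g8, hp8, hm8, hk8⟩ := g7.mountain hfU3 hyU3 (hp7 ▸ hp6 ▸ hp5 ▸ hp4 ▸ hp3f)
    (hp7 ▸ hp6 ▸ hp5 ▸ hp4 ▸ hp3U y.1 hyU) (by linarith)
    (by
      rintro a (rfl | ha)
      · simp only [Interleaved]
        grind
      have h2 := h1.sep a ha
      have h3 := hyc a ha
      simp only [Interleaved]
      grind)
  have hpos : A8.pos = A3.pos := by rw [hp8, hp7, hp6, hp5, hp4]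
  have hkind : ∀ e ∈ Es, A.kind e = ArcKind.mountain → A8.kind e = ArcKind.mountain := by
    intro e he hm
    refine hk8 e (hk7 e (hk6 e (by simp [he]) (hk5 e (by simp [he]) (hk4 e he ?_))))
    rw [hk3, hk2]
    exact hm
  refine ⟨A8, _, _, _, _, _, g8, ?_, ?_, ?_, ?_⟩
  · rintro e (he | rfl | rfl | rfl | rfl | rfl)
    · simp [hE e he]
    · simp [Sym2.eq_swap]
    · simp
    · simp [Sym2.eq_swap (a := f)]
    · simp
    · simp [Sym2.eq_swap (a := f)]
  · have eR : Envelope A8 (insert s(f, y.1) (insert s(v, y.1) (insert s(p, f) (insert s(v, f)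
        (insert s(p, v) Es))))) (insert tf (insert tv Z)) (insert (tf, A.pos y.1)
        (insert (tv, A.pos y.1) Up)) (y :: R) := by
      refine h1.envR.mono_right ?_ ?_ (fun _ _ _ _ he => hkind _ he) ?_ ?_
      · intro x hx
        rw [hpos, hp3U]
        exact hU x (by simp [List.mem_cons.1 hx])
      · intro e he
        simp [he]
      · rintro z (rfl | rfl | hz)
        · right; linarith
        · right; linarith
        · exact Or.inl hz
      · rintro a (rfl | rfl | ha)
        · right; simp only; constructor <;> linarith
        · right; simp only; constructor <;> linarith
        · exact Or.inl ha
    refine Envelope.glue (Envelope.mono_left h1.envL ?_ ?_ (fun _ _ _ _ he => hkind _ he) ?_ ?_)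
      (eR.cons ?_ ?_) ?_
    · intro x hx
      rw [hpos, hp3U]
      rcases List.mem_append.1 hx with hx | hx
      · exact hU x (by simp [hx])
      · rw [List.mem_singleton.1 hx]; exact hpU
    · intro e he
      simp [he]
    · rintro z (rfl | rfl | hz)
      · right; linarith
      · right; linarith
      · exact Or.inl hz
    · rintro a (rfl | rfl | ha)
      · right; simp only; linarith
      · right; simp only; linarith
      · exact Or.inl ha
    · simp only [EnvelopeRel, hpos, hp3v, hp3U y.1 hyU]
      refine ⟨by linarith, ?_, fun _ => ⟨by simp, hk8 _ hm7⟩, by simp⟩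
      rintro a (rfl | rfl | ha) h2
      · simp only at h2; linarith
      · simp
      · rcases h1.sep a ha with h3 | h3
        · linarith [h3.1]
        · linarith
    · simp only [hpos, hp3v]
      rintro a (rfl | rfl | ha)
      · simp only; rintro ⟨h3, h4⟩; linarith
      · simp
      · have := h1.sep a ha
        grind
    · simp only [EnvelopeRel, hpos, hp3v, hp3U p hpU]
      refine ⟨hv1, ?_, by simp, ?_⟩
      · rintro a (rfl | rfl | ha) h2
        · simp only at h2; linarith
        · simp only at h2; linarith
        · rcases h1.sep a ha with h3 | h3
          · linarith [h3.1]
          · linarith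
      · rintro - z (rfl | rfl | hz) ⟨h2, h3⟩
        · linarith
        · linarith
        · exact h1.gap z hz ⟨h2, by linarith⟩
  · intro x hx
    simp only [List.mem_append, List.mem_cons] at hx
    rcases hx with hx | rfl | rfl | hx
    · simp [hU x (by simp [hx])]
    · exact hpU3
    · exact hvU3
    · simp [hU x (by simp [hx])]
  · simp only [List.countP_append, List.countP_cons] at hk ⊢
    cases t <;> simp at hk ⊢ <;> omega

end Ops

section Ops

variable {V : Type} [DecidableEq V] {l r : V} {A : ArcDiagram V} {U : Finset V}
  {Es : Finset (Sym2 V)} {Z : Set ℝ} {Up Lo : Set (ℝ × ℝ)} {b : ℕ} {L R : List (V × Bool)}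
  {p q v f : V} {y : V × Bool} {t : Bool} {E : Set (Sym2 V)} {k : ℕ}

/-- Two new vertices `f` and `v` inside a pocket from `p` to `y.1`, where `f` is the vertex of the
face `v`, `p`, `y.1`; the new edge to `p` is a mountain. -/
lemma HasDiagram.coverLeft (h : HasDiagram l r U E (L ++ (p, false) :: y :: R) k) (hv : v ∉ U)
    (hf : f ∉ U) (hvf : v ≠ f) :
    HasDiagram l r (insert f (insert v U))
      (E ∪ {s(v, p), s(v, y.1), s(f, p), s(f, y.1), s(f, v)})
      (L ++ (p, true) :: (v, false) :: y :: R) (k + 1) := by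
  obtain ⟨A0, Es, Z0, Up0, Lo0, b, h0, hE, hP, hU, hk⟩ := h
  obtain ⟨A, Z, Up, Lo, τ, h1, hA0, hτ⟩ := h0.exists_openAt hP hU
  have hpU : p ∈ U := hU (p, false) (by simp)
  have hyU : y.1 ∈ U := hU y (by simp)
  have hlt := h1.lt
  obtain rfl : τ = A.pos y.1 := le_antisymm h1.le (hA0 ▸ hτ rfl)
  obtain ⟨tf, hf1, hf2⟩ := exists_between hlt
  obtain ⟨tv, hv1, hv2⟩ := exists_between hf2
  have hlp : A.pos l ≤ A.pos p := h1.left _ (h1.pos_mem p hpU)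
  have hrZ := h1.gap _ (h1.pos_mem r h1.r_mem)
  have hlo : ∀ a ∈ Lo, (a.1 ≤ A.pos p ∨ A.pos y.1 ≤ a.1) ∧ (a.2 ≤ A.pos p ∨ A.pos y.1 ≤ a.2) := by
    intro a ha
    have h2 := h1.gap _ (h1.lo_ends a ha).1
    have h3 := h1.gap _ (h1.lo_ends a ha).2
    grind
  obtain ⟨A2, g2, hp2v, hp2, hk2⟩ := h1.toRootedDiagram.vertex hv
    (t := tv) (fun h' => h1.gap tv h' ⟨by linarith, hv2⟩) (by linarith)
  have hfU' : f ∉ insert v U := by simp [hf, hvf.symm]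
  obtain ⟨A3, g3, hp3f, hp3, hk3⟩ := g2.vertex hfU'
    (t := tf) (by
      rintro (h' | h')
      · linarith
      · exact h1.gap tf h' ⟨by linarith, hf2⟩) (by rw [hp2 l h1.l_mem]; linarith)
  have hp3U : ∀ x ∈ U, A3.pos x = A.pos x := fun x hx => by
    rw [hp3 x (Finset.mem_insert_of_mem hx), hp2 x hx]
  have hp3v : A3.pos v = tv := by rw [hp3 v (by simp), hp2v]
  have hpU3 : p ∈ insert f (insert v U) := by simp [hpU]
  have hyU3 : y.1 ∈ insert f (insert v U) := by simp [hyU]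
  have hvU3 : v ∈ insert f (insert v U) := by simp
  have hfU3 : f ∈ insert f (insert v U) := by simp
  have hr3 := hp3U r h1.r_mem
  have hpv : v ≠ p := fun h' => hv (h' ▸ hpU)
  have hpf : f ≠ p := fun h' => hf (h' ▸ hpU)
  have hyv : v ≠ y.1 := fun h' => hv (h' ▸ hyU)
  have hyf : f ≠ y.1 := fun h' => hf (h' ▸ hyU)
  have hyp : y.1 ≠ p := fun h' => by rw [h'] at hlt; exact lt_irrefl _ hlt
  obtain ⟨A4, g4, hp4, hk4⟩ := g3.pocket hpU3 hfU3 (hp3U p hpU) hp3f hf1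
    (by rw [Sym2.eq_swap]; exact h1.notMem_edges hf)
    (fun a ha => by
      have := hlo a ha
      simp only [Interleaved]
      grind) (by rw [hr3]; grind)
  obtain ⟨A5, g5, hp5, hk5⟩ := g4.pocket hfU3 hvU3 (hp4 ▸ hp3f) (hp4 ▸ hp3v) hv1
    (by
      rw [Finset.mem_insert, not_or]
      refine ⟨?_, h1.notMem_edges hf⟩
      simp [hpf, hvf, hpv])
    (by
      rintro a (rfl | ha)
      · simp only [Interleaved]
        grind
      have := hlo a ha
      simp only [Interleaved]
      grind) (by rw [hp4, hr3]; grind)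
  obtain ⟨A6, g6, hp6, hk6⟩ := g5.pocket hvU3 hyU3 (hp5 ▸ hp4 ▸ hp3v)
    (hp5 ▸ hp4 ▸ hp3U y.1 hyU) hv2
    (by
      rw [Finset.mem_insert, Finset.mem_insert, not_or, not_or]
      refine ⟨?_, ?_, h1.notMem_edges hv⟩
      · simp [hvf, hyf.symm]
      · simp [hpv, hvf])
    (by
      rintro a (rfl | rfl | ha)
      · simp only [Interleaved]
        grind
      · simp only [Interleaved]
        grind
      have := hlo a ha
      simp only [Interleaved]
      grind) (by rw [hp5, hp4, hr3]; grind)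
  obtain ⟨A7, g7, hp7, hk7⟩ := g6.pocket hfU3 hyU3 (hp6 ▸ hp5 ▸ hp4 ▸ hp3f)
    (hp6 ▸ hp5 ▸ hp4 ▸ hp3U y.1 hyU) hf2
    (by
      rw [Finset.mem_insert, Finset.mem_insert, Finset.mem_insert, not_or, not_or, not_or]
      refine ⟨?_, ?_, ?_, h1.notMem_edges hf⟩
      · simp [hvf.symm, hyf]
      · simp [hvf.symm, hyv.symm]
      · simp [hpf, hyp])
    (by
      rintro a (rfl | rfl | rfl | ha)
      · simp only [Interleaved]
        grind
      · simp only [Interleaved]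
        grind
      · simp only [Interleaved]
        grind
      have := hlo a ha
      simp only [Interleaved]
      grind) (by rw [hp6, hp5, hp4, hr3]; grind)
  obtain ⟨A8, g8, hp8, hm8, hk8⟩ := g7.mountain hpU3 hvU3 (hp7 ▸ hp6 ▸ hp5 ▸ hp4 ▸ hp3U p hpU)
    (hp7 ▸ hp6 ▸ hp5 ▸ hp4 ▸ hp3v) (by linarith)
    (by
      intro a ha
      have h2 := h1.sep a ha
      simp only [Interleaved]
      grind)
  have hpos : A8.pos = A3.pos := by rw [hp8, hp7, hp6, hp5, hp4]
  have hkind : ∀ e ∈ Es, A.kind e = ArcKind.mountain → A8.kind e = ArcKind.mountain := by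
    intro e he hm
    refine hk8 e (hk7 e (by simp [he]) (hk6 e (by simp [he]) (hk5 e (by simp [he])
      (hk4 e he ?_))))
    rw [hk3, hk2]
    exact hm
  refine ⟨A8, _, _, _, _, _, g8, ?_, ?_, ?_, ?_⟩
  · rintro e (he | rfl | rfl | rfl | rfl | rfl)
    · simp [hE e he]
    · simp [Sym2.eq_swap]
    · simp
    · simp [Sym2.eq_swap (a := f)]
    · simp
    · simp
  · have eR : Envelope A8 (insert s(p, v) (insert s(f, y.1) (insert s(v, y.1) (insert s(f, v)
        (insert s(p, f) Es))))) (insert tf (insert tv Z)) (insert (A.pos p, tv) Up) (y :: R) := by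
      refine h1.envR.mono_right ?_ ?_ (fun _ _ _ _ he => hkind _ he) ?_ ?_
      · intro x hx
        rw [hpos, hp3U]
        exact hU x (by simp [List.mem_cons.1 hx])
      · intro e he
        simp [he]
      · rintro z (rfl | rfl | hz)
        · right; linarith
        · right; linarith
        · exact Or.inl hz
      · rintro a (rfl | ha)
        · right; simp only; constructor <;> linarith
        · exact Or.inl ha
    refine Envelope.glue (Envelope.mono_left h1.envL ?_ ?_ (fun _ _ _ _ he => hkind _ he) ?_ ?_)
      (eR.cons ?_ ?_) ?_
    · intro x hx
      rw [hpos, hp3U]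
      rcases List.mem_append.1 hx with hx | hx
      · exact hU x (by simp [hx])
      · rw [List.mem_singleton.1 hx]; exact hpU
    · intro e he
      simp [he]
    · rintro z (rfl | rfl | hz)
      · right; linarith
      · right; linarith
      · exact Or.inl hz
    · rintro a (rfl | ha)
      · right; simp only; linarith
      · exact Or.inl ha
    · simp only [EnvelopeRel, hpos, hp3v, hp3U y.1 hyU]
      refine ⟨by linarith, ?_, by simp, ?_⟩
      · rintro a (rfl | ha) h2
        · simp only at h2; linarith
        · rcases h1.sep a ha with h3 | h3
          · linarith [h3.1]
          · linarith
      · rintro - z (rfl | rfl | hz) ⟨h2, h3⟩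
        · linarith
        · linarith
        · exact h1.gap z hz ⟨by linarith, by linarith⟩
    · simp only [hpos, hp3v]
      rintro a (rfl | ha)
      · simp
      · have := h1.sep a ha
        grind
    · simp only [EnvelopeRel, hpos, hp3v, hp3U p hpU]
      refine ⟨by linarith, ?_, fun _ => ⟨by simp, hm8⟩, by simp⟩
      rintro a (rfl | ha) h2
      · simp
      · rcases h1.sep a ha with h3 | h3
        · linarith [h3.1]
        · linarith
  · intro x hx
    simp only [List.mem_append, List.mem_cons] at hx
    rcases hx with hx | rfl | rfl | hx
    · simp [hU x (by simp [hx])]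
    · exact hpU3
    · exact hvU3
    · simp [hU x (by simp [hx])]
  · simp only [List.countP_append, List.countP_cons] at hk ⊢
    simp at hk ⊢
    omega

/-- The triangle `p`, `q`, `y.1` above a mountain from `q` to `y.1` is closed by a mountain. -/
lemma HasDiagram.closeFace (h : HasDiagram l r U E (L ++ (p, t) :: (q, true) :: y :: R) k)
    (hf : f ∉ U) :
    HasDiagram l r (insert f U) (E ∪ {s(p, y.1), s(f, p), s(f, q), s(f, y.1)})
      (L ++ (p, true) :: y :: R) k := by
  obtain ⟨A0, Es, Z0, Up0, Lo0, b, h0, hE, hP, hU, hk⟩ := h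
  obtain ⟨A, Z, Up, Lo, τ, h1, -, -⟩ := h0.exists_openAt hP hU
  have hpU : p ∈ U := hU (p, t) (by simp)
  have hqU : q ∈ U := hU (q, true) (by simp)
  have hyU : y.1 ∈ U := hU y (by simp)
  have hlt := h1.lt
  have hle := h1.le
  simp only at hle
  have hqy : A.pos q < A.pos y.1 := h1.envR.lt_of_cons y (by simp)
  obtain ⟨tf, hf1, hf2⟩ := exists_between hlt
  have hlp : A.pos l ≤ A.pos p := h1.left _ (h1.pos_mem p hpU)
  have hrZ := h1.gap _ (h1.pos_mem r h1.r_mem)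
  have hqc : ∀ a ∈ Up, ¬ (a.1 < A.pos q ∧ A.pos q < a.2) := h1.envR.clear (q, true) (by simp)
  have hyc : ∀ a ∈ Up, ¬ (a.1 < A.pos y.1 ∧ A.pos y.1 < a.2) := h1.envR.clear y (by simp)
  obtain ⟨A3, g3, hp3f, hp3U, hk3⟩ := h1.toRootedDiagram.vertex hf
    (t := tf) (fun h' => h1.gap tf h' ⟨hf1, hf2⟩) (by linarith)
  have hpU3 : p ∈ insert f U := by simp [hpU]
  have hqU3 : q ∈ insert f U := by simp [hqU]
  have hyU3 : y.1 ∈ insert f U := by simp [hyU]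
  have hfU3 : f ∈ insert f U := by simp
  have hr3 := hp3U r h1.r_mem
  obtain ⟨A4, g4, hp4, hk4⟩ := g3.pocket hpU3 hfU3 (hp3U p hpU) hp3f hf1
    (by rw [Sym2.eq_swap]; exact h1.notMem_edges hf)
    (fun a ha => by
      have h2 := h1.gap _ (h1.lo_ends a ha).1
      have h3 := h1.gap _ (h1.lo_ends a ha).2
      simp only [Interleaved]
      grind) (by rw [hr3]; grind)
  obtain ⟨A5, g5, hp5, hm5, hk5⟩ := g4.mountain hfU3 hqU3 (hp4 ▸ hp3f) (hp4 ▸ hp3U q hqU)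
    (by linarith)
    (by
      intro a ha
      have h2 := h1.sep a ha
      have h3 := hqc a ha
      simp only [Interleaved]
      grind)
  obtain ⟨A6, g6, hp6, hm6, hk6⟩ := g5.mountain hfU3 hyU3 (hp5 ▸ hp4 ▸ hp3f)
    (hp5 ▸ hp4 ▸ hp3U y.1 hyU) (by linarith)
    (by
      rintro a (rfl | ha)
      · simp only [Interleaved]
        grind
      have h2 := h1.sep a ha
      have h3 := hyc a ha
      simp only [Interleaved]
      grind)
  obtain ⟨A8, g8, hp8, hm8, hk8⟩ := g6.mountain hpU3 hyU3 (hp6 ▸ hp5 ▸ hp4 ▸ hp3U p hpU)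
    (hp6 ▸ hp5 ▸ hp4 ▸ hp3U y.1 hyU) (by linarith)
    (by
      rintro a (rfl | rfl | ha)
      · simp only [Interleaved]
        grind
      · simp only [Interleaved]
        grind
      have h2 := h1.sep a ha
      have h3 := hyc a ha
      simp only [Interleaved]
      grind)
  have hpos : A8.pos = A3.pos := by rw [hp8, hp6, hp5, hp4]
  have hkind : ∀ e ∈ Es, A.kind e = ArcKind.mountain → A8.kind e = ArcKind.mountain := by
    intro e he hm
    refine hk8 e (hk6 e (hk5 e (hk4 e he ?_)))
    rw [hk3]
    exact hm
  refine ⟨A8, _, _, _, _, _, g8, ?_, ?_, ?_, ?_⟩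
  · rintro e (he | rfl | rfl | rfl | rfl)
    · simp [hE e he]
    · simp
    · simp [Sym2.eq_swap (a := f) (b := p)]
    · simp
    · simp
  · refine Envelope.glue (Envelope.mono_left h1.envL ?_ ?_ (fun _ _ _ _ he => hkind _ he) ?_ ?_)
      (h1.envR.tail.mono_right ?_ ?_ (fun _ _ _ _ he => hkind _ he) ?_ ?_) ?_
    · intro x hx
      rw [hpos, hp3U]
      rcases List.mem_append.1 hx with hx | hx
      · exact hU x (by simp [hx])
      · rw [List.mem_singleton.1 hx]; exact hpU
    · intro e he
      simp [he]
    · rintro z (rfl | hz)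
      · right; linarith
      · exact Or.inl hz
    · rintro a (rfl | rfl | rfl | ha)
      · right; simp only; linarith
      · right; simp only; linarith
      · right; simp only; linarith
      · exact Or.inl ha
    · intro x hx
      rw [hpos, hp3U]
      exact hU x (by simp [List.mem_cons.1 hx])
    · intro e he
      simp [he]
    · rintro z (rfl | hz)
      · right; linarith
      · exact Or.inl hz
    · rintro a (rfl | rfl | rfl | ha)
      · right; simp only; constructor <;> linarith
      · right; simp only; constructor <;> linarith
      · right; simp only; constructor <;> linarith
      · exact Or.inl ha
    · simp only [EnvelopeRel, hpos, hp3U y.1 hyU, hp3U p hpU]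
      refine ⟨by linarith, ?_, fun _ => ⟨by simp, hm8⟩, by simp⟩
      rintro a (rfl | rfl | rfl | ha) h2
      · simp
      · simp only at h2; linarith
      · simp only at h2; linarith
      · rcases h1.sep a ha with h3 | h3
        · linarith [h3.1]
        · linarith
  · intro x hx
    simp only [List.mem_append, List.mem_cons] at hx
    rcases hx with hx | rfl | hx
    · simp [hU x (by simp [hx])]
    · exact hpU3
    · simp [hU x (by simp [hx])]
  · simp only [List.countP_append, List.countP_cons] at hk ⊢
    cases t <;> simp at hk ⊢ <;> omega

lemma RootedDiagram.vertexLeft (h : RootedDiagram l r A U Es Z Up Lo b) {c : V} (hc : c ∉ U) :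
    ∃ A' t, RootedDiagram c r A' (insert c U) (insert s(c, r) Es) (insert t Z) Up
        (insert (t, A.pos r) Lo) b ∧ A'.pos c = t ∧ (∀ y ∈ U, A'.pos y = A.pos y) ∧
      (∀ z ∈ Z, t < z) ∧ ∀ e ∈ Es, A.kind e = ArcKind.mountain → A'.kind e = ArcKind.mountain := by
  obtain ⟨t, ht⟩ : ∃ t, ∀ z ∈ Z, t < z :=
    ⟨A.pos l - 1, fun z hz => by linarith [h.left z hz]⟩
  have htZ : t ∉ Z := fun h' => lt_irrefl _ (ht t h')
  obtain ⟨A1, h1, h2, h3, h4⟩ := h.addVertex hc htZ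
  have g1 : RootedDiagram c r A1 (insert c U) Es (insert t Z) Up Lo b := by
    refine ⟨h1, Finset.mem_insert_self _ _, Finset.mem_insert_of_mem h.r_mem, ?_, ?_⟩
    · rw [h2]
      rintro z (rfl | hz)
      · exact le_rfl
      · exact (ht z hz).le
    · rw [h3 r h.r_mem]
      exact h.low
  obtain ⟨A2, g2, hp2, hk2⟩ := g1.pocket (Finset.mem_insert_self _ _)
    (Finset.mem_insert_of_mem h.r_mem) h2 (h3 r h.r_mem) (ht _ (h.pos_mem r h.r_mem))
    (h.notMem_edges hc)
    (fun a ha => ⟨fun h5 => absurd h5.1 (ht _ (h.lo_ends a ha).1).not_gt,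
      fun h5 => h.low a ha ⟨h5.2.1, h5.2.2⟩⟩)
    (fun h5 => by rw [h3 r h.r_mem] at h5; exact lt_irrefl _ h5.2)
  refine ⟨A2, t, g2, by rw [hp2, h2], fun y hy => by rw [hp2, h3 y hy], ht, ?_⟩
  intro e he hm
  exact hk2 e he (by rw [h4]; exact hm)

/-- A new leftmost vertex on the envelope. -/
lemma HasDiagram.addLeft {c : V} (h : HasDiagram r r U E ((r, t) :: R) k) (hc : c ∉ U) :
    HasDiagram c r (insert c U) (E ∪ {s(c, r)}) ((c, false) :: (r, t) :: R) k := by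
  obtain ⟨A, Es, Z, Up, Lo, b, h0, hE, hP, hU, hk⟩ := h
  obtain ⟨A', τ, g, hpc, hpos, hτ, hkind⟩ := h0.vertexLeft hc
  have hpr := hpos r h0.r_mem
  have hrZ := hτ _ (h0.pos_mem r h0.r_mem)
  refine ⟨A', _, _, _, _, _, g, ?_, ?_, ?_, ?_⟩
  · rintro e (he | rfl)
    · simp [hE e he]
    · simp
  · refine (hP.mono_right (fun x hx => hpos _ (hU x hx)) (Finset.subset_insert _ _)
      (fun _ _ _ _ he => hkind _ he) ?_ (fun a ha => Or.inl ha)).cons ?_ ?_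
    · rintro z (rfl | hz)
      · exact Or.inr hrZ.le
      · exact Or.inl hz
    · simp only [EnvelopeRel, hpc, hpr]
      refine ⟨hrZ, ?_, by simp, ?_⟩
      · intro a ha h1
        exact absurd (hτ _ (h0.up_ends a ha).1) (by rw [h1]; exact lt_irrefl _)
      · rintro - z (rfl | hz) h1
        · exact lt_irrefl _ h1.1
        · linarith [h0.left z hz, h1.2]
    · simp only [hpc]
      intro a ha h1
      exact absurd h1.1 (hτ _ (h0.up_ends a ha).1).not_gt
  · intro x hx
    rcases List.mem_cons.1 hx with rfl | hx
    · exact Finset.mem_insert_self _ _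
    · exact Finset.mem_insert_of_mem (hU x hx)
  · simpa using hk

/-- A vertex in the outer face, adjacent to the root and to two vertices of the envelope. -/
lemma HasDiagram.addOuter {o : V} {P : List (V × Bool)} {x y : V × Bool}
    (h : HasDiagram l r U E P k) (ho : o ∉ U) (hx : x ∈ P) (hy : y ∈ P) :
    HasDiagram o r (insert o U) (E ∪ {s(o, r), s(o, x.1), s(o, y.1)}) [] (k - P.countP (·.2)) := by
  obtain ⟨A, Es, Z, Up, Lo, b, h0, hE, hP, hU, hk⟩ := h
  obtain ⟨A', τ, g, hpc, hpos, hτ, -⟩ := h0.vertexLeft ho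
  have hoU : o ∈ insert o U := Finset.mem_insert_self _ _
  obtain ⟨A2, g2, hp2, -⟩ := g.mountain hoU (Finset.mem_insert_of_mem (hU x hx)) hpc
    (hpos _ (hU x hx)) (hτ _ (h0.pos_mem _ (hU x hx)))
    (fun a ha => ⟨fun h5 => absurd h5.1 (hτ _ (h0.up_ends a ha).1).not_gt,
      fun h5 => hP.clear x hx a ha ⟨h5.2.1, h5.2.2⟩⟩)
  obtain ⟨A3, g3, hp3, -⟩ := g2.mountain hoU (Finset.mem_insert_of_mem (hU y hy)) (hp2 ▸ hpc)
    (hp2 ▸ hpos _ (hU y hy)) (hτ _ (h0.pos_mem _ (hU y hy)))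
    (by
      rintro a (rfl | ha)
      · exact ⟨fun h5 => lt_irrefl _ h5.1, fun h5 => lt_irrefl _ h5.1⟩
      · exact ⟨fun h5 => absurd h5.1 (hτ _ (h0.up_ends a ha).1).not_gt,
          fun h5 => hP.clear y hy a ha ⟨h5.2.1, h5.2.2⟩⟩)
  refine ⟨A3, _, _, _, _, _, g3, ?_, ⟨List.isChain_nil, by simp⟩, by simp, ?_⟩
  · rintro e (he | rfl | rfl | rfl)
    · simp [hE e he]
    · simp
    · simp
    · simp
  · simp
    omega

lemma HasDiagram.mono {E' : Set (Sym2 V)} {P : List (V × Bool)} (h : HasDiagram l r U E P k)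
    (hE : E' ⊆ E) : HasDiagram l r U E' P k := by
  obtain ⟨A, Es, Z, Up, Lo, b, h0, h1, h2⟩ := h
  exact ⟨A, Es, Z, Up, Lo, b, h0, fun e he => h1 e (hE he), h2⟩

/-- The diagram of a single edge. -/
lemma HasDiagram.base {v1 v2 : V} (h : v1 ≠ v2) :
    HasDiagram v1 v1 {v2, v1} {s(v1, v2)} [(v1, false), (v2, false)] 0 := by
  have h0 : RootedDiagram v1 v1 ⟨fun _ => 0, fun _ => ArcKind.mountain, fun _ => 0, fun _ => 0⟩
      {v1} ∅ {0} ∅ ∅ 0 := by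
    refine ⟨⟨?_, ?_, ?_, Set.finite_singleton _, ?_, ?_, ?_, ?_, ?_, ?_, ?_, ?_, ?_⟩, ?_, ?_, ?_,
      ?_⟩ <;> simp
  obtain ⟨A1, g1, hp1, hp1', -⟩ := h0.vertex (x := v2) (t := 1) (by simpa using h.symm) (by simp)
    (by simp)
  have hp0 : A1.pos v1 = 0 := hp1' v1 (by simp)
  obtain ⟨A2, g2, hp2, -⟩ := g1.pocket (x := v1) (y := v2) (by simp) (by simp) hp0 hp1 one_pos
    (by simp) (by simp) (by rw [hp0]; simp)
  refine ⟨A2, _, _, _, _, _, g2, by simp, ⟨?_, by simp⟩, by simp, by simp⟩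
  rw [List.isChain_pair]
  simp only [EnvelopeRel, hp2, hp0, hp1]
  refine ⟨one_pos, by simp, by simp, ?_⟩
  rintro - z (rfl | rfl)
  · simp
  · simp

end Ops

lemma Fan.split_at {V ι : Type} [DecidableEq V] {N : ι → Finset V} {v p : V} {L R : List V}
    {gs : List ι} (h : Fan N v (L ++ p :: R) gs) :
    ∃ gs₁ gs₂, gs = gs₁ ++ gs₂ ∧ Fan N v (L ++ [p]) gs₁ ∧ Fan N v (p :: R) gs₂ := by
  induction L generalizing gs with
  | nil => exact ⟨[], gs, rfl, .single p, h⟩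
  | cons a L ih =>
    cases L with
    | nil =>
      cases h with
      | @cons _ _ _ g gs hN h => exact ⟨[g], gs, rfl, .cons hN (.single p), h⟩
    | cons b L =>
      cases h with
      | @cons _ _ _ g gs hN h =>
        obtain ⟨gs₁, gs₂, rfl, h1, h2⟩ := ih h
        exact ⟨g :: gs₁, gs₂, rfl, .cons hN h1, h2⟩

/-- The edges from `v` to the vertices of `P`. -/
def spokes {V : Type} (v : V) (P : List V) : Set (Sym2 V) := {e | ∃ z ∈ P, e = s(v, z)}

/-- The edges from the face vertices `gs` to the vertices of their faces. -/
def faceEdges {V : Type} (N : V → Finset V) (gs : List V) : Set (Sym2 V) :=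
  {e | ∃ g ∈ gs, ∃ z ∈ N g, e = s(g, z)}

section FanOps

variable {V : Type} [DecidableEq V] {N : V → Finset V} {l r : V} {U : Finset V}
  {E : Set (Sym2 V)} {k : ℕ} {L R : List (V × Bool)} {p q v : V} {t tq : Bool} {gs : List V}

lemma HasDiagram.closeRight {M : List (V × Bool)}
    (h : HasDiagram l r U E (L ++ (v, t) :: (M ++ (q, tq) :: R)) k)
    (hM : ∀ x ∈ M, x.2 = true) (hF : Fan N v (M.map Prod.fst ++ [q]) gs) (hgs : gs.Nodup)
    (hgU : ∀ g ∈ gs, g ∉ U) (hE : ∀ z ∈ (M.map Prod.fst ++ [q]).head?, s(v, z) ∈ E) :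
    HasDiagram l r (U ∪ gs.toFinset) (E ∪ spokes v (M.map Prod.fst ++ [q]) ∪ faceEdges N gs)
      (L ++ (v, t || !M.isEmpty) :: (q, tq) :: R) k := by
  induction M generalizing t U E gs with
  | nil =>
    cases hF
    simp only [List.map_nil, List.nil_append, List.head?_cons, Option.mem_some_iff,
      forall_eq'] at hE
    have h1 : HasDiagram l r (U ∪ ([] : List V).toFinset) E
      (L ++ (v, t || !(List.isEmpty ([] : List (V × Bool)))) :: (q, tq) :: R) k := by simpa using h
    refine h1.mono ?_
    rintro e ((he | ⟨z, hz, rfl⟩) | ⟨g, hg, -⟩)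
    · exact he
    · simp only [List.map_nil, List.nil_append, List.mem_singleton] at hz
      exact hz ▸ hE
    · cases hg
  | cons m M ih =>
    obtain ⟨m, tm⟩ := m
    obtain rfl : tm = true := hM _ (List.mem_cons_self ..)
    obtain ⟨y, M', hy⟩ : ∃ y M', M ++ (q, tq) :: R = y :: M' := by
      cases M <;> simp
    obtain ⟨Y, hY⟩ : ∃ Y, M.map Prod.fst ++ [q] = y.1 :: Y := by
      cases M <;> simp at hy ⊢ <;> simp [← hy.1]
    rw [List.cons_append, hy] at h
    rw [List.map_cons, List.cons_append, hY] at hF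
    cases hF with
    | @cons _ _ _ g gs hN hF =>
      have hgU' := hgU g (by simp)
      have h1 := h.closeFace (f := g) hgU'
      rw [← hy] at h1
      rw [List.nodup_cons] at hgs
      have h2 := ih h1 (fun x hx => hM x (List.mem_cons_of_mem _ hx)) (hY ▸ hF) hgs.2 (by
        intro k hk
        rw [Finset.mem_insert, not_or]
        exact ⟨fun h' => hgs.1 (h' ▸ hk), hgU k (List.mem_cons_of_mem _ hk)⟩) (by
        rw [hY]
        simp)
      have hset : insert g U ∪ gs.toFinset = U ∪ (g :: gs).toFinset := by
        ext x
        simp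
      rw [hset] at h2
      have hflag : (t || !((m, true) :: M).isEmpty) = (true || !M.isEmpty) := by simp
      rw [hflag]
      refine h2.mono ?_
      rintro e ((he | ⟨z, hz, rfl⟩) | ⟨k, hk, z, hz, rfl⟩)
      · exact Or.inl (Or.inl (Or.inl he))
      · rw [List.map_cons, List.cons_append, List.mem_cons] at hz
        rcases hz with rfl | hz
        · exact Or.inl (Or.inl (Or.inl (hE _ (by simp))))
        · exact Or.inl (Or.inr ⟨z, hz, rfl⟩)
      · rcases List.mem_cons.1 hk with rfl | hk
        · rw [hN] at hz
          simp only [Finset.mem_insert, Finset.mem_singleton] at hz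
          refine Or.inl (Or.inl (Or.inr ?_))
          rcases hz with rfl | rfl | rfl <;> simp
        · exact Or.inr ⟨k, hk, z, hz, rfl⟩

lemma HasDiagram.closeLeft {M : List (V × Bool)} {p₀ : V}
    (h : HasDiagram l r U E (L ++ (M ++ (p, true) :: (v, t) :: R)) k)
    (hF : Fan N v (M.map Prod.fst ++ [p]) gs) (hgs : gs.Nodup)
    (hgU : ∀ g ∈ gs, g ∉ U) (hE : s(v, p) ∈ E)
    (hp₀ : (M.map Prod.fst ++ [p]).head? = some p₀) :
    HasDiagram l r (U ∪ gs.toFinset) (E ∪ spokes v (M.map Prod.fst ++ [p]) ∪ faceEdges N gs)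
      (L ++ (p₀, true) :: (v, t) :: R) k := by
  induction M using List.reverseRecOn generalizing p U E gs with
  | nil =>
    cases hF
    simp only [List.map_nil, List.nil_append, List.head?_cons, Option.some.injEq] at hp₀
    subst hp₀
    have h1 : HasDiagram l r (U ∪ ([] : List V).toFinset) E
      (L ++ (p, true) :: (v, t) :: R) k := by simpa using h
    refine h1.mono ?_
    rintro e ((he | ⟨z, hz, rfl⟩) | ⟨g, hg, -⟩)
    · exact he
    · simp only [List.map_nil, List.nil_append, List.mem_singleton] at hz
      exact hz ▸ hE
    · cases hg
  | append_singleton M x ih =>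
    obtain ⟨x, tx⟩ := x
    have hmap : List.map Prod.fst (M ++ [(x, tx)]) ++ [p] = M.map Prod.fst ++ x :: [p] := by simp
    rw [hmap] at hF hp₀
    obtain ⟨gs₁, gs₂, rfl, h1, h2⟩ := hF.split_at
    cases h2 with
    | @cons _ _ _ g _ hN h2 =>
      cases h2
      have h0 : HasDiagram l r U E ((L ++ M) ++ (x, tx) :: (p, true) :: (v, t) :: R) k := by
        simpa using h
      have h3 := h0.closeFace (f := g) (hgU g (by simp))
      rw [List.append_assoc] at h3
      rw [List.nodup_append] at hgs
      have h4 := ih h3 h1 hgs.1 (by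
        intro k hk
        rw [Finset.mem_insert, not_or]
        exact ⟨hgs.2.2 k hk g (by simp), hgU k (by simp [hk])⟩)
        (by simp [Sym2.eq_swap])
        (by cases M <;> simpa using hp₀)
      have hset : insert g U ∪ gs₁.toFinset = U ∪ (gs₁ ++ [g]).toFinset := by
        ext x
        simp only [Finset.mem_union, Finset.mem_insert, List.mem_toFinset, List.mem_append,
          List.mem_singleton]
        tauto
      rw [hset] at h4
      refine h4.mono ?_
      rw [hmap]
      rintro e ((he | ⟨z, hz, rfl⟩) | ⟨k, hk, z, hz, rfl⟩)
      · exact Or.inl (Or.inl (Or.inl he))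
      · rw [List.mem_append, List.mem_cons, List.mem_singleton] at hz
        rcases hz with hz | rfl | rfl
        · exact Or.inl (Or.inr ⟨z, by simp [hz], rfl⟩)
        · exact Or.inl (Or.inr ⟨z, by simp, rfl⟩)
        · exact Or.inl (Or.inl (Or.inl hE))
      · rcases List.mem_append.1 hk with hk | hk
        · exact Or.inr ⟨k, hk, z, hz, rfl⟩
        · obtain rfl := List.mem_singleton.1 hk
          rw [hN] at hz
          simp only [Finset.mem_insert, Finset.mem_singleton] at hz
          refine Or.inl (Or.inl (Or.inr ?_))
          rcases hz with rfl | rfl | rfl <;> simp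

/-- A new vertex over a subpath on which all edges but possibly the first are mountains. -/
lemma HasDiagram.stepRight {M : List (V × Bool)}
    (h : HasDiagram l r U E (L ++ (p, t) :: (M ++ (q, tq) :: R)) k)
    (hM : ∀ x ∈ M, x.2 = true) (hF : Fan N v (p :: (M.map Prod.fst ++ [q])) gs) (hgs : gs.Nodup)
    (hgU : ∀ g ∈ gs, g ∉ U) (hv : v ∉ U) (hvg : v ∉ gs) :
    HasDiagram l r (insert v U ∪ gs.toFinset)
      (E ∪ spokes v (p :: (M.map Prod.fst ++ [q])) ∪ faceEdges N gs)
      (L ++ (p, false) :: (v, true) :: (q, tq) :: R) (k + 1) := by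
  obtain ⟨y, M', hy⟩ : ∃ y M', M ++ (q, tq) :: R = y :: M' := by
    cases M <;> simp
  obtain ⟨Y, hY⟩ : ∃ Y, M.map Prod.fst ++ [q] = y.1 :: Y := by
    cases M <;> simp at hy ⊢ <;> simp [← hy.1]
  rw [hy] at h
  rw [hY] at hF
  cases hF with
  | @cons _ _ _ g gs hN hF =>
    rw [List.nodup_cons] at hgs
    rw [List.mem_cons, not_or] at hvg
    have h1 := h.coverRight hv (hgU g (by simp)) hvg.1
    rw [← hy] at h1
    have h1' : HasDiagram l r (insert g (insert v U))
      (E ∪ {s(v, p), s(v, y.1), s(g, p), s(g, y.1), s(g, v)})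
      ((L ++ [(p, false)]) ++ (v, true) :: (M ++ (q, tq) :: R)) (k + 1) := by simpa using h1
    have h2 := h1'.closeRight hM (hY ▸ hF) hgs.2 (by
      intro k hk
      rw [Finset.mem_insert, Finset.mem_insert, not_or, not_or]
      exact ⟨fun h' => hgs.1 (h' ▸ hk), fun h' => hvg.2 (h' ▸ hk),
        hgU k (List.mem_cons_of_mem _ hk)⟩) (by rw [hY]; simp)
    have hset : insert g (insert v U) ∪ gs.toFinset = insert v U ∪ (g :: gs).toFinset := by
      ext x
      simp only [Finset.mem_union, Finset.mem_insert, List.mem_toFinset, List.mem_cons]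
      tauto
    rw [hset, Bool.true_or, List.append_assoc] at h2
    refine h2.mono ?_
    rintro e ((he | ⟨z, hz, rfl⟩) | ⟨k, hk, z, hz, rfl⟩)
    · exact Or.inl (Or.inl (Or.inl he))
    · rcases List.mem_cons.1 hz with rfl | hz
      · exact Or.inl (Or.inl (Or.inr (by simp)))
      · exact Or.inl (Or.inr ⟨z, hz, rfl⟩)
    · rcases List.mem_cons.1 hk with rfl | hk
      · rw [hN] at hz
        simp only [Finset.mem_insert, Finset.mem_singleton] at hz
        refine Or.inl (Or.inl (Or.inr ?_))
        rcases hz with rfl | rfl | rfl <;> simp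
      · exact Or.inr ⟨k, hk, z, hz, rfl⟩

/-- A new vertex over a subpath whose rightmost pocket starts at `p`. -/
lemma HasDiagram.stepLeft {M₁ M₂ : List (V × Bool)} {p₀ : V}
    (h : HasDiagram l r U E (L ++ (M₁ ++ (p, false) :: (M₂ ++ (q, tq) :: R))) k)
    (hM : ∀ x ∈ M₂, x.2 = true)
    (hF : Fan N v (M₁.map Prod.fst ++ p :: (M₂.map Prod.fst ++ [q])) gs) (hgs : gs.Nodup)
    (hgU : ∀ g ∈ gs, g ∉ U) (hv : v ∉ U) (hvg : v ∉ gs)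
    (hp₀ : (M₁.map Prod.fst ++ [p]).head? = some p₀) :
    HasDiagram l r (insert v U ∪ gs.toFinset)
      (E ∪ spokes v (M₁.map Prod.fst ++ p :: (M₂.map Prod.fst ++ [q])) ∪ faceEdges N gs)
      (L ++ (p₀, true) :: (v, !M₂.isEmpty) :: (q, tq) :: R) (k + 1) := by
  obtain ⟨gs₁, gs₂, rfl, hF₁, hF₂⟩ := hF.split_at
  obtain ⟨y, M', hy⟩ : ∃ y M', M₂ ++ (q, tq) :: R = y :: M' := by
    cases M₂ <;> simp
  obtain ⟨Y, hY⟩ : ∃ Y, M₂.map Prod.fst ++ [q] = y.1 :: Y := by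
    cases M₂ <;> simp at hy ⊢ <;> simp [← hy.1]
  rw [hy] at h
  rw [hY] at hF₂
  cases hF₂ with
  | @cons _ _ _ g gs hN hF₃ =>
    rw [List.nodup_append, List.nodup_cons] at hgs
    obtain ⟨hgs₁, ⟨hg, hgs₂⟩, hgs₁₂⟩ := hgs
    rw [List.mem_append, List.mem_cons, not_or, not_or] at hvg
    have h0 : HasDiagram l r U E ((L ++ M₁) ++ (p, false) :: y :: M') k := by simpa using h
    have h1 := h0.coverLeft hv (hgU g (by simp)) hvg.2.1
    rw [← hy] at h1
    have h1' : HasDiagram l r (insert g (insert v U))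
      (E ∪ {s(v, p), s(v, y.1), s(g, p), s(g, y.1), s(g, v)})
      (((L ++ M₁) ++ [(p, true)]) ++ (v, false) :: (M₂ ++ (q, tq) :: R)) (k + 1) := by
      simpa using h1
    have h2 := h1'.closeRight hM (hY ▸ hF₃) hgs₂ (by
      intro k hk
      rw [Finset.mem_insert, Finset.mem_insert, not_or, not_or]
      exact ⟨fun h' => hg (h' ▸ hk), fun h' => hvg.2.2 (h' ▸ hk), hgU k (by simp [hk])⟩)
      (by rw [hY]; simp)
    rw [Bool.false_or, List.append_assoc, List.append_assoc] at h2
    have h3 := h2.closeLeft hF₁ hgs₁ (by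
      intro k hk
      rw [Finset.mem_union, Finset.mem_insert, Finset.mem_insert, List.mem_toFinset, not_or, not_or,
        not_or]
      exact ⟨⟨hgs₁₂ k hk g (by simp), fun h' => hvg.1 (h' ▸ hk), hgU k (by simp [hk])⟩,
        fun h' => hgs₁₂ k hk k (by simp [h']) rfl⟩) (by simp) hp₀
    have hset : insert g (insert v U) ∪ gs.toFinset ∪ gs₁.toFinset =
        insert v U ∪ (gs₁ ++ g :: gs).toFinset := by
      ext x
      simp only [Finset.mem_union, Finset.mem_insert, List.mem_toFinset, List.mem_cons,
        List.mem_append]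
      tauto
    rw [hset] at h3
    refine h3.mono ?_
    rintro e ((he | ⟨z, hz, rfl⟩) | ⟨k, hk, z, hz, rfl⟩)
    · exact Or.inl (Or.inl (Or.inl (Or.inl (Or.inl he))))
    · rw [List.mem_append, List.mem_cons] at hz
      rcases hz with hz | rfl | hz
      · exact Or.inl (Or.inr ⟨z, by simp [hz], rfl⟩)
      · exact Or.inl (Or.inr ⟨z, by simp, rfl⟩)
      · exact Or.inl (Or.inl (Or.inl (Or.inr ⟨z, hz, rfl⟩)))
    · rw [List.mem_append, List.mem_cons] at hk
      rcases hk with hk | rfl | hk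
      · exact Or.inr ⟨k, hk, z, hz, rfl⟩
      · rw [hN] at hz
        simp only [Finset.mem_insert, Finset.mem_singleton] at hz
        refine Or.inl (Or.inl (Or.inl (Or.inl (Or.inr ?_))))
        rcases hz with rfl | rfl | rfl <;> simp
      · exact Or.inl (Or.inl (Or.inr ⟨k, hk, z, hz, rfl⟩))

end FanOps

lemma exists_last_false {V : Type} {X : List (V × Bool)} (h : ∃ x ∈ X, x.2 = false) :
    ∃ M₁ p M₂, X = M₁ ++ (p, false) :: M₂ ∧ ∀ x ∈ M₂, x.2 = true := by
  induction X with
  | nil => simp at h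
  | cons a X ih =>
    by_cases hX : ∃ x ∈ X, x.2 = false
    · obtain ⟨M₁, p, M₂, rfl, hM⟩ := ih hX
      exact ⟨a :: M₁, p, M₂, rfl, hM⟩
    · obtain ⟨x, hx, hx2⟩ := h
      rcases List.mem_cons.1 hx with rfl | hx
      · refine ⟨[], x.1, X, ?_, fun y hy => ?_⟩
        · rw [← hx2]; rfl
        · by_contra hy2
          exact hX ⟨y, hy, by simpa using hy2⟩
      · exact absurd ⟨x, hx, hx2⟩ hX

section Canonical

variable {V : Type} [DecidableEq V] {N : V → Finset V} {l r : V} {U : Finset V}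
  {E : Set (Sym2 V)} {L M R : List (V × Bool)} {k : ℕ} {p q v : V} {t tq : Bool} {gs : List V}

/-- A new vertex over a subpath that contains a pocket. -/
lemma HasDiagram.coverPocket
    (h : HasDiagram l r U E (L ++ (p, t) :: (M ++ (q, tq) :: R)) k)
    (hM : ∃ x ∈ (p, t) :: M, x.2 = false)
    (hF : Fan N v (p :: (M.map Prod.fst ++ [q])) gs) (hgs : gs.Nodup)
    (hgU : ∀ g ∈ gs, g ∉ U) (hv : v ∉ U) (hvg : v ∉ gs) :
    ∃ tv, HasDiagram l r (insert v U ∪ gs.toFinset)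
      (E ∪ spokes v (p :: (M.map Prod.fst ++ [q])) ∪ faceEdges N gs)
      (L ++ (p, true) :: (v, tv) :: (q, tq) :: R) (k + 1) ∧
      ((∃ X x, (p, t) :: M = X ++ [(x, true)]) → tv = true) := by
  obtain ⟨M₁, a, M₂, hX, hM₂⟩ := exists_last_false hM
  have hmap : p :: (M.map Prod.fst ++ [q]) =
      M₁.map Prod.fst ++ a :: (M₂.map Prod.fst ++ [q]) := by
    have := congrArg (List.map Prod.fst) hX
    simp only [List.map_cons, List.map_append] at this
    rw [← List.cons_append, this]
    simp
  have hpath : (p, t) :: (M ++ (q, tq) :: R) =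
      M₁ ++ (a, false) :: (M₂ ++ (q, tq) :: R) := by
    rw [← List.cons_append, hX]
    simp
  rw [hpath] at h
  rw [hmap] at hF ⊢
  refine ⟨!M₂.isEmpty, h.stepLeft hM₂ hF hgs hgU hv hvg ?_, ?_⟩
  · cases M₁ with
    | nil => simp at hX; simp [hX.1.1]
    | cons b M₁ => simp at hX; simp [← hX.1]
  · rintro ⟨X, x, hx⟩
    rw [hX] at hx
    cases M₂ with
    | nil => simpa using congrArg List.getLast? hx
    | cons => rfl

/-- A new vertex over an arbitrary subpath. -/
lemma HasDiagram.cover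
    (h : HasDiagram l r U E (L ++ (p, t) :: (M ++ (q, tq) :: R)) k)
    (hF : Fan N v (p :: (M.map Prod.fst ++ [q])) gs) (hgs : gs.Nodup)
    (hgU : ∀ g ∈ gs, g ∉ U) (hv : v ∉ U) (hvg : v ∉ gs) :
    ∃ tp tv, HasDiagram l r (insert v U ∪ gs.toFinset)
      (E ∪ spokes v (p :: (M.map Prod.fst ++ [q])) ∪ faceEdges N gs)
      (L ++ (p, tp) :: (v, tv) :: (q, tq) :: R) (k + 1) ∧
      (M = [] ∨ (∃ X x, (p, t) :: M = X ++ [(x, true)]) → tv = true) := by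
  by_cases hM : ∀ x ∈ M, x.2 = true
  · exact ⟨_, _, h.stepRight hM hF hgs hgU hv hvg, fun _ => rfl⟩
  · push Not at hM
    obtain ⟨x, hx, hx2⟩ := hM
    obtain ⟨tv, h1, h2⟩ := h.coverPocket ⟨x, by simp [hx], by simpa using hx2⟩ hF hgs hgU hv hvg
    refine ⟨_, tv, h1, ?_⟩
    rintro (rfl | h')
    · simp at hx
    · exact h2 h'

/-- Diagrams of canonical constructions, with one face vertex in each inner face. -/
lemma BuiltF.exists_hasDiagram {v1 v2 : V} {S W : Finset V} {P us : List V}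
    (h : BuiltF N v1 v2 W P E us) (hWS : W ⊆ S) (hus : us.Nodup) (hS : ∀ g ∈ us, g ∉ S) :
    ∃ P' k X x t, P'.map Prod.fst = P ∧ k + 2 = W.card ∧ P' = X ++ [(x, t), (v2, false)] ∧
      (t = true ∨ X = [] ∧ W.card = 2) ∧
      HasDiagram v1 v1 (W ∪ us.toFinset) (E ∪ {s(v1, v2)} ∪ faceEdges N us) P' k := by
  induction h with
  | base hne =>
    refine ⟨_, 0, [], v1, false, ?_, ?_, rfl, Or.inr ⟨rfl, ?_⟩, ?_⟩
    · simp
    · rw [Finset.card_pair hne]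
    · rw [Finset.card_pair hne]
    · have := HasDiagram.base hne
      rw [Finset.pair_comm] at this
      simp only [List.toFinset_nil, Finset.union_empty]
      refine this.mono ?_
      rintro e ((he | he) | ⟨g, hg, -⟩)
      · exact he.elim
      · exact he
      · simp at hg
  | @step W L Q R p q v E us gs hB hvW hF ih =>
    rw [List.nodup_append] at hus
    obtain ⟨hgs, hus, hdis⟩ := hus
    obtain ⟨P', k, X, x, t', hP', hk, hX, ht', hD⟩ := ih
      (fun y hy => hWS (Finset.mem_insert_of_mem hy)) hus (fun g hg => hS g (by simp [hg]))
    obtain ⟨L', Y, rfl, rfl, hY⟩ := List.map_eq_append_iff.1 hP'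
    obtain ⟨⟨p', t⟩, Y₁, rfl, rfl, hY₁⟩ := List.map_eq_cons_iff.1 hY
    obtain ⟨M, Y₂, rfl, rfl, hY₂⟩ := List.map_eq_append_iff.1 hY₁
    obtain ⟨⟨q', tq⟩, R', rfl, rfl, rfl⟩ := List.map_eq_cons_iff.1 hY₂
    have hvS : v ∈ S := hWS (by simp)
    have hgW : ∀ g ∈ gs, g ∉ W ∪ us.toFinset := by
      intro g hg hgW
      rcases Finset.mem_union.1 hgW with hgW | hgu
      · exact hS g (by simp [hg]) (hWS (Finset.mem_insert_of_mem hgW))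
      · exact hdis g hg g (by simpa using hgu) rfl
    have hvU : v ∉ W ∪ us.toFinset := by
      intro hvU
      rcases Finset.mem_union.1 hvU with hvU | hvu
      · exact hvW hvU
      · exact hS v (by simp at hvu; simp [hvu]) hvS
    obtain ⟨tp, tv, hD', htv⟩ := hD.cover hF hgs hgW hvU (fun hvg => hS v (by simp [hvg]) hvS)
    have hset : insert v (W ∪ us.toFinset) ∪ gs.toFinset = insert v W ∪ (gs ++ us).toFinset := by
      ext y
      simp only [Finset.mem_union, Finset.mem_insert, List.mem_toFinset, List.mem_append]
      clear * -
      tauto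
    rw [hset] at hD'
    have hD' := hD'.mono (E' := E ∪ {e | ∃ z ∈ p' :: (M.map Prod.fst ++ [q']), e = s(v, z)} ∪
        {s(v1, v2)} ∪ faceEdges N (gs ++ us)) (by
      rintro e (((he | he) | he) | ⟨g, hg, z, hz, rfl⟩)
      · exact Or.inl (Or.inl (Or.inl (Or.inl he)))
      · exact Or.inl (Or.inr he)
      · exact Or.inl (Or.inl (Or.inl (Or.inr he)))
      · rcases List.mem_append.1 hg with hg | hg
        · exact Or.inr ⟨g, hg, z, hz, rfl⟩
        · exact Or.inl (Or.inl (Or.inr ⟨g, hg, z, hz, rfl⟩)))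
    have hcard : k + 1 + 2 = (insert v W).card := by
      rw [Finset.card_insert_of_notMem hvW]; omega
    rcases List.eq_nil_or_concat R' with rfl | ⟨R₀, z, rfl⟩
    · have e1 : (L' ++ (p', t) :: M) ++ [(q', tq)] = (X ++ [(x, t')]) ++ [(v2, false)] := by
        simpa using hX
      obtain ⟨e2, e3⟩ := List.append_inj' e1 rfl
      have htv' : tv = true := htv (by
        rcases ht' with rfl | ⟨rfl, -⟩
        · right
          rcases List.eq_nil_or_concat M with rfl | ⟨M₀, z, rfl⟩
          · obtain ⟨-, e4⟩ := List.append_inj' e2 rfl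
            exact ⟨[], x, e4⟩
          · rw [List.concat_eq_append] at e2 ⊢
            have e5 : (L' ++ (p', t) :: M₀) ++ [z] = X ++ [(x, true)] := by simpa using e2
            obtain ⟨-, e4⟩ := List.append_inj' e5 rfl
            exact ⟨(p', t) :: M₀, x, by rw [← e4]; rfl⟩
        · left
          have := congrArg List.length e2
          simp at this
          exact List.eq_nil_of_length_eq_zero (by omega))
      refine ⟨_, k + 1, L' ++ [(p', tp)], v, tv, ?_, hcard, ?_, Or.inl htv', hD'⟩
      · simp
      · rw [e3]; simp
    · rw [List.concat_eq_append] at hX hD' ⊢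
      have e1 : (L' ++ (p', t) :: (M ++ (q', tq) :: R₀)) ++ [z] =
          (X ++ [(x, t')]) ++ [(v2, false)] := by simpa using hX
      obtain ⟨e2, e3⟩ := List.append_inj' e1 rfl
      obtain ⟨Y, z', hz'⟩ : ∃ Y z', (q', tq) :: R₀ = Y ++ [z'] :=
        (List.eq_nil_or_concat ((q', tq) :: R₀)).elim (by simp)
          (fun ⟨Y, z', h'⟩ => ⟨Y, z', by simpa using h'⟩)
      have e4 : (L' ++ (p', t) :: (M ++ Y)) ++ [z'] = X ++ [(x, t')] := by
        rw [← e2, hz']; simp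
      obtain ⟨e5, e6⟩ := List.append_inj' e4 rfl
      refine ⟨_, k + 1, L' ++ (p', tp) :: (v, tv) :: Y, x, t', ?_, hcard, ?_, ?_, hD'⟩
      · simp
      · rw [← List.cons_append, hz', e6, e3]; simp
      · rcases ht' with ht' | ⟨rfl, -⟩
        · exact Or.inl ht'
        · simp at e5

end Canonical

section Final

variable {V : Type} [DecidableEq V] {T : SimpleGraph V} {S F : Finset V} {N : V → Finset V}
  {v1 v2 c o : V} {P us gs : List V} {E : Set (Sym2 V)}

/-- The diagram of a triangulation with a face vertex in every face. -/
lemma IsCanonical.exists_hasDiagram (h : IsCanonical T S F N v1 v2 c o P E us gs) (hc : c ∈ S)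
    (ho : o ∉ S) (hF : ∀ g ∈ F, g ∉ S) (hN : N o = {v1, v2, c}) :
    HasDiagram o v1 (insert o (S ∪ (gs ++ us).toFinset))
      (E ∪ {s(v1, v2)} ∪ spokes c P ∪ faceEdges N (gs ++ us) ∪ faceEdges N [o]) []
      (S.card - 4) := by
  have hnd := List.nodup_append.1 h.nodup
  have hcS : (S.erase c).card + 1 = S.card := Finset.card_erase_add_one hc
  have hfS : ∀ g ∈ gs ++ us, g ∉ S := fun g hg => hF g (h.mem_faces g hg)
  obtain ⟨P', k, X, x, t, hP', hk, hX, ht, hD⟩ := h.built.exists_hasDiagram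
    (Finset.erase_subset c S) hnd.2.1 (fun g hg => hfS g (by simp [hg]))
  obtain ⟨t₀, M, hM, hlast⟩ : ∃ t₀ M, P' = (v1, t₀) :: (M ++ [(v2, false)]) ∧
      (v1, t₀) :: M = X ++ [(x, t)] := by
    have hhead := h.built.head_last.1
    rw [← hP', hX] at hhead
    cases X with
    | nil =>
      simp at hhead
      exact ⟨t, [], by rw [hX, hhead]; rfl, by rw [hhead]; rfl⟩
    | cons a X =>
      simp at hhead
      exact ⟨a.2, X ++ [(x, t)], by rw [hX, ← hhead]; simp, by rw [← hhead]; simp⟩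
  have hPM : P = v1 :: (M.map Prod.fst ++ [v2]) := by rw [← hP', hM]; simp
  have hfan := h.fan
  have hcU : c ∉ S.erase c ∪ us.toFinset := by
    intro hcU
    rcases Finset.mem_union.1 hcU with h' | h'
    · simp at h'
    · exact hfS c (by simp at h'; simp [h']) hc
  have hcg : c ∉ gs := fun h' => hfS c (by simp [h']) hc
  have hgU : ∀ g ∈ gs, g ∉ S.erase c ∪ us.toFinset := by
    intro g hg h'
    rcases Finset.mem_union.1 h' with h' | h'
    · exact hfS g (by simp [hg]) (Finset.mem_of_mem_erase h')
    · exact hnd.2.2 g hg g (by simpa using h') rfl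
  have hset : insert c (S.erase c ∪ us.toFinset) ∪ gs.toFinset = S ∪ (gs ++ us).toFinset := by
    rw [← Finset.insert_union, Finset.insert_erase hc, List.toFinset_append, Finset.union_assoc,
      Finset.union_comm gs.toFinset]
  have hoU : o ∉ S ∪ (gs ++ us).toFinset := by
    rw [Finset.mem_union, List.mem_toFinset, not_or]
    exact ⟨ho, h.outer_notMem⟩
  rw [hM] at hD
  by_cases hpk : ∃ y ∈ (v1, t₀) :: M, y.2 = false
  · obtain ⟨tv, h1, htv⟩ := HasDiagram.coverPocket (L := []) (R := []) hD hpk (hPM ▸ hfan)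
      hnd.1 hgU hcU hcg
    rw [hset] at h1
    have h2 := h1.addOuter hoU (x := (c, tv)) (y := (v2, false)) (by simp) (by simp)
    have hk' : k + 1 - List.countP (·.2) ([] ++ [(v1, true), (c, tv), (v2, false)]) =
        S.card - 4 := by
      cases tv with
      | true => simp; omega
      | false =>
        rcases ht with rfl | ⟨-, hW⟩
        · exact absurd (htv ⟨X, x, hlast⟩) (by simp)
        · simp; omega
    rw [hk'] at h2
    refine h2.mono ?_
    rintro e ((((he | he) | he) | ⟨g, hg, z, hz, rfl⟩) | ⟨g, hg, z, hz, rfl⟩)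
    · exact Or.inl (Or.inl (Or.inl (Or.inl (Or.inl he))))
    · exact Or.inl (Or.inl (Or.inl (Or.inl (Or.inr he))))
    · exact Or.inl (Or.inl (Or.inr (hPM ▸ he)))
    · rcases List.mem_append.1 hg with hg | hg
      · exact Or.inl (Or.inr ⟨g, hg, z, hz, rfl⟩)
      · exact Or.inl (Or.inl (Or.inl (Or.inr ⟨g, hg, z, hz, rfl⟩)))
    · rw [List.mem_singleton] at hg
      subst hg
      rw [hN] at hz
      simp only [Finset.mem_insert, Finset.mem_singleton] at hz
      rcases hz with rfl | rfl | rfl <;> simp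
  · have hall : ∀ y ∈ (v1, t₀) :: M, y.2 = true := by
      intro y hy
      by_contra hy2
      exact hpk ⟨y, hy, by simpa using hy2⟩
    have h0 := hD.addLeft hcU
    have h1 := HasDiagram.closeRight (L := []) (R := []) (M := (v1, t₀) :: M) h0 hall
      (N := N) (gs := gs) (by rw [hPM] at hfan; simpa using hfan) hnd.1 (by
        intro g hg
        rw [Finset.mem_insert, not_or]
        exact ⟨fun h' => hcg (h' ▸ hg), hgU g hg⟩) (by simp)
    rw [hset] at h1
    have h2 := h1.addOuter hoU (x := (c, true)) (y := (v2, false)) (by simp) (by simp)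
    have hk' : k - List.countP (·.2) ([] ++ [(c, false || !((v1, t₀) :: M).isEmpty),
        (v2, false)]) = S.card - 4 := by
      simp; omega
    rw [hk'] at h2
    refine h2.mono ?_
    rintro e ((((he | he) | he) | ⟨g, hg, z, hz, rfl⟩) | ⟨g, hg, z, hz, rfl⟩)
    · exact Or.inl (Or.inl (Or.inl (Or.inl (Or.inl (Or.inl he)))))
    · exact Or.inl (Or.inl (Or.inl (Or.inl (Or.inl (Or.inr he)))))
    · refine Or.inl (Or.inl (Or.inr ?_))
      rw [hPM] at he
      exact he
    · rcases List.mem_append.1 hg with hg | hg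
      · exact Or.inl (Or.inr ⟨g, hg, z, hz, rfl⟩)
      · exact Or.inl (Or.inl (Or.inl (Or.inl (Or.inr ⟨g, hg, z, hz, rfl⟩))))
    · rw [List.mem_singleton] at hg
      subst hg
      rw [hN] at hz
      simp only [Finset.mem_insert, Finset.mem_singleton] at hz
      rcases hz with rfl | rfl | rfl <;> simp

end Final

/-- The neighbours of a vertex as a finset. -/
noncomputable def nbrFinset {V : Type} [Fintype V] (G : SimpleGraph V) (v : V) : Finset V :=
  (Set.toFinite (G.neighborSet v)).toFinset

lemma mem_nbrFinset {V : Type} [Fintype V] {G : SimpleGraph V} {v y : V} :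
    y ∈ nbrFinset G v ↔ G.Adj v y := by
  simp [nbrFinset]

lemma IsKleetopeOf.isFullSystem {V : Type} [Fintype V] [DecidableEq V] {G : SimpleGraph V}
    {S : Finset V} (h : IsKleetopeOf G S) : IsFullSystem G S Sᶜ (nbrFinset G) := by
  obtain ⟨⟨-, ⟨D⟩, -⟩, ⟨h3, -, -⟩, hf, hcard⟩ := h
  refine ⟨⟨fun f hf' y hy => ?_, fun f hf' => ?_, fun f hf' a ha b hb => ?_, ?_⟩, ?_, ?_⟩
  · exact (hf f (by simpa using hf')).2.1 (mem_nbrFinset.1 hy)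
  · rw [nbrFinset, ← Set.ncard_eq_toFinset_card]
    exact (hf f (by simpa using hf')).1
  · exact (hf f (by simpa using hf')).2.2 a (mem_nbrFinset.1 ha) b (mem_nbrFinset.1 hb)
  · intro X hXS hX hdis g hg hgF hadj
    refine D.no_minor X hX hdis g hg (fun i j hij => ?_) (fun i j => ?_)
    · have := hgF i
      simp at this
      exact this (hXS j hij)
    · obtain ⟨y, hy, hyX⟩ := hadj i j
      exact ⟨y, hyX, (mem_nbrFinset.1 hy).symm⟩
  · simpa using h3
  · rw [Finset.card_compl]
    have := S.card_le_univ
    omega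

lemma HasDiagram.exists_arcDiagram {V : Type} [Fintype V] [DecidableEq V] {G : SimpleGraph V}
    {l r : V} {U : Finset V} {E : Set (Sym2 V)} {P : List (V × Bool)} {k : ℕ}
    (h : HasDiagram l r U E P k) (hU : ∀ x, x ∈ U) (hE : ∀ x y, G.Adj x y → s(x, y) ∈ E) :
    ∃ A : ArcDiagram V, A.IsPlaneOn G Set.univ ∧ A.biarcCount G Set.univ ≤ k := by
  obtain ⟨A, Es, Z, Up, Lo, b, hR, hEs, -, -, hb⟩ := h
  have hmem : ∀ e ∈ edgesWithin G Set.univ, e ∈ Es := by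
    rintro e ⟨he, -⟩
    induction e using Sym2.ind with
    | _ x y => exact hEs _ (hE x y he)
  refine ⟨A, ⟨fun x _ y _ hxy => hR.inj (hU x) (hU y) hxy, fun e he hk => ?_,
    fun e he f hf hef => hR.cross_inj e (hmem e he) f (hmem f hf) hef,
    fun e he f hf _ => ⟨fun p hp q hq => ?_, fun p hp q hq => ?_⟩⟩, ?_⟩
  · obtain ⟨h1, h2, h3, -⟩ := hR.cross e (hmem e he) hk
    exact ⟨h1, h2, fun x _ => h3 x (hU x)⟩
  · exact hR.up_nc p (hR.up_mem e (hmem e he) p hp) q (hR.up_mem f (hmem f hf) q hq)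
  · exact hR.lo_nc p (hR.lo_mem e (hmem e he) p hp) q (hR.lo_mem f (hmem f hf) q hq)
  · have hsub : {e | e ∈ edgesWithin G Set.univ ∧ A.kind e = ArcKind.biarc} ⊆
        ((Es.filter fun e => A.kind e = ArcKind.biarc : Finset (Sym2 V)) : Set (Sym2 V)) := by
      rintro e ⟨he, hk⟩
      simp [hmem e he, hk]
    have h1 := Set.ncard_le_ncard hsub (Finset.finite_toSet _)
    rw [Set.ncard_coe_finset] at h1
    have h2 := hR.count
    unfold ArcDiagram.biarcCount
    omega

/-- Every Kleetope on `n` vertices admits a monotone plane arc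
diagram with at most `⌊(n-8)/3⌋` biarcs, where every biarc is down-up. -/
theorem kleetope_arc_diagram_few_biarcs {V : Type} [Fintype V] [DecidableEq V]
    (G : SimpleGraph V) (hG : ∃ S : Finset V, IsKleetopeOf G S) :
    ∃ A : ArcDiagram V, A.IsPlaneOn G Set.univ ∧
      A.biarcCount G Set.univ ≤ (Fintype.card V - 8) / 3 := by
  obtain ⟨S, hS⟩ := hG
  have hfull := hS.isFullSystem
  have hcut : NoTwoCut G S := hfull.noTwoCut hS.2.1.2.2
  have hcard := hS.2.2.2
  have h3 := hfull.three_le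
  obtain ⟨o, ho⟩ : (Sᶜ : Finset V).Nonempty := by
    rw [← Finset.card_pos]
    have := hfull.card_eq
    omega
  obtain ⟨v1, v2, c, -, -, -, hN⟩ := Finset.card_eq_three.1 (hfull.card o ho)
  obtain ⟨P, E, us, gs, hcan⟩ := hfull.exists_canonical hcut ho hN
  have hcS : c ∈ S := hfull.sub o ho (by rw [hN]; simp)
  have hface : ∀ f, f ∉ S → f ∈ gs ++ us ∨ f = o := by
    intro f hf
    rcases hcan.cover f (by simpa using hf) with h | h | h <;> simp [h]
  have hD := hcan.exists_hasDiagram hcS (by simpa using ho) (fun g hg => by simpa using hg) hN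
  have hk : S.card - 4 = (Fintype.card V - 8) / 3 := by omega
  rw [hk] at hD
  have hfe : ∀ f y, f ∉ S → G.Adj f y → s(f, y) ∈ E ∪ {s(v1, v2)} ∪ spokes c P ∪
      faceEdges (nbrFinset G) (gs ++ us) ∪ faceEdges (nbrFinset G) [o] := by
    intro f y hf hy
    rcases hface f hf with h | rfl
    · exact Or.inl (Or.inr ⟨f, h, y, mem_nbrFinset.2 hy, rfl⟩)
    · exact Or.inr ⟨f, by simp, y, mem_nbrFinset.2 hy, rfl⟩
  refine hD.exists_arcDiagram (fun x => ?_) (fun x y hxy => ?_)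
  · by_cases hx : x ∈ S
    · simp [hx]
    · rcases hface x hx with h | rfl
      · simp only [Finset.mem_insert, Finset.mem_union, List.mem_toFinset, h, or_true]
      · simp
  · by_cases hx : x ∈ S
    swap
    · exact hfe x y hx hxy
    by_cases hy : y ∈ S
    swap
    · rw [Sym2.eq_swap (a := x) (b := y)]
      exact hfe y x hy hxy.symm
    by_cases hxc : x = c
    · subst hxc
      exact Or.inl (Or.inl (Or.inr ⟨y, hcan.adj_last y hy hxy, rfl⟩))
    by_cases hyc : y = c
    · subst hyc
      exact Or.inl (Or.inl (Or.inr ⟨x, hcan.adj_last x hx hxy.symm, Sym2.eq_swap⟩))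
    exact Or.inl (Or.inl (Or.inl (hcan.adj_edge x (Finset.mem_erase.2 ⟨hxc, hx⟩) y
      (Finset.mem_erase.2 ⟨hyc, hy⟩) hxy)))
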